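/- Consider the linear hyperbolic system ∂_t u + a(x,t)∂_x u + b(x,t)u = 0 on (0,1)×ℝ with the reflection boundary conditions, where a = diag(a₁,…,aₙ) and b = (b_{jk}) have bounded continuous partial derivatives up to first order on [0,1]×ℝ, a satisfies the Λ₀-condition, and (H3) holds. Let {U(t,s)}_{t≥s} be the evolution family on L²((0,1);ℝⁿ) generated by this problem. Then there exists d > 0, not depending on s ∈ ℝ, such that for all s ∈ ℝ and all t ≥ s + 2d, the operator U(t,s) is smoothing from L²((0,1);ℝⁿ) to C¹([0,1];ℝⁿ): there is a bounded linear operator V from L²((0,1);ℝⁿ) to C¹([0,1];ℝⁿ) whose composition with the inclusion C¹ ↪ L² equals U(t,s). -/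

import Mathlib

noncomputable section

open MeasureTheory Set Filter

/-- `ℝⁿ` with the Euclidean norm. -/
abbrev Vn (n : ℕ) : Type := EuclideanSpace ℝ (Fin n)

/-- The strip `[0,1] × ℝ`. -/
def strip : Set (ℝ × ℝ) := Set.Icc (0:ℝ) 1 ×ˢ (Set.univ : Set ℝ)

/-- `g` is `C^k` on the strip `[0,1] × ℝ` with the function and all its partial
derivatives up to order `k` bounded by `C` there (the `BC^k`-norm is `≤ C`). -/
def BCle (k : ℕ) (g : ℝ → ℝ → ℝ) (C : ℝ) : Prop :=
  ContDiffOn ℝ k (fun q : ℝ × ℝ => g q.1 q.2) strip ∧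
  ∀ i : ℕ, i ≤ k → ∀ q ∈ strip,
    ‖iteratedFDerivWithin ℝ i (fun q : ℝ × ℝ => g q.1 q.2) strip q‖ ≤ C

/-- The reflection boundary conditions relating the boundary values
`w0 = u(0,t)` and `w1 = u(1,t)`. -/
def BCrel (n m : ℕ) (p : Fin n → Fin n → ℝ) (w0 w1 : Vn n) : Prop :=
  ∀ j : Fin n,
    ((j : ℕ) < m →
      w0 j = ∑ k : Fin n, if m ≤ (k : ℕ) then p j k * w0 k else p j k * w1 k) ∧
    (m ≤ (j : ℕ) →
      w1 j = ∑ k : Fin n, if m ≤ (k : ℕ) then p j k * w0 k else p j k * w1 k)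

/-- Assumption (H3). -/
def H3cond (n : ℕ) (p : Fin n → Fin n → ℝ) : Prop :=
  ∀ i : Fin (n + 1) → Fin n, ∏ l : Fin n, p (i l.castSucc) (i l.succ) = 0

/-- The `Λ₀`-condition on the diagonal coefficients `a`. -/
def LamCond (n m : ℕ) (Λ₀ : ℝ) (a : ℝ → ℝ → Fin n → ℝ) : Prop :=
  ∀ x ∈ Set.Icc (0:ℝ) 1, ∀ t : ℝ,
    (∀ j : Fin n, ((j : ℕ) < m → Λ₀ ≤ a x t j) ∧ (m ≤ (j : ℕ) → a x t j ≤ -Λ₀)) ∧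
    ∀ j k : Fin n, j ≠ k → Λ₀ ≤ |a x t j - a x t k|

/-- A classical solution `u` (with partial derivatives `ux`, `ut`) of the linear
problem `∂ₜu + a ∂ₓu + b u = f` on `[0,1] × [s,∞)` with the reflection boundary
conditions and initial datum `φ` at time `s`. -/
def IsLinSol (n m : ℕ) (p : Fin n → Fin n → ℝ)
    (a : ℝ → ℝ → Fin n → ℝ) (b : ℝ → ℝ → Fin n → Fin n → ℝ)
    (f : ℝ → ℝ → Fin n → ℝ) (s : ℝ) (φ : ℝ → Vn n)
    (u ux ut : ℝ → ℝ → Vn n) : Prop :=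
  ContinuousOn (fun q : ℝ × ℝ => u q.1 q.2) (Set.Icc 0 1 ×ˢ Set.Ici s) ∧
  ContinuousOn (fun q : ℝ × ℝ => ux q.1 q.2) (Set.Icc 0 1 ×ˢ Set.Ici s) ∧
  ContinuousOn (fun q : ℝ × ℝ => ut q.1 q.2) (Set.Icc 0 1 ×ˢ Set.Ici s) ∧
  (∀ x ∈ Set.Icc (0:ℝ) 1, ∀ t ∈ Set.Ici s, ∀ j : Fin n,
    HasDerivWithinAt (fun y => u y t j) (ux x t j) (Set.Icc 0 1) x ∧
    HasDerivWithinAt (fun τ => u x τ j) (ut x t j) (Set.Ici s) t) ∧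
  (∀ x ∈ Set.Icc (0:ℝ) 1, ∀ t ∈ Set.Ici s, ∀ j : Fin n,
    ut x t j + a x t j * ux x t j + ∑ k : Fin n, b x t j k * u x t k = f x t j) ∧
  (∀ t ∈ Set.Ici s, BCrel n m p (u 0 t) (u 1 t)) ∧
  (∀ x ∈ Set.Icc (0:ℝ) 1, u x s = φ x)

/-- Lebesgue measure restricted to `(0,1)`. -/
abbrev μ01 : Measure ℝ := volume.restrict (Set.Ioo (0:ℝ) 1)

/-- The space `L²((0,1); ℝⁿ)`. -/
abbrev L2 (n : ℕ) := Lp (Vn n) 2 μ01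

/-- An evolution family of bounded linear operators. -/
def IsEvoFam {X : Type*} [NormedAddCommGroup X] [NormedSpace ℝ X]
    (U : ℝ → ℝ → X →L[ℝ] X) : Prop :=
  (∀ t : ℝ, U t t = ContinuousLinearMap.id ℝ X) ∧
  (∀ s r t : ℝ, s ≤ r → r ≤ t → ∀ x : X, U t r (U r s x) = U t s x)

/-- `U` is the evolution family on `L²((0,1);ℝⁿ)` generated by the linear
problem with coefficients `a`, `b`: it is a strongly continuous, exponentially
bounded evolution family which, on `C¹` data with compact support in `(0,1)`,
is given by the classical solutions. -/
def GeneratedBy (n m : ℕ) (p : Fin n → Fin n → ℝ)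
    (a : ℝ → ℝ → Fin n → ℝ) (b : ℝ → ℝ → Fin n → Fin n → ℝ)
    (U : ℝ → ℝ → L2 n →L[ℝ] L2 n) : Prop :=
  IsEvoFam U ∧
  (∀ φ : L2 n, ContinuousOn (fun q : ℝ × ℝ => U q.1 q.2 φ) {q : ℝ × ℝ | q.2 ≤ q.1}) ∧
  (∃ K : ℝ, 1 ≤ K ∧ ∃ ν : ℝ, ∀ s t : ℝ, s ≤ t →
    ‖U t s‖ ≤ K * Real.exp (ν * (t - s))) ∧
  ∀ s : ℝ, ∀ φ : ℝ → Vn n, ContDiff ℝ 1 φ → tsupport φ ⊆ Set.Ioo 0 1 →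
    ∀ φh : L2 n, (∀ᵐ x ∂μ01, φh x = φ x) →
    ∀ u ux ut : ℝ → ℝ → Vn n,
      IsLinSol n m p a b (fun _ _ _ => 0) s φ u ux ut →
      ∀ t : ℝ, s ≤ t → ∀ᵐ x ∂μ01, (U t s φh) x = u x t

/-- Exponential dichotomy on `ℝ` with exponent `α` and bound `M`. -/
def HasExpDichotomy {X : Type*} [NormedAddCommGroup X] [NormedSpace ℝ X]
    (U : ℝ → ℝ → X →L[ℝ] X) (α M : ℝ) : Prop :=
  ∃ P : ℝ → X →L[ℝ] X, ∃ W : ℝ → ℝ → X →L[ℝ] X,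
    (∀ t, (P t).comp (P t) = P t) ∧
    (∀ x : X, Continuous fun t => P t x) ∧
    (∀ x : X, ∃ C : ℝ, ∀ t, ‖P t x‖ ≤ C) ∧
    (∀ s t : ℝ, s ≤ t → (U t s).comp (P s) = (P t).comp (U t s)) ∧
    (∀ s t : ℝ, s ≤ t → ∀ x : X, W s t (U t s (x - P s x)) = x - P s x) ∧
    (∀ s t : ℝ, s ≤ t → ∀ x : X, U t s (W s t (x - P t x)) = x - P t x) ∧
    (∀ s t : ℝ, s ≤ t → ∀ x : X, P s (W s t (x - P t x)) = 0) ∧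
    (∀ s t : ℝ, s ≤ t → ‖(U t s).comp (P s)‖ ≤ M * Real.exp (-α * (t - s))) ∧
    (∀ s t : ℝ, s ≤ t →
      ‖(W s t).comp (ContinuousLinearMap.id ℝ X - P t)‖ ≤ M * Real.exp (-α * (t - s)))

section Part1

abbrev I01 : Set ℝ := Set.Icc (0:ℝ) 1

def pj (x : ℝ) : ℝ := max 0 (min 1 x)

lemma pj_mem (x : ℝ) : pj x ∈ I01 := by
  unfold pj; constructor
  · exact le_max_left _ _
  · exact max_le zero_le_one (min_le_left _ _)

lemma pj_of_mem {x : ℝ} (h : x ∈ I01) : pj x = x := by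
  unfold pj; rw [min_eq_right h.2, max_eq_right h.1]

lemma pj_cont : Continuous pj := by unfold pj; fun_prop

lemma pj_pj (x : ℝ) : pj (pj x) = pj x := pj_of_mem (pj_mem x)

lemma pj_lip (x y : ℝ) : |pj x - pj y| ≤ |x - y| := by
  unfold pj
  calc _ ≤ |min 1 x - min 1 y| := by
        have := abs_max_sub_max_le_max 0 (min 1 x) 0 (min 1 y)
        simpa using this
    _ ≤ _ := by
        have := abs_min_sub_min_le_max 1 x 1 y
        simpa using this

lemma abs_sub_le_one_of_mem {x y : ℝ} (hx : x ∈ I01) (hy : y ∈ I01) : |x - y| ≤ 1 := by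
  rw [abs_le]; constructor <;> linarith [hx.1, hx.2, hy.1, hy.2]

lemma uIcc_sub_I {x y : ℝ} (hx : x ∈ I01) (hy : y ∈ I01) : uIcc x y ⊆ I01 :=
  uIcc_subset_Icc hx hy

/-- FTC on the unit interval for functions differentiable within it. -/
lemma ftcI {h h' : ℝ → ℝ} {a b : ℝ} (ha : a ∈ I01) (hb : b ∈ I01) (hc : Continuous h')
    (hd : ∀ x ∈ I01, HasDerivWithinAt h (h' x) I01 x) : ∫ x in a..b, h' x = h b - h a := by
  apply intervalIntegral.integral_eq_sub_of_hasDeriv_right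
  · intro x hx
    exact ((hd x (uIcc_sub_I ha hb hx)).continuousWithinAt).mono (uIcc_sub_I ha hb)
  · intro x hx
    have hx' : x ∈ Ioo (0:ℝ) 1 := ⟨lt_of_le_of_lt (le_min ha.1 hb.1) hx.1,
      lt_of_lt_of_le hx.2 (max_le ha.2 hb.2)⟩
    exact ((hd x (Ioo_subset_Icc_self hx')).hasDerivAt
      (Icc_mem_nhds hx'.1 hx'.2)).hasDerivWithinAt
  · exact hc.intervalIntegrable _ _

lemma prim_deriv {f : ℝ → ℝ} (hf : Continuous f) (a x : ℝ) :
    HasDerivAt (fun y => ∫ t in a..y, f t) (f x) x :=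
  intervalIntegral.integral_hasDerivAt_right (hf.intervalIntegrable _ _)
    (hf.stronglyMeasurableAtFilter _ _) hf.continuousAt

/-- Scalar characteristic slope data. -/
structure Slope (α αt : ℝ → ℝ → ℝ) (δ L : ℝ) : Prop where
  c : Continuous fun q : ℝ × ℝ => α q.1 q.2
  ct : Continuous fun q : ℝ × ℝ => αt q.1 q.2
  d : ∀ x t, HasDerivAt (α x) (αt x t) t
  b : ∀ x t, |α x t| ≤ δ
  bt : ∀ x t, |αt x t| ≤ L

variable {α αt : ℝ → ℝ → ℝ} {δ L : ℝ}

lemma Slope.δ0 (h : Slope α αt δ L) : 0 ≤ δ := (abs_nonneg _).trans (h.b 0 0)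
lemma Slope.L0 (h : Slope α αt δ L) : 0 ≤ L := (abs_nonneg _).trans (h.bt 0 0)

lemma Slope.lip (h : Slope α αt δ L) (x : ℝ) : LipschitzWith (Real.toNNReal L) (α x) := by
  apply lipschitzWith_of_nnnorm_deriv_le (fun t => (h.d x t).differentiableAt)
  intro t
  rw [(h.d x t).deriv]
  rw [← NNReal.coe_le_coe, coe_nnnorm, Real.coe_toNNReal _ h.L0]
  exact h.bt x t

def IsCurve (α : ℝ → ℝ → ℝ) (c : ℝ → ℝ) : Prop :=
  Continuous c ∧ ∀ ξ ∈ I01, HasDerivWithinAt c (α ξ (c ξ)) I01 ξ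

lemma Slope.exists_curve (h : Slope α αt δ L) {x : ℝ} (hx : x ∈ I01) (t : ℝ) :
    ∃ c, IsCurve α c ∧ c x = t := by
  have hP : IsPicardLindelof α (⟨x, hx⟩ : Icc (0:ℝ) 1) t (Real.toNNReal δ) 0 (Real.toNNReal δ)
      (Real.toNNReal L) := by
    refine ⟨fun y _ => (h.lip y).lipschitzOnWith, fun y _ => ?_, fun y _ z _ => ?_, ?_⟩
    · exact (h.c.comp (by fun_prop : Continuous fun s : ℝ => (s, y))).continuousOn
    · rw [Real.coe_toNNReal _ h.δ0]; exact h.b y z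
    · rw [Real.coe_toNNReal _ h.δ0]
      have : max (1 - x) (x - 0) ≤ 1 := max_le (by linarith [hx.1]) (by linarith [hx.2])
      simpa using mul_le_of_le_one_right h.δ0 this
  obtain ⟨c, hc0, hc⟩ := hP.exists_eq_forall_mem_Icc_hasDerivWithinAt₀
  refine ⟨fun ξ => c (pj ξ), ⟨?_, fun ξ hξ => ?_⟩, ?_⟩
  · have hcI : ContinuousOn c I01 := fun y hy => (hc y hy).continuousWithinAt
    exact hcI.comp_continuous pj_cont pj_mem
  · simp only [pj_of_mem hξ]
    exact (hc ξ hξ).congr (fun y hy => by simp only [pj_of_mem hy]) (by simp only [pj_of_mem hξ])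
  · simp only [pj_of_mem hx]; exact hc0

/-- mean slope of `αt` between two curves -/
def mslope (αt : ℝ → ℝ → ℝ) (c d : ℝ → ℝ) (η : ℝ) : ℝ :=
  ∫ σ in (0:ℝ)..1, αt η (c η + σ * (d η - c η))

lemma Slope.mslope_cont (h : Slope α αt δ L) {c d : ℝ → ℝ} (hc : Continuous c)
    (hd : Continuous d) : Continuous (mslope αt c d) := by
  unfold mslope
  apply intervalIntegral.continuous_parametric_intervalIntegral_of_continuous'
  exact h.ct.comp (by fun_prop : Continuous fun q : ℝ × ℝ =>
    (q.1, c q.1 + q.2 * (d q.1 - c q.1)))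

lemma Slope.mslope_eq (h : Slope α αt δ L) (c d : ℝ → ℝ) (η : ℝ) :
    mslope αt c d η * (d η - c η) = α η (d η) - α η (c η) := by
  unfold mslope
  rw [← intervalIntegral.integral_mul_const]
  have := intervalIntegral.integral_eq_sub_of_hasDerivAt
    (f := fun σ => α η (c η + σ * (d η - c η)))
    (f' := fun σ => αt η (c η + σ * (d η - c η)) * (d η - c η)) (a := 0) (b := 1) ?_ ?_
  · rw [this]; simp
  · intro σ _
    have h1 := h.d η (c η + σ * (d η - c η))
    have h2 : HasDerivAt (fun σ : ℝ => c η + σ * (d η - c η)) (d η - c η) σ := by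
      simpa using ((hasDerivAt_id σ).mul_const (d η - c η)).const_add (c η)
    exact h1.comp σ h2
  · apply Continuous.intervalIntegrable
    exact (h.ct.comp (by fun_prop : Continuous fun σ : ℝ =>
      (η, c η + σ * (d η - c η)))).mul continuous_const

lemma Slope.mslope_le (h : Slope α αt δ L) (c d : ℝ → ℝ) (η : ℝ) : |mslope αt c d η| ≤ L := by
  unfold mslope
  have := intervalIntegral.norm_integral_le_of_norm_le_const (a := 0) (b := 1) (C := L)
    (f := fun σ => αt η (c η + σ * (d η - c η))) (fun σ _ => h.bt _ _)
  simpa using this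

/-- a function with zero derivative within the interval is constant there -/
lemma const_of_deriv_zero {h : ℝ → ℝ} (hd : ∀ x ∈ I01, HasDerivWithinAt h 0 I01 x)
    {a b : ℝ} (ha : a ∈ I01) (hb : b ∈ I01) : h a = h b := by
  have := ftcI (h := h) (h' := fun _ => 0) ha hb continuous_const hd
  simp at this; linarith

lemma Slope.diff_formula (h : Slope α αt δ L) {c d : ℝ → ℝ} (hc : IsCurve α c)
    (hd : IsCurve α d) {x ξ : ℝ} (hx : x ∈ I01) (hξ : ξ ∈ I01) :
    d ξ - c ξ = (d x - c x) * Real.exp (∫ η in x..ξ, mslope αt c d η) := by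
  set M : ℝ → ℝ := fun ξ => ∫ η in x..ξ, mslope αt c d η with hM
  have key : ∀ y ∈ I01, HasDerivWithinAt (fun y => (d y - c y) * Real.exp (-(M y))) 0 I01 y := by
    intro y hy
    have h1 := (hd.2 y hy).sub (hc.2 y hy)
    have h2 : HasDerivAt M (mslope αt c d y) y := prim_deriv (h.mslope_cont hc.1 hd.1) x y
    have h3 := h1.mul (h2.neg.exp.hasDerivWithinAt (s := I01))
    refine h3.congr_deriv ?_
    have := h.mslope_eq c d y
    simp only [Pi.sub_apply]
    linear_combination (-Real.exp (-(M y))) * this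
  have := const_of_deriv_zero key hξ hx
  have hMx : M x = 0 := by simp [hM]
  rw [hMx] at this
  simp only [neg_zero, Real.exp_zero, mul_one] at this
  rw [← this, mul_assoc, ← Real.exp_add, neg_add_cancel, Real.exp_zero, mul_one]

lemma Slope.abs_int_le (h : Slope α αt δ L) (c d : ℝ → ℝ) {x ξ : ℝ} (hx : x ∈ I01)
    (hξ : ξ ∈ I01) : |∫ η in x..ξ, mslope αt c d η| ≤ L := by
  have := intervalIntegral.norm_integral_le_of_norm_le_const (a := x) (b := ξ) (C := L)
    (f := mslope αt c d) (fun σ _ => h.mslope_le _ _ _)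
  rw [Real.norm_eq_abs] at this
  exact this.trans (mul_le_of_le_one_right h.L0 (abs_sub_le_one_of_mem hξ hx))

lemma Slope.diff_le (h : Slope α αt δ L) {c d : ℝ → ℝ} (hc : IsCurve α c)
    (hd : IsCurve α d) {x ξ : ℝ} (hx : x ∈ I01) (hξ : ξ ∈ I01) :
    |d ξ - c ξ| ≤ Real.exp L * |d x - c x| := by
  rw [h.diff_formula hc hd hx hξ, abs_mul, Real.abs_exp, mul_comm]
  gcongr
  exact (le_abs_self _).trans (h.abs_int_le c d hx hξ)

/-- The characteristic flow. -/
def Slope.Om (h : Slope α αt δ L) (ξ x t : ℝ) : ℝ :=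
  (h.exists_curve (pj_mem x) t).choose (pj ξ)

lemma Slope.Om_pj (h : Slope α αt δ L) (ξ x t : ℝ) : h.Om ξ (pj x) t = h.Om ξ x t := by
  unfold Slope.Om
  have aux : ∀ (y z : ℝ) (hy : y ∈ I01) (hz : z ∈ I01), y = z →
      (h.exists_curve hy t).choose (pj ξ) = (h.exists_curve hz t).choose (pj ξ) := by
    rintro y z hy hz rfl; rfl
  exact aux _ _ (pj_mem _) (pj_mem _) (pj_pj x)

lemma Slope.Om_pj' (h : Slope α αt δ L) (ξ x t : ℝ) : h.Om (pj ξ) x t = h.Om ξ x t := by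
  unfold Slope.Om; simp only [pj_pj]

lemma Slope.Om_curve (h : Slope α αt δ L) (x t : ℝ) : IsCurve α (fun ξ => h.Om ξ x t) := by
  have hs := (h.exists_curve (pj_mem x) t).choose_spec
  refine ⟨hs.1.1.comp pj_cont, fun ξ hξ => ?_⟩
  unfold Slope.Om
  simp only [pj_of_mem hξ]
  exact (hs.1.2 ξ hξ).congr (fun y hy => by simp only [pj_of_mem hy]) (by simp only [pj_of_mem hξ])

lemma Slope.Om_self (h : Slope α αt δ L) {x : ℝ} (hx : x ∈ I01) (t : ℝ) : h.Om x x t = t := by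
  have hs := (h.exists_curve (pj_mem x) t).choose_spec
  exact hs.2

lemma Slope.Om_unique (h : Slope α αt δ L) {c : ℝ → ℝ} (hc : IsCurve α c) {x ξ : ℝ}
    (hx : x ∈ I01) (hξ : ξ ∈ I01) : h.Om ξ x (c x) = c ξ := by
  have := h.diff_formula hc (h.Om_curve x (c x)) hx hξ
  simp only [h.Om_self hx, sub_self, zero_mul] at this
  linarith

lemma Slope.Om_group (h : Slope α αt δ L) (ξ x t : ℝ) {y : ℝ} (hy : y ∈ I01) :
    h.Om ξ y (h.Om y x t) = h.Om ξ x t := by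
  rw [← h.Om_pj' ξ, ← h.Om_pj' ξ]
  exact h.Om_unique (h.Om_curve x t) hy (pj_mem ξ)

lemma Slope.Om_lip_ξ (h : Slope α αt δ L) (ξ ξ' x t : ℝ) :
    |h.Om ξ x t - h.Om ξ' x t| ≤ δ * |ξ - ξ'| := by
  rw [← h.Om_pj' ξ, ← h.Om_pj' ξ']
  have hc := h.Om_curve x t
  have := (convex_Icc (0:ℝ) 1).norm_image_sub_le_of_norm_hasDerivWithin_le (C := δ)
    (fun y hy => hc.2 y hy) (fun y _ => h.b y _) (pj_mem ξ') (pj_mem ξ)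
  simp only [Real.norm_eq_abs] at this
  exact this.trans (mul_le_mul_of_nonneg_left (pj_lip _ _) h.δ0)

lemma Slope.Om_sub_le (h : Slope α αt δ L) (ξ : ℝ) {x : ℝ} (hx : x ∈ I01) (t : ℝ) :
    |h.Om ξ x t - t| ≤ δ := by
  have h1 := h.Om_lip_ξ (pj ξ) x x t
  rw [h.Om_self hx, h.Om_pj'] at h1
  exact h1.trans (mul_le_of_le_one_right h.δ0 (abs_sub_le_one_of_mem (pj_mem _) hx))

lemma Slope.Om_lip_t (h : Slope α αt δ L) (ξ x t t' : ℝ) :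
    |h.Om ξ x t - h.Om ξ x t'| ≤ Real.exp L * |t - t'| := by
  rw [← h.Om_pj' ξ, ← h.Om_pj' ξ, ← h.Om_pj _ x, ← h.Om_pj _ x]
  have := h.diff_le (h.Om_curve (pj x) t') (h.Om_curve (pj x) t) (pj_mem x) (pj_mem ξ)
  simpa only [h.Om_self (pj_mem x)] using this

lemma Slope.Om_lip_x (h : Slope α αt δ L) (ξ x x' t : ℝ) :
    |h.Om ξ x t - h.Om ξ x' t| ≤ Real.exp L * (δ * |x - x'|) := by
  rw [← h.Om_pj _ x, ← h.Om_pj _ x', ← h.Om_group ξ (pj x') t (pj_mem x)]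
  refine (h.Om_lip_t _ _ _ _).trans ?_
  gcongr
  have h1 := h.Om_lip_ξ (pj x) (pj x') (pj x') t
  rw [h.Om_self (pj_mem x')] at h1
  rw [abs_sub_comm]
  exact h1.trans (mul_le_mul_of_nonneg_left (pj_lip _ _) h.δ0)

lemma Slope.Om_cont (h : Slope α αt δ L) :
    Continuous fun q : ℝ × ℝ × ℝ => h.Om q.1 q.2.1 q.2.2 := by
  rw [continuous_iff_continuousAt]
  rintro ⟨ξ, x, t⟩
  rw [ContinuousAt, tendsto_iff_dist_tendsto_zero]
  have hb : ∀ q : ℝ × ℝ × ℝ, dist (h.Om q.1 q.2.1 q.2.2) (h.Om ξ x t) ≤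
      δ * |q.1 - ξ| + Real.exp L * (δ * |q.2.1 - x|) + Real.exp L * |q.2.2 - t| := by
    rintro ⟨ξ', x', t'⟩
    rw [Real.dist_eq]
    have h1 := h.Om_lip_ξ ξ' ξ x' t'
    have h2 := h.Om_lip_x ξ x' x t'
    have h3 := h.Om_lip_t ξ x t' t
    calc _ = |(h.Om ξ' x' t' - h.Om ξ x' t') + (h.Om ξ x' t' - h.Om ξ x t')
          + (h.Om ξ x t' - h.Om ξ x t)| := by congr 1; ring
      _ ≤ _ := (abs_add_three _ _ _).trans (by linarith)
  refine squeeze_zero (fun _ => dist_nonneg) hb ?_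
  have : Continuous fun q : ℝ × ℝ × ℝ =>
    δ * |q.1 - ξ| + Real.exp L * (δ * |q.2.1 - x|) + Real.exp L * |q.2.2 - t| := by fun_prop
  have := this.tendsto (ξ, x, t)
  simpa using this

@[fun_prop]
lemma Slope.Om_cont' (h : Slope α αt δ L) {X : Type*} [TopologicalSpace X] {f g k : X → ℝ}
    (hf : Continuous f) (hg : Continuous g) (hk : Continuous k) :
    Continuous fun q => h.Om (f q) (g q) (k q) :=
  h.Om_cont.comp (hf.prodMk (hg.prodMk hk))

lemma Slope.c' (h : Slope α αt δ L) {X : Type*} [TopologicalSpace X] {f g : X → ℝ}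
    (hf : Continuous f) (hg : Continuous g) : Continuous fun q => α (f q) (g q) :=
  h.c.comp (hf.prodMk hg)

lemma Slope.ct' (h : Slope α αt δ L) {X : Type*} [TopologicalSpace X] {f g : X → ℝ}
    (hf : Continuous f) (hg : Continuous g) : Continuous fun q => αt (f q) (g q) :=
  h.ct.comp (hf.prodMk hg)

/-- The derivative of the flow in the time variable. -/
def Slope.w (h : Slope α αt δ L) (ξ x t : ℝ) : ℝ :=
  Real.exp (∫ η in (pj x)..(pj ξ), αt η (h.Om η x t))

lemma Slope.w_pos (h : Slope α αt δ L) (ξ x t : ℝ) : 0 < h.w ξ x t := Real.exp_pos _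

lemma Slope.w_int_le (h : Slope α αt δ L) (ξ x t : ℝ) :
    |∫ η in (pj x)..(pj ξ), αt η (h.Om η x t)| ≤ L := by
  have := intervalIntegral.norm_integral_le_of_norm_le_const (a := pj x) (b := pj ξ) (C := L)
    (f := fun η => αt η (h.Om η x t)) (fun σ _ => h.bt _ _)
  rw [Real.norm_eq_abs] at this
  exact this.trans (mul_le_of_le_one_right h.L0 (abs_sub_le_one_of_mem (pj_mem _) (pj_mem _)))

lemma Slope.w_le (h : Slope α αt δ L) (ξ x t : ℝ) : h.w ξ x t ≤ Real.exp L :=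
  Real.exp_le_exp.2 ((le_abs_self _).trans (h.w_int_le ξ x t))

lemma Slope.le_w (h : Slope α αt δ L) (ξ x t : ℝ) : Real.exp (-L) ≤ h.w ξ x t :=
  Real.exp_le_exp.2 (neg_le_of_abs_le (h.w_int_le ξ x t))

lemma Slope.w_eq (h : Slope α αt δ L) (ξ x t : ℝ) :
    h.w ξ x t = Real.exp ((∫ η in (0:ℝ)..(pj ξ), αt η (h.Om η x t)) -
      ∫ η in (0:ℝ)..(pj x), αt η (h.Om η x t)) := by
  unfold Slope.w
  have hi : ∀ a b : ℝ, IntervalIntegrable (fun η => αt η (h.Om η x t)) volume a b := fun a b =>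
    (h.ct' continuous_id (h.Om_cont' continuous_id continuous_const
      continuous_const)).intervalIntegrable _ _
  rw [← intervalIntegral.integral_add_adjacent_intervals (hi (pj x) 0) (hi 0 (pj ξ)),
    intervalIntegral.integral_symm 0 (pj x)]
  congr 1; ring

lemma Slope.w_cont (h : Slope α αt δ L) :
    Continuous fun q : ℝ × ℝ × ℝ => h.w q.1 q.2.1 q.2.2 := by
  simp only [h.w_eq]
  refine Real.continuous_exp.comp (Continuous.sub ?_ ?_)
  · refine intervalIntegral.continuous_parametric_intervalIntegral_of_continuous
      (f := fun (q : ℝ × ℝ × ℝ) η => αt η (h.Om η q.2.1 q.2.2)) ?_ (pj_cont.comp continuous_fst)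
    exact h.ct' (by fun_prop) (h.Om_cont' (by fun_prop) (by fun_prop) (by fun_prop))
  · refine intervalIntegral.continuous_parametric_intervalIntegral_of_continuous
      (f := fun (q : ℝ × ℝ × ℝ) η => αt η (h.Om η q.2.1 q.2.2)) ?_
      (pj_cont.comp (continuous_fst.comp continuous_snd))
    exact h.ct' (by fun_prop) (h.Om_cont' (by fun_prop) (by fun_prop) (by fun_prop))

@[fun_prop]
lemma Slope.w_cont' (h : Slope α αt δ L) {X : Type*} [TopologicalSpace X] {f g k : X → ℝ}
    (hf : Continuous f) (hg : Continuous g) (hk : Continuous k) :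
    Continuous fun q => h.w (f q) (g q) (k q) :=
  h.w_cont.comp (hf.prodMk (hg.prodMk hk))

lemma Slope.w_self (h : Slope α αt δ L) (x t : ℝ) : h.w x x t = 1 := by
  unfold Slope.w; simp

lemma Slope.w_group (h : Slope α αt δ L) (ξ x t : ℝ) {y : ℝ} (hy : y ∈ I01) :
    h.w ξ y (h.Om y x t) * h.w y x t = h.w ξ x t := by
  unfold Slope.w
  have hi : ∀ a b : ℝ, IntervalIntegrable (fun η => αt η (h.Om η x t)) volume a b := fun a b =>
    (h.ct' continuous_id (h.Om_cont' continuous_id continuous_const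
      continuous_const)).intervalIntegrable _ _
  simp only [h.Om_group _ x t hy]
  rw [← Real.exp_add, add_comm, intervalIntegral.integral_add_adjacent_intervals (hi _ _) (hi _ _)]

lemma Slope.w_deriv_ξ (h : Slope α αt δ L) (x t : ℝ) {ξ : ℝ} (hξ : ξ ∈ I01) :
    HasDerivWithinAt (fun ξ => h.w ξ x t) (αt ξ (h.Om ξ x t) * h.w ξ x t) I01 ξ := by
  have h1 := (prim_deriv (f := fun η => αt η (h.Om η x t)) (h.ct' continuous_id
    (h.Om_cont' continuous_id continuous_const continuous_const)) (pj x) ξ).exp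
  refine ((h1.hasDerivWithinAt (s := I01)).congr (fun y hy => by simp only [Slope.w, pj_of_mem hy])
    (by simp only [Slope.w, pj_of_mem hξ])).congr_deriv ?_
  · simp only [Slope.w, pj_of_mem hξ]; ring

lemma Slope.Om_deriv_t (h : Slope α αt δ L) (ξ x t : ℝ) :
    HasDerivAt (fun t => h.Om ξ x t) (h.w ξ x t) t := by
  rw [hasDerivAt_iff_tendsto_slope]
  set Q : ℝ → ℝ := fun t' => Real.exp (∫ η in (pj x)..(pj ξ),
    mslope αt (fun η => h.Om η x t) (fun η => h.Om η x t') η) with hQ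
  have hQc : Continuous Q := by
    refine Real.continuous_exp.comp ?_
    apply intervalIntegral.continuous_parametric_intervalIntegral_of_continuous'
    unfold mslope
    apply intervalIntegral.continuous_parametric_intervalIntegral_of_continuous'
      (f := fun (q : ℝ × ℝ) σ => αt q.2 (h.Om q.2 x t + σ * (h.Om q.2 x q.1 - h.Om q.2 x t)))
    refine h.ct' (by fun_prop) ?_
    have h1 : Continuous fun q : (ℝ × ℝ) × ℝ => h.Om q.1.2 x t :=
      h.Om_cont' (by fun_prop) (by fun_prop) (by fun_prop)
    have h2 : Continuous fun q : (ℝ × ℝ) × ℝ => h.Om q.1.2 x q.1.1 :=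
      h.Om_cont' (by fun_prop) (by fun_prop) (by fun_prop)
    exact h1.add (continuous_snd.mul (h2.sub h1))
  have hQt : Q t = h.w ξ x t := by
    simp [hQ, Slope.w, mslope]
  rw [← hQt]
  refine Tendsto.congr' ?_ ((hQc.tendsto t).mono_left nhdsWithin_le_nhds)
  filter_upwards [self_mem_nhdsWithin] with t' ht'
  have ht'' : t' - t ≠ 0 := sub_ne_zero.2 ht'
  have := h.diff_formula (h.Om_curve (pj x) t) (h.Om_curve (pj x) t') (pj_mem x) (pj_mem ξ)
  simp only [h.Om_self (pj_mem x), h.Om_pj, h.Om_pj'] at this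
  rw [slope_def_field, this, hQ]
  field_simp

/-- Causality of the flow. -/
lemma Slope.Om_causal_pos (h : Slope α αt δ L) {κ : ℝ} (hκ : ∀ x t, κ ≤ α x t)
    {x ξ t : ℝ} (hx : x ∈ I01) (hξ : ξ ∈ I01) (hle : ξ ≤ x) :
    h.Om ξ x t ≤ t - κ * (x - ξ) := by
  have hc := h.Om_curve x t
  have h1 := ftcI (h := fun ξ => h.Om ξ x t) (h' := fun ξ => α ξ (h.Om ξ x t)) hξ hx
    (h.c' continuous_id (h.Om_cont' continuous_id continuous_const continuous_const)) hc.2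
  have h2 : ∫ _ in ξ..x, κ ≤ ∫ y in ξ..x, α y (h.Om y x t) :=
    intervalIntegral.integral_mono_on hle (by simp)
      ((h.c' continuous_id (h.Om_cont' continuous_id continuous_const
        continuous_const)).intervalIntegrable _ _) (fun y _ => hκ _ _)
  rw [h1] at h2
  simp [h.Om_self hx] at h2
  linarith

lemma Slope.Om_causal_neg (h : Slope α αt δ L) {κ : ℝ} (hκ : ∀ x t, α x t ≤ -κ)
    {x ξ t : ℝ} (hx : x ∈ I01) (hξ : ξ ∈ I01) (hle : x ≤ ξ) :
    h.Om ξ x t ≤ t - κ * (ξ - x) := by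
  have hc := h.Om_curve x t
  have h1 := ftcI (h := fun ξ => h.Om ξ x t) (h' := fun ξ => α ξ (h.Om ξ x t)) hx hξ
    (h.c' continuous_id (h.Om_cont' continuous_id continuous_const continuous_const)) hc.2
  have h2 : ∫ y in x..ξ, α y (h.Om y x t) ≤ ∫ _ in x..ξ, (-κ) :=
    intervalIntegral.integral_mono_on hle
      ((h.c' continuous_id (h.Om_cont' continuous_id continuous_const
        continuous_const)).intervalIntegrable _ _) (by simp) (fun y _ => hκ _ _)
  rw [h1] at h2
  simp [h.Om_self hx] at h2
  linarith

end Part1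

section Part2

/-- derivative under the integral sign, continuous version -/
lemma deriv_int {h ht : ℝ → ℝ → ℝ} (hc : Continuous fun q : ℝ × ℝ => h q.1 q.2)
    (htc : Continuous fun q : ℝ × ℝ => ht q.1 q.2)
    (hd : ∀ ξ t, HasDerivAt (h ξ) (ht ξ t) t) (a b t : ℝ) :
    HasDerivAt (fun t => ∫ ξ in a..b, h ξ t) (∫ ξ in a..b, ht ξ t) t := by
  have hK : IsCompact (uIcc a b ×ˢ Metric.closedBall t 1) :=
    isCompact_uIcc.prod (isCompact_closedBall t 1)
  obtain ⟨C, hC⟩ := hK.exists_bound_of_continuousOn htc.continuousOn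
  refine (intervalIntegral.hasDerivAt_integral_of_dominated_loc_of_deriv_le (μ := volume)
    (F := fun t ξ => h ξ t) (F' := fun t ξ => ht ξ t) (bound := fun _ => C)
    (Metric.ball_mem_nhds t one_pos) ?_ ?_ ?_ ?_ ?_ ?_).2
  · refine Eventually.of_forall fun t' => ?_
    exact (hc.comp (by fun_prop : Continuous fun ξ : ℝ => (ξ, t'))).aestronglyMeasurable
  · exact (hc.comp (by fun_prop : Continuous fun ξ : ℝ => (ξ, t))).intervalIntegrable _ _
  · exact (htc.comp (by fun_prop : Continuous fun ξ : ℝ => (ξ, t))).aestronglyMeasurable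
  · refine Eventually.of_forall fun ξ hξ t' ht' => ?_
    exact hC (ξ, t') ⟨uIoc_subset_uIcc hξ, Metric.ball_subset_closedBall ht'⟩
  · exact intervalIntegrable_const
  · exact Eventually.of_forall fun ξ _ t' _ => hd ξ t'

lemma abs_int_exp_le {f : ℝ → ℝ} {e x B μ : ℝ} (hμ : 0 < μ) (hf : Continuous f)
    (hb : ∀ ξ ∈ uIcc e x, |f ξ| ≤ B * μ * Real.exp (-(μ * |x - ξ|))) :
    |∫ ξ in e..x, f ξ| ≤ B := by
  have hB : 0 ≤ B := by
    have h1 := (abs_nonneg _).trans (hb x right_mem_uIcc)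
    simp at h1
    by_contra hneg
    push Not at hneg
    nlinarith
  rcases le_total e x with h | h
  · have hI : ∫ ξ in e..x, B * μ * Real.exp (-(μ * (x - ξ))) = B * (1 - Real.exp (-(μ * (x - e)))) := by
      rw [intervalIntegral.integral_eq_sub_of_hasDerivAt
        (f := fun ξ => B * Real.exp (-(μ * (x - ξ))))]
      · simp; ring
      · intro ξ _
        have : HasDerivAt (fun ξ : ℝ => -(μ * (x - ξ))) (μ) ξ := by
          exact (((hasDerivAt_id ξ).const_sub x).const_mul μ).neg.congr_deriv (by simp)
        refine (this.exp.const_mul B).congr_deriv ?_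
        ring
      · apply Continuous.intervalIntegrable; fun_prop
    have h1 : |∫ ξ in e..x, f ξ| ≤ ∫ ξ in e..x, |f ξ| := by
      simpa using intervalIntegral.abs_integral_le_integral_abs (f := f) (μ := volume) h
    have h2 : ∫ ξ in e..x, |f ξ| ≤ ∫ ξ in e..x, B * μ * Real.exp (-(μ * (x - ξ))) := by
      apply intervalIntegral.integral_mono_on h
      · exact (hf.abs).intervalIntegrable _ _
      · apply Continuous.intervalIntegrable; fun_prop
      · intro ξ hξ
        have := hb ξ (by rw [uIcc_of_le h]; exact hξ)
        rwa [abs_of_nonneg (by linarith [hξ.2] : 0 ≤ x - ξ)] at this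
    rw [hI] at h2
    have : 0 ≤ B * Real.exp (-(μ * (x - e))) := by positivity
    linarith
  · have hI : ∫ ξ in x..e, B * μ * Real.exp (-(μ * (ξ - x))) = B * (1 - Real.exp (-(μ * (e - x)))) := by
      rw [intervalIntegral.integral_eq_sub_of_hasDerivAt
        (f := fun ξ => - (B * Real.exp (-(μ * (ξ - x)))))]
      · simp; ring
      · intro ξ _
        have : HasDerivAt (fun ξ : ℝ => -(μ * (ξ - x))) (-μ) ξ := by
          exact (((hasDerivAt_id ξ).sub_const x).const_mul μ).neg.congr_deriv (by simp)
        refine (this.exp.const_mul B).neg.congr_deriv ?_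
        ring
      · apply Continuous.intervalIntegrable; fun_prop
    rw [intervalIntegral.integral_symm, abs_neg]
    have h1 : |∫ ξ in x..e, f ξ| ≤ ∫ ξ in x..e, |f ξ| := by
      simpa using intervalIntegral.abs_integral_le_integral_abs (f := f) (μ := volume) h
    have h2 : ∫ ξ in x..e, |f ξ| ≤ ∫ ξ in x..e, B * μ * Real.exp (-(μ * (ξ - x))) := by
      apply intervalIntegral.integral_mono_on h
      · exact (hf.abs).intervalIntegrable _ _
      · apply Continuous.intervalIntegrable; fun_prop
      · intro ξ hξ
        have := hb ξ (by rw [uIcc_of_ge h]; exact hξ)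
        rwa [abs_of_nonpos (by linarith [hξ.1] : x - ξ ≤ 0), neg_sub] at this
    rw [hI] at h2
    have : 0 ≤ B * Real.exp (-(μ * (e - x))) := by positivity
    linarith

/-- chain rule along a curve with only the time derivative jointly continuous -/
lemma chain_curve {h y : ℝ → ℝ → ℝ} (hyc : Continuous fun q : ℝ × ℝ => y q.1 q.2)
    (hd : ∀ x t, HasDerivAt (h x) (y x t) t) {c : ℝ → ℝ} {c' x : ℝ}
    (hc : HasDerivWithinAt c c' I01 x) :
    HasDerivWithinAt (fun x' => h x' (c x') - h x' (c x)) (y x (c x) * c') I01 x := by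
  -- difference quotient kernel
  set m : ℝ → ℝ := fun x' => ∫ σ in (0:ℝ)..1, y x' (c x + σ * (c x' - c x)) with hm
  have hme : ∀ x', h x' (c x') - h x' (c x) = m x' * (c x' - c x) := by
    intro x'
    rw [hm]
    simp only
    rw [← intervalIntegral.integral_mul_const]
    have := intervalIntegral.integral_eq_sub_of_hasDerivAt
      (f := fun σ => h x' (c x + σ * (c x' - c x)))
      (f' := fun σ => y x' (c x + σ * (c x' - c x)) * (c x' - c x)) (a := 0) (b := 1) ?_ ?_
    · rw [this]; simp
    · intro σ _
      have h2 : HasDerivAt (fun σ : ℝ => c x + σ * (c x' - c x)) (c x' - c x) σ := by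
        simpa using ((hasDerivAt_id σ).mul_const (c x' - c x)).const_add (c x)
      exact (hd x' _).comp σ h2
    · apply Continuous.intervalIntegrable
      exact (hyc.comp (by fun_prop : Continuous fun σ : ℝ =>
        (x', c x + σ * (c x' - c x)))).mul continuous_const
  have hmc : ContinuousWithinAt m I01 x := by
    have h1 : Continuous fun q : ℝ × ℝ => ∫ σ in (0:ℝ)..1, y q.1 (c x + σ * q.2) := by
      apply intervalIntegral.continuous_parametric_intervalIntegral_of_continuous'
        (f := fun (q : ℝ × ℝ) σ => y q.1 (c x + σ * q.2))
      exact hyc.comp (by fun_prop : Continuous fun r : (ℝ × ℝ) × ℝ => (r.1.1, c x + r.2 * r.1.2))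
    have h2 : ContinuousWithinAt (fun x' => (x', c x' - c x)) I01 x :=
      continuousWithinAt_id.prodMk (hc.continuousWithinAt.sub continuousWithinAt_const)
    exact ContinuousAt.comp_continuousWithinAt (f := fun x' => (x', c x' - c x))
      (g := fun q : ℝ × ℝ => ∫ σ in (0:ℝ)..1, y q.1 (c x + σ * q.2)) h1.continuousAt h2
  have hmx : m x = y x (c x) := by simp [hm]
  rw [hasDerivWithinAt_iff_tendsto_slope] at hc ⊢
  rw [← hmx]
  have h3 : Tendsto m (nhdsWithin x (I01 \ {x})) (nhds (m x)) := hmc.tendsto.mono_left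
    (nhdsWithin_mono _ sdiff_subset)
  refine (h3.mul hc).congr' ?_
  filter_upwards with x'
  rw [slope_def_field, slope_def_field, hme, hme]
  simp; ring

lemma chain_sum {h y : ℝ → ℝ → ℝ} (hyc : Continuous fun q : ℝ × ℝ => y q.1 q.2)
    (hd : ∀ x t, HasDerivAt (h x) (y x t) t) {c : ℝ → ℝ} {c' x D t : ℝ} (hcx : c x = t)
    (hc : HasDerivWithinAt c c' I01 x) (hx : HasDerivWithinAt (fun x' => h x' t) D I01 x) :
    HasDerivWithinAt (fun x' => h x' (c x')) (D + y x t * c') I01 x := by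
  subst hcx
  have := hx.add (chain_curve hyc hd hc)
  refine (this.congr (fun y hy => by simp) (by simp))

lemma chain_sub {h y : ℝ → ℝ → ℝ} (hyc : Continuous fun q : ℝ × ℝ => y q.1 q.2)
    (hd : ∀ x t, HasDerivAt (h x) (y x t) t) {c : ℝ → ℝ} {c' x D t : ℝ} (hcx : c x = t)
    (hc : HasDerivWithinAt c c' I01 x) (hx : HasDerivWithinAt (fun x' => h x' (c x')) D I01 x) :
    HasDerivWithinAt (fun x' => h x' t) (D - y x t * c') I01 x := by
  subst hcx
  have := hx.sub (chain_curve hyc hd hc)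
  refine (this.congr (fun y hy => by simp) (by simp))

/-- coefficient functions of class `BC¹` on the strip, extended constantly in `x` -/
structure D1 (g gx gt : ℝ → ℝ → ℝ) : Prop where
  c : Continuous fun q : ℝ × ℝ => g q.1 q.2
  cx : Continuous fun q : ℝ × ℝ => gx q.1 q.2
  ct : Continuous fun q : ℝ × ℝ => gt q.1 q.2
  dt : ∀ x t, HasDerivAt (g x) (gt x t) t
  dx : ∀ x ∈ I01, ∀ t, HasDerivWithinAt (fun x => g x t) (gx x t) I01 x
  b : ∃ C, ∀ x t, |g x t| ≤ C ∧ |gx x t| ≤ C ∧ |gt x t| ≤ C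

lemma BCle.toD1 {g : ℝ → ℝ → ℝ} {C : ℝ} (h : BCle 1 g C) :
    ∃ gx gt, D1 (fun x t => g (pj x) t) gx gt := by
  obtain ⟨hd, hb⟩ := h
  set G : ℝ × ℝ → ℝ := fun q => g q.1 q.2 with hG
  have hu : UniqueDiffOn ℝ strip := (uniqueDiffOn_Icc one_pos).prod uniqueDiffOn_univ
  have hms : ∀ x t, ((pj x, t) : ℝ × ℝ) ∈ strip := fun x t => ⟨pj_mem x, mem_univ _⟩
  have hπ : Continuous fun q : ℝ × ℝ => (pj q.1, q.2) :=
    (pj_cont.comp continuous_fst).prodMk continuous_snd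
  have hDc : ContinuousOn (fderivWithin ℝ G strip) strip :=
    hd.continuousOn_fderivWithin hu (by simp)
  have hDc' : Continuous fun q : ℝ × ℝ => fderivWithin ℝ G strip (pj q.1, q.2) :=
    hDc.comp_continuous hπ (fun q => hms q.1 q.2)
  have hda : ∀ q ∈ strip, HasFDerivWithinAt G (fderivWithin ℝ G strip q) strip q := fun q hq =>
    ((hd.differentiableOn (by simp)) q hq).hasFDerivWithinAt
  have hn0 : ∀ q ∈ strip, |G q| ≤ C := by
    intro q hq
    have := hb 0 (by simp) q hq
    simpa using this
  have hn1 : ∀ q ∈ strip, ‖fderivWithin ℝ G strip q‖ ≤ C := by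
    intro q hq
    have := hb 1 le_rfl q hq
    rwa [norm_iteratedFDerivWithin_one _ (hu q hq)] at this
  refine ⟨fun x t => fderivWithin ℝ G strip (pj x, t) (1, 0),
    fun x t => fderivWithin ℝ G strip (pj x, t) (0, 1), ?_, ?_, ?_, ?_, ?_, C, ?_⟩
  · exact hd.continuousOn.comp_continuous hπ (fun q => hms q.1 q.2)
  · exact hDc'.clm_apply continuous_const
  · exact hDc'.clm_apply continuous_const
  · intro x t
    have h1 := hda _ (hms x t)
    have h2 : HasDerivAt (fun t : ℝ => ((pj x, t) : ℝ × ℝ)) (0, 1) t :=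
      (hasDerivAt_const t (pj x)).prodMk (hasDerivAt_id t)
    have := h1.comp_hasDerivWithinAt t (s := univ) h2.hasDerivWithinAt (fun t _ => hms x t)
    rw [hasDerivWithinAt_univ] at this
    exact this
  · intro x hx t
    have h1 := hda _ (hms x t)
    have h2 : HasDerivWithinAt (fun x : ℝ => ((pj x, t) : ℝ × ℝ)) (1, 0) I01 x := by
      have := (hasDerivWithinAt_id x I01).prodMk (hasDerivWithinAt_const x I01 t)
      exact this.congr (fun y hy => by simp [pj_of_mem hy]) (by simp [pj_of_mem hx])
    exact h1.comp_hasDerivWithinAt x h2 (fun y _ => hms y t)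
  · intro x t
    refine ⟨hn0 _ (hms x t), ?_, ?_⟩
    · have := (fderivWithin ℝ G strip (pj x, t)).le_opNorm (1, 0)
      refine this.trans ?_
      have h2 := hn1 _ (hms x t)
      simpa using h2
    · have := (fderivWithin ℝ G strip (pj x, t)).le_opNorm (0, 1)
      refine this.trans ?_
      have h2 := hn1 _ (hms x t)
      simpa using h2

variable {f fx ft g gx gt : ℝ → ℝ → ℝ}

lemma D1.mul (hf : D1 f fx ft) (hg : D1 g gx gt) :
    D1 (fun x t => f x t * g x t) (fun x t => fx x t * g x t + f x t * gx x t)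
      (fun x t => ft x t * g x t + f x t * gt x t) := by
  refine ⟨hf.c.mul hg.c, (hf.cx.mul hg.c).add (hf.c.mul hg.cx),
    (hf.ct.mul hg.c).add (hf.c.mul hg.ct), fun x t => (hf.dt x t).mul (hg.dt x t),
    fun x hx t => (hf.dx x hx t).mul (hg.dx x hx t), ?_⟩
  obtain ⟨C, hC⟩ := hf.b
  obtain ⟨D, hD⟩ := hg.b
  have hC0 : 0 ≤ C := (abs_nonneg _).trans (hC 0 0).1
  have hD0 : 0 ≤ D := (abs_nonneg _).trans (hD 0 0).1
  have key : ∀ a b : ℝ, |a| ≤ C → |b| ≤ D → |a * b| ≤ C * D := fun a b ha hb => by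
    rw [abs_mul]; gcongr
  have hCD : 0 ≤ C * D := mul_nonneg hC0 hD0
  refine ⟨C * D + C * D, fun x t => ⟨?_, ?_, ?_⟩⟩
  · linarith [key _ _ (hC x t).1 (hD x t).1]
  · exact (abs_add_le _ _).trans (add_le_add (key _ _ (hC x t).2.1 (hD x t).1)
      (key _ _ (hC x t).1 (hD x t).2.1))
  · exact (abs_add_le _ _).trans (add_le_add (key _ _ (hC x t).2.2 (hD x t).1)
      (key _ _ (hC x t).1 (hD x t).2.2))

lemma D1.sub (hf : D1 f fx ft) (hg : D1 g gx gt) :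
    D1 (fun x t => f x t - g x t) (fun x t => fx x t - gx x t)
      (fun x t => ft x t - gt x t) := by
  refine ⟨hf.c.sub hg.c, (hf.cx.sub hg.cx),
    (hf.ct.sub hg.ct), fun x t => (hf.dt x t).sub (hg.dt x t),
    fun x hx t => (hf.dx x hx t).sub (hg.dx x hx t), ?_⟩
  obtain ⟨C, hC⟩ := hf.b
  obtain ⟨D, hD⟩ := hg.b
  refine ⟨C + D, fun x t => ⟨?_, ?_, ?_⟩⟩
  · exact (abs_sub _ _).trans (add_le_add (hC x t).1 (hD x t).1)
  · exact (abs_sub _ _).trans (add_le_add (hC x t).2.1 (hD x t).2.1)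
  · exact (abs_sub _ _).trans (add_le_add (hC x t).2.2 (hD x t).2.2)

lemma D1.inv (hf : D1 f fx ft) {c : ℝ} (hc : 0 < c) (hb : ∀ x t, c ≤ |f x t|) :
    D1 (fun x t => (f x t)⁻¹) (fun x t => -fx x t / (f x t) ^ 2)
      (fun x t => -ft x t / (f x t) ^ 2) := by
  have hne : ∀ x t, f x t ≠ 0 := fun x t h0 => by
    have := hb x t; rw [h0, abs_zero] at this; linarith
  refine ⟨hf.c.inv₀ (fun q => hne _ _), (hf.cx.neg.div (hf.c.pow 2) (fun q => pow_ne_zero _ (hne _ _))),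
    (hf.ct.neg.div (hf.c.pow 2) (fun q => pow_ne_zero _ (hne _ _))), fun x t => (hf.dt x t).inv (hne _ _),
    fun x hx t => (hf.dx x hx t).inv (hne _ _), ?_⟩
  obtain ⟨C, hC⟩ := hf.b
  have hC0 : 0 ≤ C := (abs_nonneg _).trans (hC 0 0).1
  have h2 : ∀ x t, c ^ 2 ≤ (f x t) ^ 2 := fun x t => by
    rw [← sq_abs (f x t)]; exact pow_le_pow_left₀ hc.le (hb x t) 2
  refine ⟨c⁻¹ + C / c ^ 2, fun x t => ⟨?_, ?_, ?_⟩⟩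
  · rw [abs_inv]
    have := inv_anti₀ hc (hb x t)
    have h3 : 0 ≤ C / c ^ 2 := by positivity
    linarith
  · rw [abs_div, abs_neg, abs_of_nonneg (sq_nonneg (f x t))]
    have h3 : |fx x t| / f x t ^ 2 ≤ C / c ^ 2 :=
      div_le_div₀ hC0 (hC x t).2.1 (by positivity) (h2 x t)
    have : 0 < c⁻¹ := by positivity
    linarith
  · rw [abs_div, abs_neg, abs_of_nonneg (sq_nonneg (f x t))]
    have h3 : |ft x t| / f x t ^ 2 ≤ C / c ^ 2 :=
      div_le_div₀ hC0 (hC x t).2.2 (by positivity) (h2 x t)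
    have : 0 < c⁻¹ := by positivity
    linarith

lemma D1.zero : D1 (fun _ _ => 0) (fun _ _ => 0) (fun _ _ => 0) := by
  refine ⟨continuous_const, continuous_const, continuous_const, fun x t => hasDerivAt_const _ _,
    fun x hx t => hasDerivWithinAt_const _ _ _, 0, by simp⟩

/-- rank function from nilpotency -/
def Ar {n : ℕ} (p : Fin n → Fin n → ℝ) : ℕ → Fin n → Prop
  | 0, _ => False
  | r + 1, j => ∀ k, p j k ≠ 0 → Ar p r k

lemma Ar_mono {n : ℕ} (p : Fin n → Fin n → ℝ) (r : ℕ) : ∀ j, Ar p r j → Ar p (r + 1) j := by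
  induction r with
  | zero => intro j h; exact h.elim
  | succ r ih => intro j h k hk; exact ih k (h k hk)

lemma not_Ar {n : ℕ} (p : Fin n → Fin n → ℝ) (r : ℕ) : ∀ j, ¬ Ar p r j →
    ∃ i : ℕ → Fin n, i 0 = j ∧ ∀ l < r, p (i l) (i (l + 1)) ≠ 0 := by
  induction r with
  | zero => intro j _; exact ⟨fun _ => j, rfl, by simp⟩
  | succ r ih =>
    intro j h
    simp only [Ar, not_forall] at h
    obtain ⟨k, hk, hk'⟩ := h
    obtain ⟨i, hi0, hi⟩ := ih k hk'
    refine ⟨fun l => match l with | 0 => j | l + 1 => i l, rfl, fun l hl => ?_⟩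
    cases l with
    | zero => simpa [hi0] using hk
    | succ l => exact hi l (by omega)

lemma exists_rank {n : ℕ} (p : Fin n → Fin n → ℝ) (hH : H3cond n p) :
    ∃ ρ : Fin n → ℕ, (∀ j, ρ j < n) ∧ ∀ j k, p j k ≠ 0 → ρ k < ρ j := by
  classical
  have hall : ∀ j, Ar p n j := by
    intro j
    by_contra hj
    obtain ⟨i, hi0, hi⟩ := not_Ar p n j hj
    have := hH (fun l => i l)
    rw [Finset.prod_eq_zero_iff] at this
    obtain ⟨l, _, hl⟩ := this
    exact hi l l.2 (by simpa using hl)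
  have hex : ∀ j, ∃ r, Ar p r j := fun j => ⟨n, hall j⟩
  have hpos : ∀ j, Nat.find (hex j) ≠ 0 := by
    intro j h0
    have := Nat.find_spec (hex j)
    rw [h0] at this
    exact this
  have hle : ∀ j, Nat.find (hex j) ≤ n := fun j => Nat.find_min' _ (hall j)
  refine ⟨fun j => Nat.find (hex j) - 1, fun j => ?_, fun j k hk => ?_⟩
  · have := hpos j; have := hle j; simp only; omega
  · have h1 := Nat.find_spec (hex j)
    obtain ⟨r, hr⟩ := Nat.exists_eq_succ_of_ne_zero (hpos j)
    rw [hr] at h1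
    have := Nat.find_min' (hex k) (h1 k hk)
    have := hpos k
    simp only
    omega

lemma exists_scale {n : ℕ} (p : Fin n → Fin n → ℝ) (ρ : Fin n → ℕ)
    (hρ : ∀ j k, p j k ≠ 0 → ρ k < ρ j) {ε : ℝ} (hε : 0 < ε) :
    ∃ c : Fin n → ℝ, (∀ j, 0 < c j) ∧ ∀ j k, |p j k| * c k ≤ ε * c j := by
  set S : ℝ := ∑ j, ∑ k, |p j k| with hS
  have hS0 : 0 ≤ S := by positivity
  have hpS : ∀ j k, |p j k| ≤ S := fun j k =>
    (Finset.single_le_sum (f := fun k => |p j k|) (fun _ _ => abs_nonneg _) (Finset.mem_univ k)).trans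
      (Finset.single_le_sum (f := fun j => ∑ k, |p j k|)
        (fun _ _ => Finset.sum_nonneg fun _ _ => abs_nonneg _) (Finset.mem_univ j))
  set Γ : ℝ := 1 + S / ε with hΓ
  have hΓ1 : 1 ≤ Γ := by have : 0 ≤ S / ε := by positivity
                         linarith
  refine ⟨fun j => Γ ^ ρ j, fun j => by positivity, fun j k => ?_⟩
  by_cases hp : p j k = 0
  · rw [hp]; simp; positivity
  · have h1 : Γ ^ (ρ k + 1) ≤ Γ ^ ρ j := pow_le_pow_right₀ hΓ1 (hρ j k hp)
    have h2 : |p j k| ≤ ε * Γ := by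
      rw [hΓ, mul_add, mul_div_cancel₀ _ hε.ne']; linarith [hpS j k]
    calc |p j k| * Γ ^ ρ k ≤ (ε * Γ) * Γ ^ ρ k := by gcongr
      _ = ε * Γ ^ (ρ k + 1) := by ring
      _ ≤ _ := by gcongr

end Part2

section Part3

/-- data of a linear fixed point problem along characteristics -/
structure FPData (ι : Type) where
  E : ι → ℝ
  O : ι → ℝ
  Om : ι → ℝ → ℝ → ℝ → ℝ
  P : ι → ι → ℝ → ℝ → ℝ
  M : ι → ι → ℝ → ℝ → ℝ → ℝ
  G : ι → ℝ → ℝ → ℝ → ℝ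

variable {ι : Type} [Fintype ι]

def FPData.T (D : FPData ι) (R : ι → ℝ → ℝ → ℝ) : ι → ℝ → ℝ → ℝ := fun i x t =>
  ∑ k, D.P i k x t * R k (D.O k) (D.Om i (D.E i) x t) +
    ∫ ξ in (D.E i)..(pj x), (D.G i ξ x t + ∑ k, D.M i k ξ x t * R k ξ (D.Om i ξ x t))

structure FPOk (D : FPData ι) (W : ι → ℝ → ℝ) (Γ μ : ℝ) : Prop where
  cOm : ∀ i, Continuous fun q : ℝ × ℝ × ℝ => D.Om i q.1 q.2.1 q.2.2
  cP : ∀ i k, Continuous fun q : ℝ × ℝ => D.P i k q.1 q.2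
  cM : ∀ i k, Continuous fun q : ℝ × ℝ × ℝ => D.M i k q.1 q.2.1 q.2.2
  cG : ∀ i, Continuous fun q : ℝ × ℝ × ℝ => D.G i q.1 q.2.1 q.2.2
  cW : ∀ i, Continuous (W i)
  pW : ∀ i t, 0 < W i t
  hμ : 0 < μ
  hΓ : 0 ≤ Γ
  hP : ∀ i x t, ∑ k, |D.P i k x t| * W k (D.Om i (D.E i) x t) ≤ W i t / 4
  hM : ∀ i x t, ∀ ξ ∈ uIcc (D.E i) (pj x), ∑ k, |D.M i k ξ x t| * W k (D.Om i ξ x t) ≤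
    W i t / 4 * μ * Real.exp (-(μ * |pj x - ξ|))
  hG : ∀ i x t, ∀ ξ ∈ uIcc (D.E i) (pj x), |D.G i ξ x t| ≤
    Γ * W i t * μ * Real.exp (-(μ * |pj x - ξ|))

variable {D : FPData ι} {W : ι → ℝ → ℝ} {Γ μ : ℝ}

def CF (R : ι → ℝ → ℝ → ℝ) : Prop := ∀ i, Continuous fun q : ℝ × ℝ => R i q.1 q.2

lemma CF.comp {R : ι → ℝ → ℝ → ℝ} (h : CF R) (i : ι) {X : Type*} [TopologicalSpace X] {f g : X → ℝ}
    (hf : Continuous f) (hg : Continuous g) : Continuous fun q => R i (f q) (g q) :=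
  (h i).comp (hf.prodMk hg)

lemma FPOk.cOm' (h : FPOk D W Γ μ) (i : ι) {X : Type*} [TopologicalSpace X] {f g k : X → ℝ}
    (hf : Continuous f) (hg : Continuous g) (hk : Continuous k) :
    Continuous fun q => D.Om i (f q) (g q) (k q) :=
  (h.cOm i).comp (hf.prodMk (hg.prodMk hk))

lemma FPOk.integrand_cont (h : FPOk D W Γ μ) {R : ι → ℝ → ℝ → ℝ} (hR : CF R) (i : ι) :
    Continuous fun q : ℝ × ℝ × ℝ => D.G i q.1 q.2.1 q.2.2 +
      ∑ k, D.M i k q.1 q.2.1 q.2.2 * R k q.1 (D.Om i q.1 q.2.1 q.2.2) := by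
  refine (h.cG i).add (continuous_finset_sum _ fun k _ => (h.cM i k).mul ?_)
  exact hR.comp k continuous_fst (h.cOm i)

lemma FPOk.T_cont (h : FPOk D W Γ μ) {R : ι → ℝ → ℝ → ℝ} (hR : CF R) : CF (D.T R) := by
  intro i
  unfold FPData.T
  refine Continuous.add (continuous_finset_sum _ fun k _ => (h.cP i k).mul ?_) ?_
  · exact hR.comp k continuous_const (h.cOm' i continuous_const continuous_fst continuous_snd)
  · refine intervalIntegral.continuous_parametric_intervalIntegral_of_continuous
      (f := fun (q : ℝ × ℝ) ξ => D.G i ξ q.1 q.2 + ∑ k, D.M i k ξ q.1 q.2 * R k ξ (D.Om i ξ q.1 q.2))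
      ?_ (pj_cont.comp continuous_fst)
    exact (h.integrand_cont hR i).comp (by fun_prop : Continuous fun r : (ℝ × ℝ) × ℝ =>
      (r.2, r.1.1, r.1.2))

lemma FPOk.T_lip (h : FPOk D W Γ μ) {R R' : ι → ℝ → ℝ → ℝ} (hR : CF R) (hR' : CF R') {ε : ℝ}
    (hε : 0 ≤ ε)
    (hd : ∀ i x t, |R i x t - R' i x t| ≤ ε * W i t) (i : ι) (x t : ℝ) :
    |D.T R i x t - D.T R' i x t| ≤ ε / 2 * W i t := by
  have c1 : ∀ (R : ι → ℝ → ℝ → ℝ), CF R → Continuous fun ξ =>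
      (D.G i ξ x t + ∑ k, D.M i k ξ x t * R k ξ (D.Om i ξ x t)) := fun R hR =>
    (h.integrand_cont hR i).comp (by fun_prop : Continuous fun ξ : ℝ => (ξ, x, t))
  have heq : D.T R i x t - D.T R' i x t =
      ∑ k, D.P i k x t * (R k (D.O k) (D.Om i (D.E i) x t) - R' k (D.O k) (D.Om i (D.E i) x t)) +
      ∫ ξ in (D.E i)..(pj x),
        ∑ k, D.M i k ξ x t * (R k ξ (D.Om i ξ x t) - R' k ξ (D.Om i ξ x t)) := by
    unfold FPData.T
    rw [add_sub_add_comm, ← intervalIntegral.integral_sub ((c1 R hR).intervalIntegrable _ _)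
      ((c1 R' hR').intervalIntegrable _ _), ← Finset.sum_sub_distrib]
    congr 1
    · exact Finset.sum_congr rfl fun k _ => by ring
    · congr 1; ext ξ
      rw [add_sub_add_left_eq_sub, ← Finset.sum_sub_distrib]
      exact Finset.sum_congr rfl fun k _ => by ring
  rw [heq]
  have b1 : |∑ k, D.P i k x t * (R k (D.O k) (D.Om i (D.E i) x t) -
      R' k (D.O k) (D.Om i (D.E i) x t))| ≤ ε * (W i t / 4) := by
    refine (Finset.abs_sum_le_sum_abs _ _).trans ?_
    refine le_trans ?_ (mul_le_mul_of_nonneg_left (h.hP i x t) hε)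
    rw [Finset.mul_sum]
    refine Finset.sum_le_sum fun k _ => ?_
    rw [abs_mul]
    calc _ ≤ |D.P i k x t| * (ε * W k (D.Om i (D.E i) x t)) := by gcongr; exact hd _ _ _
      _ = _ := by ring
  have b2 : |∫ ξ in (D.E i)..(pj x),
        ∑ k, D.M i k ξ x t * (R k ξ (D.Om i ξ x t) - R' k ξ (D.Om i ξ x t))| ≤ ε * (W i t / 4) := by
    refine abs_int_exp_le h.hμ ?_ ?_
    · have := (c1 R hR).sub (c1 R' hR')
      refine this.congr fun ξ => ?_
      rw [Pi.sub_apply, add_sub_add_left_eq_sub, ← Finset.sum_sub_distrib]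
      exact Finset.sum_congr rfl fun k _ => by ring
    · intro ξ hξ
      refine (Finset.abs_sum_le_sum_abs _ _).trans ?_
      have := mul_le_mul_of_nonneg_left (h.hM i x t ξ hξ) hε
      rw [show ε * (W i t / 4) * μ * Real.exp (-(μ * |pj x - ξ|)) =
        ε * (W i t / 4 * μ * Real.exp (-(μ * |pj x - ξ|))) by ring]
      refine le_trans ?_ this
      rw [Finset.mul_sum]
      refine Finset.sum_le_sum fun k _ => ?_
      rw [abs_mul]
      calc _ ≤ |D.M i k ξ x t| * (ε * W k (D.Om i ξ x t)) := by gcongr; exact hd _ _ _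
        _ = _ := by ring
  refine (abs_add_le _ _).trans ?_
  linarith

def FPData.it (D : FPData ι) : ℕ → ι → ℝ → ℝ → ℝ
  | 0 => fun _ _ _ => 0
  | N + 1 => D.T (D.it N)

lemma FPOk.it_cont (h : FPOk D W Γ μ) (N : ℕ) : CF (D.it N) := by
  induction N with
  | zero => exact fun i => continuous_const
  | succ N ih => exact h.T_cont ih

lemma FPOk.it_diff (h : FPOk D W Γ μ) (N : ℕ) (i : ι) (x t : ℝ) :
    |D.it (N + 1) i x t - D.it N i x t| ≤ Γ / 2 ^ N * W i t := by
  induction N generalizing i x t with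
  | zero =>
    simp only [FPData.it, FPData.T, mul_zero, Finset.sum_const_zero, add_zero, zero_add, sub_zero,
      pow_zero, div_one]
    exact abs_int_exp_le h.hμ ((h.cG i).comp (by fun_prop : Continuous fun ξ : ℝ => (ξ, x, t)))
      (h.hG i x t)
  | succ N ih =>
    have := h.T_lip (h.it_cont (N + 1)) (h.it_cont N) (div_nonneg h.hΓ (by positivity)) ih i x t
    refine this.trans (le_of_eq ?_)
    rw [pow_succ]; field_simp

theorem FPOk.fixed (h : FPOk D W Γ μ) : ∃ R : ι → ℝ → ℝ → ℝ, CF R ∧ D.T R = R ∧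
    (∀ i x t, |R i x t| ≤ 2 * Γ * W i t) ∧
    (∀ N i x t, |D.it N i x t - R i x t| ≤ 2 * Γ / 2 ^ N * W i t) := by
  have hdist : ∀ i x t N, dist (D.it N i x t) (D.it (N + 1) i x t) ≤ (2 * Γ * W i t) / 2 / 2 ^ N := by
    intro i x t N
    rw [dist_comm, Real.dist_eq]
    refine (h.it_diff N i x t).trans (le_of_eq ?_); field_simp
  choose R hR using fun (i : ι) (x t : ℝ) => cauchySeq_tendsto_of_complete
    (cauchySeq_of_le_geometric_two (hdist i x t))
  have hRd : ∀ N i x t, |D.it N i x t - R i x t| ≤ 2 * Γ / 2 ^ N * W i t := by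
    intro N i x t
    have := dist_le_of_le_geometric_two_of_tendsto (hdist i x t) (hR i x t) N
    rw [Real.dist_eq] at this
    refine this.trans (le_of_eq ?_); field_simp
  have hpow : Tendsto (fun N : ℕ => 2 * Γ / 2 ^ N) atTop (nhds 0) := by
    have := (tendsto_pow_atTop_nhds_zero_of_lt_one (r := (1/2:ℝ)) (by norm_num)
      (by norm_num)).const_mul (2 * Γ)
    rw [mul_zero] at this
    refine this.congr fun N => ?_
    rw [one_div, inv_pow, div_eq_mul_inv]
  have hRc : CF R := by
    intro i
    have hl : TendstoLocallyUniformly (fun N (q : ℝ × ℝ) => D.it N i q.1 q.2)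
        (fun q : ℝ × ℝ => R i q.1 q.2) atTop := by
      rw [Metric.tendstoLocallyUniformly_iff]
      intro ε hε q
      refine ⟨{q' | W i q'.2 < W i q.2 + 1}, ?_, ?_⟩
      · exact ((isOpen_Iio).preimage ((h.cW i).comp continuous_snd)).mem_nhds (by simp)
      · have h1 : Tendsto (fun N : ℕ => 2 * Γ / 2 ^ N * (W i q.2 + 1)) atTop (nhds 0) := by
          simpa using hpow.mul_const (W i q.2 + 1)
        filter_upwards [h1.eventually (gt_mem_nhds hε)] with N hN q' hq'
        rw [dist_comm, Real.dist_eq]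
        refine ((hRd N i _ _).trans (mul_le_mul_of_nonneg_left (le_of_lt hq') ?_)).trans_lt hN
        have := h.hΓ
        positivity
    exact hl.continuous (Frequently.of_forall fun N => h.it_cont N i)
  refine ⟨R, hRc, ?_, fun i x t => ?_, hRd⟩
  · funext i x t
    have h1 : Tendsto (fun N => D.it (N + 1) i x t) atTop (nhds (D.T R i x t)) := by
      rw [tendsto_iff_dist_tendsto_zero]
      have h2 : Tendsto (fun N : ℕ => 2 * Γ / 2 ^ N / 2 * W i t) atTop (nhds 0) := by
        simpa using (hpow.div_const 2).mul_const (W i t)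
      refine squeeze_zero (fun _ => dist_nonneg) (fun N => ?_) h2
      rw [Real.dist_eq]
      exact h.T_lip (h.it_cont N) hRc (by have := h.hΓ; positivity) (hRd N) i x t
    exact tendsto_nhds_unique h1 ((tendsto_add_atTop_iff_nat 1).2 (hR i x t))
  · have := hRd 0 i x t
    simpa [FPData.it] using this

end Part3

section Part4

/-- coefficient data of the normalised system `u_x + α u_t + β u = 0` -/
structure Sys (n : ℕ) where
  p : Fin n → Fin n → ℝ
  e : Fin n → ℝ
  o : Fin n → ℝ
  α : Fin n → ℝ → ℝ → ℝ
  αt : Fin n → ℝ → ℝ → ℝ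
  β : Fin n → Fin n → ℝ → ℝ → ℝ
  βt : Fin n → Fin n → ℝ → ℝ → ℝ
  q : Fin n → Fin n → ℝ → ℝ → ℝ
  qx : Fin n → Fin n → ℝ → ℝ → ℝ
  qt : Fin n → Fin n → ℝ → ℝ → ℝ
  δ : ℝ
  L : ℝ
  B : ℝ
  κ : ℝ
  ρ : Fin n → ℕ
  sl : ∀ j, Slope (α j) (αt j) δ L
  cβ : ∀ j k, Continuous fun q : ℝ × ℝ => β j k q.1 q.2
  cβt : ∀ j k, Continuous fun q : ℝ × ℝ => βt j k q.1 q.2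
  dβ : ∀ j k x t, HasDerivAt (β j k x) (βt j k x t) t
  bβ : ∀ j k x t, |β j k x t| ≤ B
  bβt : ∀ j k x t, |βt j k x t| ≤ B
  B0 : 0 ≤ B
  dq : ∀ j k, D1 (q j k) (qx j k) (qt j k)
  bq : ∀ j k x t, |q j k x t| ≤ B ∧ |qx j k x t| ≤ B ∧ |qt j k x t| ≤ B
  hq : ∀ j k, k ≠ j → ∀ x t, q j k x t * (α j x t - α k x t) = β j k x t
  hq0 : ∀ j x t, q j j x t = 0
  κ0 : 0 < κ
  hin : ∀ j, (e j = 0 ∧ o j = 1 ∧ ∀ x t, κ ≤ α j x t) ∨ (e j = 1 ∧ o j = 0 ∧ ∀ x t, α j x t ≤ -κ)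
  hρ : ∀ j k, p j k ≠ 0 → ρ k < ρ j
  hρn : ∀ j, ρ j < n

variable {n : ℕ}

def Sys.Om (S : Sys n) (j : Fin n) := (S.sl j).Om
def Sys.w (S : Sys n) (j : Fin n) := (S.sl j).w

lemma Sys.e_mem (S : Sys n) (j : Fin n) : S.e j ∈ I01 := by
  rcases S.hin j with h | h <;> rw [h.1] <;> simp [I01]

lemma Sys.o_mem (S : Sys n) (j : Fin n) : S.o j ∈ I01 := by
  rcases S.hin j with h | h <;> rw [h.2.1] <;> simp [I01]

lemma Sys.causal (S : Sys n) (j : Fin n) {x ξ t : ℝ} (hx : x ∈ I01) (hξ : ξ ∈ uIcc (S.e j) x) :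
    S.Om j ξ x t ≤ t - S.κ * |x - ξ| := by
  have hξ' : ξ ∈ I01 := uIcc_sub_I (S.e_mem j) hx hξ
  rcases S.hin j with h | h
  · rw [h.1, uIcc_of_le hx.1] at hξ
    rw [abs_of_nonneg (by linarith [hξ.2])]
    exact (S.sl j).Om_causal_pos h.2.2 hx hξ' hξ.2
  · rw [h.1, uIcc_of_ge hx.2] at hξ
    rw [abs_of_nonpos (by linarith [hξ.1]), neg_sub]
    exact (S.sl j).Om_causal_neg h.2.2 hx hξ' hξ.1

lemma Sys.Om_cont (S : Sys n) (j : Fin n) {X : Type*} [TopologicalSpace X] {f g k : X → ℝ}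
    (hf : Continuous f) (hg : Continuous g) (hk : Continuous k) :
    Continuous fun q => S.Om j (f q) (g q) (k q) := (S.sl j).Om_cont' hf hg hk

lemma Sys.w_cont (S : Sys n) (j : Fin n) {X : Type*} [TopologicalSpace X] {f g k : X → ℝ}
    (hf : Continuous f) (hg : Continuous g) (hk : Continuous k) :
    Continuous fun q => S.w j (f q) (g q) (k q) := (S.sl j).w_cont' hf hg hk

lemma c2 {f : ℝ → ℝ → ℝ} (h : Continuous fun q : ℝ × ℝ => f q.1 q.2) {X : Type*} [TopologicalSpace X]
    {u v : X → ℝ} (hu : Continuous u) (hv : Continuous v) : Continuous fun z => f (u z) (v z) :=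
  h.comp (hu.prodMk hv)

/-- the fixed point data with unknowns `(r, ∂ₜ r)` -/
def Sys.fp (S : Sys n) (g gt : Fin n → ℝ → ℝ → ℝ) : FPData (Fin n × Bool) where
  E := fun i => S.e i.1
  O := fun i => S.o i.1
  Om := fun i => S.Om i.1
  P := fun i k x t => match i.2, k.2 with
    | false, false => S.p i.1 k.1
    | true, true => S.w i.1 (S.e i.1) x t * S.p i.1 k.1
    | _, _ => 0
  M := fun i k ξ x t => match i.2, k.2 with
    | false, false => - S.β i.1 k.1 ξ (S.Om i.1 ξ x t)
    | true, true => - (S.w i.1 ξ x t * S.β i.1 k.1 ξ (S.Om i.1 ξ x t))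
    | true, false => - (S.w i.1 ξ x t * S.βt i.1 k.1 ξ (S.Om i.1 ξ x t))
    | false, true => 0
  G := fun i ξ x t => match i.2 with
    | false => g i.1 ξ (S.Om i.1 ξ x t)
    | true => S.w i.1 ξ x t * gt i.1 ξ (S.Om i.1 ξ x t)

def Wt (c : Fin n → ℝ) (lam s : ℝ) : Fin n × Bool → ℝ → ℝ := fun i t => match i.2 with
  | false => c i.1 * Real.exp (lam * (t - s)) / lam
  | true => c i.1 * Real.exp (lam * (t - s))

lemma exp_shift {lam s t t' κ d : ℝ} (hl : 0 ≤ lam) (h : t' ≤ t - κ * d) :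
    Real.exp (lam * (t' - s)) ≤ Real.exp (lam * (t - s)) * Real.exp (-(lam * κ * d)) := by
  rw [← Real.exp_add]
  apply Real.exp_le_exp.2
  nlinarith

lemma Sys.w_abs (S : Sys n) (j : Fin n) (ξ x t : ℝ) : |S.w j ξ x t| ≤ Real.exp S.L := by
  unfold Sys.w; rw [abs_of_pos ((S.sl j).w_pos _ _ _)]; exact (S.sl j).w_le _ _ _

lemma Sys.ok (S : Sys n) {c : Fin n → ℝ} (hc : ∀ j, 0 < c j)
    (hpc : ∀ j k, |S.p j k| * c k ≤ (1 / (4 * (n + 1) * Real.exp S.L)) * c j)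
    {lam s Γ Cg : ℝ} (hl : 1 ≤ lam) (hlc : ∀ j, 8 * Real.exp S.L * S.B * ∑ k, c k ≤ c j * lam * S.κ)
    (hΓ0 : 0 ≤ Γ) (hΓ : ∀ j, Real.exp S.L * Cg ≤ Γ * c j * S.κ)
    {g gt : Fin n → ℝ → ℝ → ℝ} (cg : CF g) (cgt : CF gt)
    (bg : ∀ j x t, |g j x t| ≤ Cg * Real.exp (lam * (t - s)))
    (bgt : ∀ j x t, |gt j x t| ≤ Cg * lam * Real.exp (lam * (t - s))) :
    FPOk (S.fp g gt) (Wt c lam s) Γ (lam * S.κ) := by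
  have hl0 : 0 < lam := by linarith
  have hκ := S.κ0
  have hμ : 0 < lam * S.κ := by positivity
  have cOm : ∀ i : Fin n × Bool, Continuous fun q : ℝ × ℝ × ℝ => S.Om i.1 q.1 q.2.1 q.2.2 := fun i =>
    S.Om_cont i.1 continuous_fst (continuous_fst.comp continuous_snd)
      (continuous_snd.comp continuous_snd)
  have cw : ∀ i : Fin n × Bool, Continuous fun q : ℝ × ℝ × ℝ => S.w i.1 q.1 q.2.1 q.2.2 := fun i =>
    S.w_cont i.1 continuous_fst (continuous_fst.comp continuous_snd)
      (continuous_snd.comp continuous_snd)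
  have hL1 : 1 ≤ Real.exp S.L ∨ n = 0 := by
    rcases Nat.eq_zero_or_pos n with h | h
    · right; exact h
    · left; exact Real.one_le_exp ((S.sl ⟨0, h⟩).L0)
  have hsum : ∀ j, ∑ k, |S.p j k| * c k ≤ c j / (4 * Real.exp S.L) := by
    intro j
    calc _ ≤ ∑ _k : Fin n, (1 / (4 * (n + 1) * Real.exp S.L)) * c j :=
          Finset.sum_le_sum fun k _ => hpc j k
      _ = n * ((1 / (4 * (n + 1) * Real.exp S.L)) * c j) := by simp
      _ = (n / (n + 1)) * (c j / (4 * Real.exp S.L)) := by field_simp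
      _ ≤ 1 * (c j / (4 * Real.exp S.L)) := by
          have := hc j
          gcongr
          rw [div_le_one (by positivity)]; linarith
      _ = _ := by ring
  have hCg : ∀ j : Fin n, 0 ≤ Cg := fun j => by
    have := (abs_nonneg _).trans (bg j 0 s)
    simpa using this
  refine ⟨cOm, ?_, ?_, ?_, ?_, ?_, hμ, hΓ0, ?_, ?_, ?_⟩
  · rintro ⟨j, _ | _⟩ ⟨k, _ | _⟩ <;> simp only [Sys.fp]
    · exact continuous_const
    · exact continuous_const
    · exact continuous_const
    · exact (S.w_cont j continuous_const continuous_fst continuous_snd).mul continuous_const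
  · rintro ⟨j, _ | _⟩ ⟨k, _ | _⟩ <;> simp only [Sys.fp]
    · exact (c2 (S.cβ j k) continuous_fst (cOm (j, false))).neg
    · exact continuous_const
    · exact ((cw (j, false)).mul (c2 (S.cβt j k) continuous_fst (cOm (j, false)))).neg
    · exact ((cw (j, false)).mul (c2 (S.cβ j k) continuous_fst (cOm (j, false)))).neg
  · rintro ⟨j, _ | _⟩ <;> simp only [Sys.fp]
    · exact c2 (cg j) continuous_fst (cOm (j, false))
    · exact (cw (j, false)).mul (c2 (cgt j) continuous_fst (cOm (j, false)))
  · rintro ⟨j, _ | _⟩ <;> unfold Wt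
    · fun_prop
    · fun_prop
  · rintro ⟨j, _ | _⟩ t <;> simp only [Wt] <;> have := hc j <;> positivity
  · rintro ⟨j, b⟩ x t
    have hL1 : 1 ≤ Real.exp S.L := hL1.resolve_right (fun h => by subst h; exact j.elim0)
    have hτ : S.Om j (S.e j) x t ≤ t := by
      have := S.causal j (t := t) (pj_mem x) (left_mem_uIcc (a := S.e j))
      rw [Sys.Om, (S.sl j).Om_pj] at this
      have h2 : 0 ≤ S.κ * |pj x - S.e j| := by positivity
      exact this.trans (by linarith)
    have hexp : Real.exp (lam * (S.Om j (S.e j) x t - s)) ≤ Real.exp (lam * (t - s)) :=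
      Real.exp_le_exp.2 (by nlinarith)
    have hcj := hc j
    rw [Fintype.sum_prod_type]
    simp only [Fintype.sum_bool]
    cases b
    · simp only [Sys.fp, Wt, abs_zero, zero_mul, zero_add]
      calc _ = (∑ k, |S.p j k| * c k) * (Real.exp (lam * (S.Om j (S.e j) x t - s)) / lam) := by
            rw [Finset.sum_mul]; exact Finset.sum_congr rfl fun k _ => by ring
        _ ≤ (c j / (4 * Real.exp S.L)) * (Real.exp (lam * (t - s)) / lam) := by
            gcongr
            exact hsum j
        _ ≤ (c j / (4 * 1)) * (Real.exp (lam * (t - s)) / lam) := by gcongr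
        _ = _ := by ring
    · simp only [Sys.fp, Wt, abs_zero, zero_mul, add_zero]
      calc _ = |S.w j (S.e j) x t| * (∑ k, |S.p j k| * c k) *
              (Real.exp (lam * (S.Om j (S.e j) x t - s))) := by
            rw [Finset.mul_sum, Finset.sum_mul]
            exact Finset.sum_congr rfl fun k _ => by rw [abs_mul]; ring
        _ ≤ Real.exp S.L * (c j / (4 * Real.exp S.L)) * (Real.exp (lam * (t - s))) := by
            gcongr
            · exact Finset.sum_nonneg fun k _ => mul_nonneg (abs_nonneg _) (hc k).le
            · exact S.w_abs _ _ _ _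
            · exact hsum j
        _ = _ := by field_simp
  · rintro ⟨j, b⟩ x t ξ hξ
    have hL1 : 1 ≤ Real.exp S.L := hL1.resolve_right (fun h => by subst h; exact j.elim0)
    have hτ : S.Om j ξ x t ≤ t - S.κ * |pj x - ξ| := by
      have := S.causal j (t := t) (pj_mem x) hξ
      rwa [Sys.Om, (S.sl j).Om_pj] at this
    have hexp := exp_shift (lam := lam) (s := s) hl0.le hτ
    have hcs : 0 ≤ ∑ k, c k := Finset.sum_nonneg fun k _ => (hc k).le
    have hB := S.B0
    rw [Fintype.sum_prod_type]
    simp only [Fintype.sum_bool]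
    cases b
    · simp only [Sys.fp, Wt, abs_zero, zero_mul, zero_add]
      calc _ ≤ ∑ k, S.B * (c k * (Real.exp (lam * (t - s)) *
                Real.exp (-(lam * S.κ * |pj x - ξ|))) / lam) := by
            refine Finset.sum_le_sum fun k _ => ?_
            rw [abs_neg]
            have := hc k
            gcongr
            exact S.bβ _ _ _ _
        _ = (S.B * ∑ k, c k) * ((Real.exp (lam * (t - s)) *
                Real.exp (-(lam * S.κ * |pj x - ξ|))) / lam) := by
            rw [Finset.mul_sum, Finset.sum_mul]; exact Finset.sum_congr rfl fun k _ => by ring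
        _ ≤ (c j * lam * S.κ / 4) * ((Real.exp (lam * (t - s)) *
                Real.exp (-(lam * S.κ * |pj x - ξ|))) / lam) := by
            gcongr
            have := hlc j
            have h1 : 0 ≤ S.B * ∑ k, c k := by positivity
            nlinarith
        _ = _ := by ring
    · simp only [Sys.fp, Wt]
      calc _ ≤ ∑ k, (Real.exp S.L * S.B * (c k * (Real.exp (lam * (t - s)) *
                Real.exp (-(lam * S.κ * |pj x - ξ|)))) + Real.exp S.L * S.B * (c k * (Real.exp (lam * (t - s)) *
                Real.exp (-(lam * S.κ * |pj x - ξ|))) / 1)) := by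
            refine Finset.sum_le_sum fun k _ => ?_
            have := hc k
            rw [abs_neg, abs_neg, abs_mul, abs_mul]
            gcongr
            · exact S.w_abs _ _ _ _
            · exact S.bβ _ _ _ _
            · exact S.w_abs _ _ _ _
            · exact S.bβt _ _ _ _
        _ = (2 * Real.exp S.L * S.B * ∑ k, c k) * ((Real.exp (lam * (t - s)) *
                Real.exp (-(lam * S.κ * |pj x - ξ|)))) := by
            rw [Finset.mul_sum, Finset.sum_mul]; exact Finset.sum_congr rfl fun k _ => by ring
        _ ≤ (c j * lam * S.κ / 4) * ((Real.exp (lam * (t - s)) *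
                Real.exp (-(lam * S.κ * |pj x - ξ|)))) := by
            gcongr
            have := hlc j
            linarith
        _ = _ := by ring
  · rintro ⟨j, b⟩ x t ξ hξ
    have hL1 : 1 ≤ Real.exp S.L := hL1.resolve_right (fun h => by subst h; exact j.elim0)
    have hτ : S.Om j ξ x t ≤ t - S.κ * |pj x - ξ| := by
      have := S.causal j (t := t) (pj_mem x) hξ
      rwa [Sys.Om, (S.sl j).Om_pj] at this
    have hexp := exp_shift (lam := lam) (s := s) hl0.le hτ
    have hCg := hCg j
    have h1 := hΓ j
    cases b
    · simp only [Sys.fp, Wt]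
      calc _ ≤ Cg * (Real.exp (lam * (t - s)) * Real.exp (-(lam * S.κ * |pj x - ξ|))) :=
            (bg _ _ _).trans (by gcongr)
        _ ≤ (Γ * c j * S.κ) * (Real.exp (lam * (t - s)) * Real.exp (-(lam * S.κ * |pj x - ξ|))) := by
            gcongr; nlinarith
        _ = _ := by field_simp
    · simp only [Sys.fp, Wt]
      rw [abs_mul]
      calc _ ≤ Real.exp S.L * (Cg * lam * (Real.exp (lam * (t - s)) *
              Real.exp (-(lam * S.κ * |pj x - ξ|)))) := by
            gcongr
            · exact S.w_abs _ _ _ _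
            · exact (bgt _ _ _).trans (by gcongr)
        _ = (Real.exp S.L * Cg) * lam * (Real.exp (lam * (t - s)) *
              Real.exp (-(lam * S.κ * |pj x - ξ|))) := by ring
        _ ≤ (Γ * c j * S.κ) * lam * (Real.exp (lam * (t - s)) * Real.exp (-(lam * S.κ * |pj x - ξ|))) := by
            gcongr
        _ = _ := by ring

end Part4

section Part5

variable {n : ℕ}

lemma Sys.T_false (S : Sys n) (g gt : Fin n → ℝ → ℝ → ℝ) (R : Fin n × Bool → ℝ → ℝ → ℝ)
    (j : Fin n) (x t : ℝ) :
    (S.fp g gt).T R (j, false) x t = ∑ k, S.p j k * R (k, false) (S.o k) (S.Om j (S.e j) x t) +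
      ∫ ξ in (S.e j)..(pj x), (g j ξ (S.Om j ξ x t) +
        ∑ k, -S.β j k ξ (S.Om j ξ x t) * R (k, false) ξ (S.Om j ξ x t)) := by
  simp only [FPData.T, Fintype.sum_prod_type, Fintype.sum_bool, Sys.fp, zero_mul, zero_add]

lemma Sys.T_true (S : Sys n) (g gt : Fin n → ℝ → ℝ → ℝ) (R : Fin n × Bool → ℝ → ℝ → ℝ)
    (j : Fin n) (x t : ℝ) :
    (S.fp g gt).T R (j, true) x t =
      ∑ k, S.w j (S.e j) x t * S.p j k * R (k, true) (S.o k) (S.Om j (S.e j) x t) +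
      ∫ ξ in (S.e j)..(pj x), (S.w j ξ x t * gt j ξ (S.Om j ξ x t) +
        ∑ k, (-(S.w j ξ x t * S.β j k ξ (S.Om j ξ x t)) * R (k, true) ξ (S.Om j ξ x t) +
          -(S.w j ξ x t * S.βt j k ξ (S.Om j ξ x t)) * R (k, false) ξ (S.Om j ξ x t))) := by
  simp only [FPData.T, Fintype.sum_prod_type, Fintype.sum_bool, Sys.fp, zero_mul, add_zero]

lemma Sys.Om_dt (S : Sys n) (j : Fin n) (ξ x t : ℝ) :
    HasDerivAt (fun t => S.Om j ξ x t) (S.w j ξ x t) t := (S.sl j).Om_deriv_t ξ x t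

/-- time differentiability is preserved by the fixed point map -/
lemma Sys.T_deriv (S : Sys n) {g gt : Fin n → ℝ → ℝ → ℝ} (cg : CF g) (cgt : CF gt)
    (dg : ∀ j x t, HasDerivAt (g j x) (gt j x t) t)
    {R : Fin n × Bool → ℝ → ℝ → ℝ} (cR : CF R)
    (dR : ∀ j x t, HasDerivAt (R (j, false) x) (R (j, true) x t) t) (j : Fin n) (x t : ℝ) :
    HasDerivAt ((S.fp g gt).T R (j, false) x) ((S.fp g gt).T R (j, true) x t) t := by
  have e1 : (S.fp g gt).T R (j, false) x = fun t => _ := funext fun t => S.T_false g gt R j x t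
  rw [e1, S.T_true]
  refine HasDerivAt.add ?_ ?_
  · refine HasDerivAt.fun_sum fun k _ => ?_
    have := ((dR k (S.o k) (S.Om j (S.e j) x t)).comp t (S.Om_dt j (S.e j) x t)).const_mul (S.p j k)
    exact this.congr_deriv (by ring)
  · have cΩ : Continuous fun q : ℝ × ℝ => S.Om j q.1 x q.2 :=
      S.Om_cont j continuous_fst continuous_const continuous_snd
    have cw : Continuous fun q : ℝ × ℝ => S.w j q.1 x q.2 :=
      S.w_cont j continuous_fst continuous_const continuous_snd
    refine deriv_int (h := fun ξ t => g j ξ (S.Om j ξ x t) +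
        ∑ k, -S.β j k ξ (S.Om j ξ x t) * R (k, false) ξ (S.Om j ξ x t))
      (ht := fun ξ t => S.w j ξ x t * gt j ξ (S.Om j ξ x t) +
        ∑ k, (-(S.w j ξ x t * S.β j k ξ (S.Om j ξ x t)) * R (k, true) ξ (S.Om j ξ x t) +
          -(S.w j ξ x t * S.βt j k ξ (S.Om j ξ x t)) * R (k, false) ξ (S.Om j ξ x t)))
      ?_ ?_ ?_ _ _ t
    · refine (c2 (cg j) continuous_fst cΩ).add (continuous_finset_sum _ fun k _ => ?_)
      exact (c2 (S.cβ j k) continuous_fst cΩ).neg.mul (c2 (cR _) continuous_fst cΩ)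
    · refine (cw.mul (c2 (cgt j) continuous_fst cΩ)).add (continuous_finset_sum _ fun k _ => ?_)
      refine Continuous.add ?_ ?_
      · exact (cw.mul (c2 (S.cβ j k) continuous_fst cΩ)).neg.mul (c2 (cR _) continuous_fst cΩ)
      · exact (cw.mul (c2 (S.cβt j k) continuous_fst cΩ)).neg.mul (c2 (cR _) continuous_fst cΩ)
    · intro ξ t
      have hΩ := S.Om_dt j ξ x t
      have h1 : HasDerivAt (fun t => g j ξ (S.Om j ξ x t))
          (S.w j ξ x t * gt j ξ (S.Om j ξ x t)) t :=
        ((dg j ξ _).comp t hΩ).congr_deriv (by ring)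
      refine h1.add (HasDerivAt.fun_sum fun k _ => ?_)
      have h2 := ((S.dβ j k ξ _).comp t hΩ).neg.mul ((dR k ξ _).comp t hΩ)
      refine h2.congr_deriv ?_
      simp only [Function.comp, Pi.neg_apply]
      ring

theorem Sys.solve (S : Sys n) {c : Fin n → ℝ} (hc : ∀ j, 0 < c j)
    (hpc : ∀ j k, |S.p j k| * c k ≤ (1 / (4 * (n + 1) * Real.exp S.L)) * c j)
    {lam s Γ Cg : ℝ} (hl : 1 ≤ lam) (hlc : ∀ j, 8 * Real.exp S.L * S.B * ∑ k, c k ≤ c j * lam * S.κ)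
    (hΓ0 : 0 ≤ Γ) (hΓ : ∀ j, Real.exp S.L * Cg ≤ Γ * c j * S.κ)
    {g gt : Fin n → ℝ → ℝ → ℝ} (cg : CF g) (cgt : CF gt)
    (bg : ∀ j x t, |g j x t| ≤ Cg * Real.exp (lam * (t - s)))
    (bgt : ∀ j x t, |gt j x t| ≤ Cg * lam * Real.exp (lam * (t - s)))
    (dg : ∀ j x t, HasDerivAt (g j x) (gt j x t) t)
    {Q : Set (ℝ × ℝ)}
    (hQo : ∀ j k, ∀ x ∈ I01, ∀ t, (x, t) ∈ Q → (S.o k, S.Om j (S.e j) x t) ∈ Q)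
    (hQ : ∀ j, ∀ x ∈ I01, ∀ t, (x, t) ∈ Q → ∀ ξ ∈ uIcc (S.e j) x, (ξ, S.Om j ξ x t) ∈ Q)
    (hQg : ∀ j, ∀ x ∈ I01, ∀ t, (x, t) ∈ Q → g j x t = 0) :
    ∃ r y : Fin n → ℝ → ℝ → ℝ, CF r ∧ CF y ∧
      (∀ j x t, HasDerivAt (r j x) (y j x t) t) ∧
      (∀ j x t, r j x t = ∑ k, S.p j k * r k (S.o k) (S.Om j (S.e j) x t) +
      ∫ ξ in (S.e j)..(pj x), (g j ξ (S.Om j ξ x t) +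
        ∑ k, -S.β j k ξ (S.Om j ξ x t) * r k ξ (S.Om j ξ x t))) ∧
      (∀ j x t, y j x t = ∑ k, S.w j (S.e j) x t * S.p j k * y k (S.o k) (S.Om j (S.e j) x t) +
      ∫ ξ in (S.e j)..(pj x), (S.w j ξ x t * gt j ξ (S.Om j ξ x t) +
        ∑ k, (-(S.w j ξ x t * S.β j k ξ (S.Om j ξ x t)) * y k ξ (S.Om j ξ x t) +
          -(S.w j ξ x t * S.βt j k ξ (S.Om j ξ x t)) * r k ξ (S.Om j ξ x t)))) ∧
      (∀ j x t, |r j x t| ≤ 2 * Γ * (c j * Real.exp (lam * (t - s)) / lam)) ∧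
      (∀ j, ∀ x ∈ I01, ∀ t, (x, t) ∈ Q → r j x t = 0) := by
  have ok := S.ok hc hpc hl hlc hΓ0 hΓ cg cgt bg bgt
  obtain ⟨R, cR, hT, hb, hconv⟩ := ok.fixed
  have hpow : Tendsto (fun N : ℕ => 2 * Γ / 2 ^ N) atTop (nhds 0) := by
    have := (tendsto_pow_atTop_nhds_zero_of_lt_one (r := (1/2:ℝ)) (by norm_num)
      (by norm_num)).const_mul (2 * Γ)
    rw [mul_zero] at this
    refine this.congr fun N => ?_
    rw [one_div, inv_pow, div_eq_mul_inv]
  have hptw : ∀ i x t, Tendsto (fun N => (S.fp g gt).it N i x t) atTop (nhds (R i x t)) := by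
    intro i x t
    rw [tendsto_iff_dist_tendsto_zero]
    have h2 : Tendsto (fun N : ℕ => 2 * Γ / 2 ^ N * Wt c lam s i t) atTop (nhds 0) := by
      simpa using hpow.mul_const (Wt c lam s i t)
    exact squeeze_zero (fun _ => dist_nonneg) (fun N => by rw [Real.dist_eq]; exact hconv N i x t) h2
  have hitd : ∀ N j x t, HasDerivAt ((S.fp g gt).it N (j, false) x)
      ((S.fp g gt).it N (j, true) x t) t := by
    intro N
    induction N with
    | zero => intro j x t; exact hasDerivAt_const t (0:ℝ)
    | succ N ih => intro j x t; exact S.T_deriv cg cgt dg (ok.it_cont N) ih j x t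
  have hit0 : ∀ N j, ∀ x ∈ I01, ∀ t, (x, t) ∈ Q → (S.fp g gt).it N (j, false) x t = 0 := by
    intro N
    induction N with
    | zero => intro j x _ t _; rfl
    | succ N ih =>
      intro j x hx t hq
      change (S.fp g gt).T _ (j, false) x t = 0
      rw [S.T_false, pj_of_mem hx]
      rw [Finset.sum_eq_zero fun k _ => by
        rw [ih k _ (S.o_mem k) _ (hQo j k x hx t hq), mul_zero], zero_add]
      refine intervalIntegral.integral_zero_ae (Eventually.of_forall fun ξ hξ => ?_)
      have hξ' := uIoc_subset_uIcc hξ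
      have hξI := uIcc_sub_I (S.e_mem j) hx hξ'
      have hm := hQ j x hx t hq ξ hξ'
      rw [hQg j ξ hξI _ hm, zero_add]
      exact Finset.sum_eq_zero fun k _ => by rw [ih k ξ hξI _ hm, mul_zero]
  refine ⟨fun j => R (j, false), fun j => R (j, true), fun j => cR _, fun j => cR _, ?_, ?_, ?_, ?_, ?_⟩
  · intro j x t
    refine hasDerivAt_of_tendstoLocallyUniformlyOn (l := atTop) (s := Ioo (t - 1) (t + 1))
      (f := fun N => (S.fp g gt).it N (j, false) x)
      (f' := fun N => (S.fp g gt).it N (j, true) x) isOpen_Ioo ?_ ?_ ?_ (by simp)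
    · apply TendstoUniformlyOn.tendstoLocallyUniformlyOn
      rw [Metric.tendstoUniformlyOn_iff]
      intro ε hε
      have h1 : Tendsto (fun N : ℕ => 2 * Γ / 2 ^ N * Wt c lam s (j, true) (t + 1)) atTop (nhds 0) := by
        simpa using hpow.mul_const (Wt c lam s (j, true) (t + 1))
      filter_upwards [h1.eventually (gt_mem_nhds hε)] with N hN t' ht'
      rw [dist_comm, Real.dist_eq]
      refine ((hconv N (j, true) x t').trans (mul_le_mul_of_nonneg_left ?_ (by positivity))).trans_lt hN
      simp only [Wt]
      have := hc j
      gcongr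
      exact ht'.2.le
    · exact Eventually.of_forall fun N t' _ => hitd N j x t'
    · exact fun t' _ => hptw _ _ _
  · intro j x t
    simp only
    conv_lhs => rw [← hT, S.T_false]
  · intro j x t
    simp only
    conv_lhs => rw [← hT, S.T_true]
  · intro j x t
    simpa only [Wt] using hb (j, false) x t
  · intro j x hx t hq
    refine tendsto_nhds_unique (hptw (j, false) x t) ?_
    simp only [hit0 _ j x hx t hq]
    exact tendsto_const_nhds

end Part5

section Part6

variable {n : ℕ}

lemma theta_exists : ∃ (θ θ' : ℝ → ℝ) (C : ℝ), 0 ≤ C ∧ Continuous θ' ∧ (∀ z, HasDerivAt θ (θ' z) z) ∧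
    (∀ z, |θ z| ≤ 1) ∧ (∀ z, |θ' z| ≤ C) ∧ (∀ z ≤ 0, θ z = 0 ∧ θ' z = 0) ∧
    (∀ z, 1 ≤ z → θ z = 1 ∧ θ' z = 0) := by
  have hcd : ContDiff ℝ 1 Real.smoothTransition := Real.smoothTransition.contDiff
  have hdc : Continuous (deriv Real.smoothTransition) := hcd.continuous_deriv le_rfl
  have h0 : ∀ z ≤ 0, deriv Real.smoothTransition z = 0 := by
    have hcl : IsClosed {z | deriv Real.smoothTransition z = 0} := isClosed_eq hdc continuous_const
    have hsub : Iio (0:ℝ) ⊆ {z | deriv Real.smoothTransition z = 0} := by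
      intro z hz
      have : Real.smoothTransition =ᶠ[nhds z] fun _ => 0 := by
        filter_upwards [Iio_mem_nhds hz] with y hy
        exact Real.smoothTransition.zero_of_nonpos (le_of_lt hy)
      change deriv _ z = 0
      rw [this.deriv_eq]; simp
    have := hcl.closure_subset_iff.2 hsub
    rw [closure_Iio] at this
    exact fun z hz => this hz
  have h1 : ∀ z, 1 ≤ z → deriv Real.smoothTransition z = 0 := by
    have hcl : IsClosed {z | deriv Real.smoothTransition z = 0} := isClosed_eq hdc continuous_const
    have hsub : Ioi (1:ℝ) ⊆ {z | deriv Real.smoothTransition z = 0} := by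
      intro z hz
      have : Real.smoothTransition =ᶠ[nhds z] fun _ => 1 := by
        filter_upwards [Ioi_mem_nhds hz] with y hy
        exact Real.smoothTransition.one_of_one_le (le_of_lt hy)
      change deriv _ z = 0
      rw [this.deriv_eq]; simp
    have := hcl.closure_subset_iff.2 hsub
    rw [closure_Ioi] at this
    exact fun z hz => this hz
  obtain ⟨C, hC⟩ := (isCompact_Icc (a := (0:ℝ)) (b := 1)).exists_bound_of_continuousOn hdc.continuousOn
  have hC0 : 0 ≤ C := (norm_nonneg _).trans (hC 0 (by simp))
  refine ⟨Real.smoothTransition, deriv Real.smoothTransition, C, hC0, hdc,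
    fun z => (hcd.differentiable one_ne_zero z).hasDerivAt, fun z => ?_, fun z => ?_,
    fun z hz => ⟨Real.smoothTransition.zero_of_nonpos hz, h0 z hz⟩,
    fun z hz => ⟨Real.smoothTransition.one_of_one_le hz, h1 z hz⟩⟩
  · rw [abs_of_nonneg (Real.smoothTransition.nonneg z)]; exact Real.smoothTransition.le_one z
  · by_cases hz : z ≤ 0
    · rw [h0 z hz]; simpa using hC0
    · by_cases hz1 : 1 ≤ z
      · rw [h1 z hz1]; simpa using hC0
      · exact hC z ⟨(not_le.1 hz).le, (not_le.1 hz1).le⟩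

/-- regular solutions of the homogeneous problem after time `s` -/
structure GoodSol (S : Sys n) (s : ℝ) (u y : Fin n → ℝ → ℝ → ℝ) : Prop where
  cu : CF u
  cy : CF y
  dt : ∀ j x t, HasDerivAt (u j x) (y j x t) t
  dx : ∀ j, ∀ x ∈ I01, ∀ t, s ≤ t → HasDerivWithinAt (fun x => u j x t)
    (-(S.α j x t * y j x t) - ∑ k, S.β j k x t * u k x t) I01 x
  bc : ∀ j t, u j (S.e j) t = ∑ k, S.p j k * u k (S.o k) t
  bcy : ∀ j t, y j (S.e j) t = ∑ k, S.p j k * y k (S.o k) t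
  ych : ∀ j x t, x ∈ I01 → s + S.δ ≤ t → ∀ ξ ∈ I01,
    HasDerivWithinAt (fun ξ => S.w j ξ x t * y j ξ (S.Om j ξ x t))
      (S.w j ξ x t * -(∑ k, (S.βt j k ξ (S.Om j ξ x t) * u k ξ (S.Om j ξ x t) +
        S.β j k ξ (S.Om j ξ x t) * y k ξ (S.Om j ξ x t)))) I01 ξ

lemma GoodSol.sub {S : Sys n} {s : ℝ} {u y u' y' : Fin n → ℝ → ℝ → ℝ} (h : GoodSol S s u y)
    (h' : GoodSol S s u' y') :
    GoodSol S s (fun j x t => u j x t - u' j x t) (fun j x t => y j x t - y' j x t) where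
  cu := fun j => (h.cu j).sub (h'.cu j)
  cy := fun j => (h.cy j).sub (h'.cy j)
  dt := fun j x t => (h.dt j x t).sub (h'.dt j x t)
  dx := fun j x hx t ht => by
    refine ((h.dx j x hx t ht).sub (h'.dx j x hx t ht)).congr_deriv ?_
    simp only [mul_sub, Finset.sum_sub_distrib]; ring
  bc := fun j t => by
    rw [h.bc, h'.bc, ← Finset.sum_sub_distrib]; simp only [mul_sub]
  bcy := fun j t => by
    rw [h.bcy, h'.bcy, ← Finset.sum_sub_distrib]; simp only [mul_sub]
  ych := fun j x t hx ht ξ hξ => by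
    have := ((h.ych j x t hx ht ξ hξ).sub (h'.ych j x t hx ht ξ hξ))
    refine (this.congr_deriv ?_).congr (fun y hy => ?_) ?_
    · rw [← mul_sub, neg_sub_neg, ← Finset.sum_sub_distrib, ← Finset.sum_neg_distrib]
      congr 1
      exact Finset.sum_congr rfl fun k _ => by ring
    · simp only [Pi.sub_apply]; ring
    · simp only [Pi.sub_apply]; ring

lemma Sys.Om_c1 (S : Sys n) (j : Fin n) (x t : ℝ) : Continuous fun ξ => S.Om j ξ x t :=
  S.Om_cont j continuous_id continuous_const continuous_const

lemma Sys.w_c1 (S : Sys n) (j : Fin n) (x t : ℝ) : Continuous fun ξ => S.w j ξ x t :=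
  S.w_cont j continuous_id continuous_const continuous_const

/-- assembling a good solution from the fixed point formulas -/
lemma good_of_fp (S : Sys n) {s : ℝ} {φ ψ : Fin n → ℝ → ℝ} (cψ : ∀ j, Continuous (ψ j))
    (dφ : ∀ j x, HasDerivAt (φ j) (ψ j x) x) (hφ0 : ∀ j, φ j 0 = 0) (hφ1 : ∀ j, φ j 1 = 0)
    {g gt r y : Fin n → ℝ → ℝ → ℝ} (cg : CF g) (cgt : CF gt) (cr : CF r) (cy : CF y)
    (hg : ∀ j x t, s ≤ t → g j x t = -(ψ j x + ∑ k, S.β j k x t * φ k x))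
    (hgt : ∀ j x t, s ≤ t → gt j x t = -(∑ k, S.βt j k x t * φ k x))
    (dr : ∀ j x t, HasDerivAt (r j x) (y j x t) t)
    (hr : ∀ j x t, r j x t = ∑ k, S.p j k * r k (S.o k) (S.Om j (S.e j) x t) +
      ∫ ξ in (S.e j)..(pj x), (g j ξ (S.Om j ξ x t) +
        ∑ k, -S.β j k ξ (S.Om j ξ x t) * r k ξ (S.Om j ξ x t)))
    (hy : ∀ j x t, y j x t = ∑ k, S.w j (S.e j) x t * S.p j k * y k (S.o k) (S.Om j (S.e j) x t) +
      ∫ ξ in (S.e j)..(pj x), (S.w j ξ x t * gt j ξ (S.Om j ξ x t) +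
        ∑ k, (-(S.w j ξ x t * S.β j k ξ (S.Om j ξ x t)) * y k ξ (S.Om j ξ x t) +
          -(S.w j ξ x t * S.βt j k ξ (S.Om j ξ x t)) * r k ξ (S.Om j ξ x t)))) :
    GoodSol S s (fun j x t => φ j x + r j x t) y := by
  have cφ : ∀ j, Continuous (φ j) := fun j => continuous_iff_continuousAt.2
    fun x => (dφ j x).continuousAt
  have hφo : ∀ k, φ k (S.o k) = 0 := fun k => by
    rcases S.hin k with h | h <;> rw [h.2.1] <;> simp [hφ0, hφ1]
  have hφe : ∀ k, φ k (S.e k) = 0 := fun k => by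
    rcases S.hin k with h | h <;> rw [h.1] <;> simp [hφ0, hφ1]
  have hOs : ∀ j x t, x ∈ I01 → S.Om j x x t = t := fun j x t hx => (S.sl j).Om_self hx t
  have hgrp : ∀ j ξ x t, ∀ y ∈ I01, S.Om j ξ y (S.Om j y x t) = S.Om j ξ x t := fun j ξ x t y hy =>
    (S.sl j).Om_group ξ x t hy
  have hwg : ∀ j ξ x t, ∀ y ∈ I01, S.w j ξ y (S.Om j y x t) * S.w j y x t = S.w j ξ x t :=
    fun j ξ x t y hy => (S.sl j).w_group ξ x t hy
  -- derivative of r along characteristics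
  have rch : ∀ j x t, ∀ ξ ∈ I01, HasDerivWithinAt (fun ξ => r j ξ (S.Om j ξ x t))
      (g j ξ (S.Om j ξ x t) + ∑ k, -S.β j k ξ (S.Om j ξ x t) * r k ξ (S.Om j ξ x t)) I01 ξ := by
    intro j x t ξ hξ
    have hc : Continuous fun ξ => g j ξ (S.Om j ξ x t) +
        ∑ k, -S.β j k ξ (S.Om j ξ x t) * r k ξ (S.Om j ξ x t) := by
      refine (c2 (cg j) continuous_id (S.Om_c1 j x t)).add (continuous_finset_sum _ fun k _ => ?_)
      exact (c2 (S.cβ j k) continuous_id (S.Om_c1 j x t)).neg.mul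
        (c2 (cr k) continuous_id (S.Om_c1 j x t))
    have h1 := ((prim_deriv hc (S.e j) ξ).const_add
      (∑ k, S.p j k * r k (S.o k) (S.Om j (S.e j) x t))).hasDerivWithinAt (s := I01)
    have hf : ∀ ξ ∈ I01, r j ξ (S.Om j ξ x t) = ∑ k, S.p j k * r k (S.o k) (S.Om j (S.e j) x t) +
        ∫ ξ in (S.e j)..ξ, (g j ξ (S.Om j ξ x t) +
        ∑ k, -S.β j k ξ (S.Om j ξ x t) * r k ξ (S.Om j ξ x t)) := by
      intro ξ hξ
      rw [hr, pj_of_mem hξ]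
      simp only [hgrp j _ x t ξ hξ]
    exact h1.congr hf (hf ξ hξ)
  refine ⟨fun j => ((cφ j).comp continuous_fst).add (cr j), cy, fun j x t => (dr j x t).const_add _,
    ?_, ?_, ?_, ?_⟩
  · intro j x hx t ht
    have h1 := rch j x t x hx
    have h2 := (S.sl j).Om_curve x t
    have h3 := chain_sub (cy j) (dr j) (c := fun ξ => S.Om j ξ x t) (hOs j x t hx) (h2.2 x hx) h1
    have h4 := ((dφ j x).hasDerivWithinAt (s := I01)).add h3
    refine h4.congr_deriv ?_
    have e1 : (S.sl j).Om x x t = t := hOs j x t hx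
    simp only [hOs j x t hx, e1, hg j x t ht]
    have e2 : ∑ k, S.β j k x t * (φ k x + r k x t) = ∑ k, S.β j k x t * φ k x -
        ∑ k, -S.β j k x t * r k x t := by
      rw [← Finset.sum_sub_distrib]; exact Finset.sum_congr rfl fun k _ => by ring
    rw [e2]; ring
  · intro j t
    simp only [hφo, hφe, zero_add]
    rw [hr, pj_of_mem (S.e_mem j), intervalIntegral.integral_same, add_zero, hOs j _ t (S.e_mem j)]
  · intro j t
    rw [hy, pj_of_mem (S.e_mem j), intervalIntegral.integral_same, add_zero, hOs j _ t (S.e_mem j)]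
    have : S.w j (S.e j) (S.e j) t = 1 := (S.sl j).w_self _ _
    simp only [this, one_mul]
  · intro j x t hx ht ξ hξ
    have hc : Continuous fun ξ => S.w j ξ x t * gt j ξ (S.Om j ξ x t) +
        ∑ k, (-(S.w j ξ x t * S.β j k ξ (S.Om j ξ x t)) * y k ξ (S.Om j ξ x t) +
          -(S.w j ξ x t * S.βt j k ξ (S.Om j ξ x t)) * r k ξ (S.Om j ξ x t)) := by
      refine ((S.w_c1 j x t).mul (c2 (cgt j) continuous_id (S.Om_c1 j x t))).add
        (continuous_finset_sum _ fun k _ => Continuous.add ?_ ?_)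
      · exact ((S.w_c1 j x t).mul (c2 (S.cβ j k) continuous_id (S.Om_c1 j x t))).neg.mul
          (c2 (cy k) continuous_id (S.Om_c1 j x t))
      · exact ((S.w_c1 j x t).mul (c2 (S.cβt j k) continuous_id (S.Om_c1 j x t))).neg.mul
          (c2 (cr k) continuous_id (S.Om_c1 j x t))
    have h1 := ((prim_deriv hc (S.e j) ξ).const_add
      (∑ k, S.w j (S.e j) x t * S.p j k * y k (S.o k) (S.Om j (S.e j) x t))).hasDerivWithinAt (s := I01)
    have hf : ∀ ξ ∈ I01, S.w j ξ x t * y j ξ (S.Om j ξ x t) =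
        ∑ k, S.w j (S.e j) x t * S.p j k * y k (S.o k) (S.Om j (S.e j) x t) +
        ∫ ξ in (S.e j)..ξ, (S.w j ξ x t * gt j ξ (S.Om j ξ x t) +
        ∑ k, (-(S.w j ξ x t * S.β j k ξ (S.Om j ξ x t)) * y k ξ (S.Om j ξ x t) +
          -(S.w j ξ x t * S.βt j k ξ (S.Om j ξ x t)) * r k ξ (S.Om j ξ x t))) := by
      intro ξ hξ
      rw [hy, pj_of_mem hξ, mul_add, Finset.mul_sum, ← intervalIntegral.integral_const_mul]
      simp only [hgrp j _ x t ξ hξ]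
      congr 1
      · refine Finset.sum_congr rfl fun k _ => ?_
        rw [← hwg j (S.e j) x t ξ hξ]; ring
      · congr 1; ext η
        rw [mul_add, Finset.mul_sum]
        congr 1
        · rw [← hwg j η x t ξ hξ]; ring
        · refine Finset.sum_congr rfl fun k _ => ?_
          rw [← hwg j η x t ξ hξ]; ring
    refine (h1.congr hf (hf ξ hξ)).congr_deriv ?_
    have hOm : s ≤ S.Om j ξ x t := by
      have h := (S.sl j).Om_sub_le ξ hx t
      have := (abs_le.1 h).1
      unfold Sys.Om; linarith
    rw [hgt j _ _ hOm, mul_neg, mul_neg]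
    rw [Finset.mul_sum, Finset.mul_sum, ← Finset.sum_neg_distrib, ← Finset.sum_neg_distrib,
      ← Finset.sum_add_distrib]
    exact Finset.sum_congr rfl fun k _ => by ring

end Part6

section Part7

variable {n : ℕ}

lemma Sys.Om_ge (S : Sys n) (j : Fin n) {x : ℝ} (hx : x ∈ I01) (ξ t : ℝ) :
    t - S.δ ≤ S.Om j ξ x t ∧ S.Om j ξ x t ≤ t + S.δ := by
  have h := abs_le.1 ((S.sl j).Om_sub_le ξ hx t)
  unfold Sys.Om; constructor <;> linarith [h.1, h.2]

theorem Sys.exists_good (S : Sys n) (s : ℝ) {φ ψ : Fin n → ℝ → ℝ} (cψ : ∀ j, Continuous (ψ j))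
    (dφ : ∀ j x, HasDerivAt (φ j) (ψ j x) x) {xl xr : ℝ} (hxl : 0 < xl) (hxr : xr < 1)
    (hφ : ∀ j x, (x < xl ∨ xr < x) → φ j x = 0) {ε : ℝ} (hε : 0 < ε) :
    ∃ u y, GoodSol S s u y ∧ (∀ j x, |u j x s - φ j x| ≤ ε) ∧
      ∃ l r, 0 < l ∧ r < 1 ∧ ∀ j, ∀ x ∈ I01, (x < l ∨ r < x) → u j x s = 0 := by
  have cφ : ∀ j, Continuous (φ j) := fun j => continuous_iff_continuousAt.2
    fun x => (dφ j x).continuousAt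
  have hψ : ∀ j x, (x < xl ∨ xr < x) → ψ j x = 0 := by
    intro j x hx
    have : φ j =ᶠ[nhds x] fun _ => 0 := by
      rcases hx with hx | hx
      · filter_upwards [Iio_mem_nhds hx] with y hy using hφ j y (Or.inl hy)
      · filter_upwards [Ioi_mem_nhds hx] with y hy using hφ j y (Or.inr hy)
    rw [← (dφ j x).deriv, this.deriv_eq]; simp
  -- bounds of the data
  have hbd : ∃ C, 0 ≤ C ∧ ∀ j x, |φ j x| ≤ C ∧ |ψ j x| ≤ C := by
    have h1 : ∀ f : Fin n → ℝ → ℝ, (∀ j, Continuous (f j)) →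
        (∀ j x, (x < xl ∨ xr < x) → f j x = 0) → ∃ C, 0 ≤ C ∧ ∀ j x, |f j x| ≤ C := by
      intro f cf hf
      choose C hC using fun j => (isCompact_Icc (a := xl) (b := xr)).exists_bound_of_continuousOn
        (cf j).continuousOn
      refine ⟨∑ j, |C j|, by positivity, fun j x => ?_⟩
      have h2 : |C j| ≤ ∑ j, |C j| :=
        Finset.single_le_sum (f := fun j => |C j|) (fun _ _ => abs_nonneg _) (Finset.mem_univ j)
      by_cases hx : x < xl ∨ xr < x
      · rw [hf j x hx, abs_zero]; exact (abs_nonneg _).trans h2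
      · push Not at hx
        exact ((hC j x hx).trans (le_abs_self _)).trans h2
    obtain ⟨C1, h10, h1'⟩ := h1 φ cφ hφ
    obtain ⟨C2, h20, h2'⟩ := h1 ψ cψ hψ
    exact ⟨C1 + C2, by positivity, fun j x => ⟨(h1' j x).trans (by linarith), (h2' j x).trans (by linarith)⟩⟩
  obtain ⟨Cd, hCd, hbd⟩ := hbd
  obtain ⟨θ, θ', Cθ, hCθ, cθ', dθ, bθ, bθ', θ0, θ1⟩ := theta_exists
  have cθ : Continuous θ := continuous_iff_continuousAt.2 fun x => (dθ x).continuousAt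
  set C0 : ℝ := Cd + n * (S.B * Cd) with hC0
  have hB := S.B0
  have hC00 : 0 ≤ C0 := by positivity
  have bsum : ∀ (b : Fin n → Fin n → ℝ → ℝ → ℝ), (∀ j k x t, |b j k x t| ≤ S.B) → ∀ j x t,
      |∑ k, b j k x t * φ k x| ≤ n * (S.B * Cd) := by
    intro b hb j x t
    refine (Finset.abs_sum_le_sum_abs _ _).trans ?_
    calc _ ≤ ∑ _k : Fin n, S.B * Cd := Finset.sum_le_sum fun k _ => by
          rw [abs_mul]; exact mul_le_mul (hb _ _ _ _) (hbd _ _).1 (abs_nonneg _) hB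
      _ = _ := by simp
  have bH : ∀ j x t, |ψ j x + ∑ k, S.β j k x t * φ k x| ≤ C0 := fun j x t =>
    (abs_add_le _ _).trans (add_le_add (hbd j x).2 (bsum S.β S.bβ j x t))
  set Cg : ℝ := Real.exp 1 * ((Cθ + 1) * C0) with hCg
  obtain ⟨c, hc, hpc⟩ := exists_scale S.p S.ρ S.hρ
    (ε := 1 / (4 * (n + 1) * Real.exp S.L)) (by positivity)
  have hκ := S.κ0
  have hCg0 : 0 ≤ Cg := by positivity
  set Γ : ℝ := ∑ j, Real.exp S.L * Cg / (c j * S.κ) with hΓdef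
  have hΓ0 : 0 ≤ Γ := Finset.sum_nonneg fun j _ => by have := hc j; positivity
  have hΓ : ∀ j, Real.exp S.L * Cg ≤ Γ * c j * S.κ := by
    intro j
    have hcj := hc j
    have h1 : Real.exp S.L * Cg / (c j * S.κ) ≤ Γ :=
      Finset.single_le_sum (f := fun j => Real.exp S.L * Cg / (c j * S.κ))
        (fun j _ => by have := hc j; positivity) (Finset.mem_univ j)
    rw [div_le_iff₀ (by positivity)] at h1
    linarith
  -- choice of lam
  have hev : ∀ᶠ lam : ℝ in atTop, 1 ≤ lam ∧
      (∀ j, 8 * Real.exp S.L * S.B * ∑ k, c k ≤ c j * lam * S.κ) ∧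
      (∀ j, 2 * Γ * (c j / lam) ≤ ε) ∧ (1 / S.κ) / lam < xl ∧ (1 / S.κ) / lam < 1 - xr := by
    have hz : ∀ K : ℝ, Tendsto (fun lam : ℝ => K / lam) atTop (nhds 0) := fun K =>
      tendsto_const_nhds.div_atTop tendsto_id
    refine (eventually_ge_atTop 1).and ((eventually_all.2 fun j => ?_).and
      ((eventually_all.2 fun j => ?_).and (((hz _).eventually (gt_mem_nhds hxl)).and
        ((hz _).eventually (gt_mem_nhds (by linarith))))))
    · have : Tendsto (fun lam : ℝ => c j * lam * S.κ) atTop atTop :=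
        (tendsto_id.const_mul_atTop (hc j)).atTop_mul_const hκ
      exact this.eventually_ge_atTop _
    · have h1 := (hz (c j)).const_mul (2 * Γ)
      rw [mul_zero] at h1
      exact (h1.eventually (gt_mem_nhds hε)).mono fun _ h => h.le
  obtain ⟨lam, hl1, hlc, hlε, hlxl, hlxr⟩ := hev.exists
  have hl0 : 0 < lam := by linarith
  -- the source
  set g : Fin n → ℝ → ℝ → ℝ := fun j x t =>
    -(θ (lam * (t - s) + 1) * (ψ j x + ∑ k, S.β j k x t * φ k x)) with hgdef
  set gt : Fin n → ℝ → ℝ → ℝ := fun j x t =>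
    -((lam * θ' (lam * (t - s) + 1)) * (ψ j x + ∑ k, S.β j k x t * φ k x) +
      θ (lam * (t - s) + 1) * ∑ k, S.βt j k x t * φ k x) with hgtdef
  have csum : ∀ (b : Fin n → Fin n → ℝ → ℝ → ℝ), (∀ j k, Continuous fun q : ℝ × ℝ => b j k q.1 q.2) →
      ∀ j, Continuous fun q : ℝ × ℝ => ∑ k, b j k q.1 q.2 * φ k q.1 := fun b hb j =>
    continuous_finset_sum _ fun k _ => (hb j k).mul ((cφ k).comp continuous_fst)
  have cz : Continuous fun q : ℝ × ℝ => lam * (q.2 - s) + 1 := by fun_prop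
  have cg : CF g := fun j => ((cθ.comp cz).mul
    (((cψ j).comp continuous_fst).add (csum S.β S.cβ j))).neg
  have cgt : CF gt := fun j => (((continuous_const.mul (cθ'.comp cz)).mul
    (((cψ j).comp continuous_fst).add (csum S.β S.cβ j))).add
      ((cθ.comp cz).mul (csum S.βt S.cβt j))).neg
  have dg : ∀ j x t, HasDerivAt (g j x) (gt j x t) t := by
    intro j x t
    have h1 : HasDerivAt (fun t => θ (lam * (t - s) + 1)) (lam * θ' (lam * (t - s) + 1)) t := by
      have hz : HasDerivAt (fun t => lam * (t - s) + 1) lam t := by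
        simpa using (((hasDerivAt_id t).sub_const s).const_mul lam).add_const 1
      exact ((dθ _).comp t hz).congr_deriv (by ring)
    have h2 : HasDerivAt (fun t => ψ j x + ∑ k, S.β j k x t * φ k x) (∑ k, S.βt j k x t * φ k x) t :=
      (HasDerivAt.fun_sum fun k _ => (S.dβ j k x t).mul_const (φ k x)).const_add _
    exact (h1.mul h2).neg
  have hexpge : ∀ t, ¬ (lam * (t - s) + 1 ≤ 0) → 1 ≤ Real.exp 1 * Real.exp (lam * (t - s)) := by
    intro t ht
    rw [← Real.exp_add]
    exact Real.one_le_exp (by linarith [not_le.1 ht])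
  have bg : ∀ j x t, |g j x t| ≤ Cg * Real.exp (lam * (t - s)) := by
    intro j x t
    by_cases ht : lam * (t - s) + 1 ≤ 0
    · simp only [hgdef, (θ0 _ ht).1, zero_mul, neg_zero, abs_zero]; positivity
    · simp only [hgdef, abs_neg, abs_mul]
      calc _ ≤ 1 * C0 := by gcongr; exact bθ _; exact bH j x t
        _ ≤ (Cθ + 1) * C0 * 1 := by nlinarith
        _ ≤ (Cθ + 1) * C0 * (Real.exp 1 * Real.exp (lam * (t - s))) := by
          gcongr; exact hexpge t ht
        _ = _ := by rw [hCg]; ring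
  have bgt : ∀ j x t, |gt j x t| ≤ Cg * lam * Real.exp (lam * (t - s)) := by
    intro j x t
    by_cases ht : lam * (t - s) + 1 ≤ 0
    · simp only [hgtdef, (θ0 _ ht).1, (θ0 _ ht).2, zero_mul, mul_zero, add_zero, neg_zero, abs_zero]
      positivity
    · simp only [hgtdef, abs_neg]
      have h2 : |∑ k, S.βt j k x t * φ k x| ≤ C0 := (bsum S.βt S.bβt j x t).trans (by linarith)
      calc _ ≤ (lam * Cθ) * C0 + 1 * C0 := by
            refine (abs_add_le _ _).trans ?_
            rw [abs_mul, abs_mul, abs_mul, abs_of_pos hl0]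
            gcongr
            · exact bθ' _
            · exact bH j x t
            · exact bθ _
        _ ≤ (lam * Cθ) * C0 + lam * C0 := by gcongr
        _ = (lam * ((Cθ + 1) * C0)) * 1 := by ring
        _ ≤ (lam * ((Cθ + 1) * C0)) * (Real.exp 1 * Real.exp (lam * (t - s))) := by
          gcongr; exact hexpge t ht
        _ = _ := by rw [hCg]; ring
  -- the region
  set Q : Set (ℝ × ℝ) := {q | q.2 ≤ s ∧ (q.1 + (q.2 - (s - 1 / lam)) / S.κ < xl ∨
    xr < q.1 - (q.2 - (s - 1 / lam)) / S.κ)} with hQdef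
  have hcone : ∀ j, ∀ x ∈ I01, ∀ t, (x, t) ∈ Q → ∀ ξ ∈ uIcc (S.e j) x, (ξ, S.Om j ξ x t) ∈ Q := by
    intro j x hx t hq ξ hξ
    have hcz := S.causal j (t := t) hx hξ
    have h1 : |x - ξ| ≤ (t - S.Om j ξ x t) / S.κ := by
      rw [le_div_iff₀ hκ]; linarith
    have h2 := abs_le.1 h1
    have h3 : 0 ≤ S.κ * |x - ξ| := by positivity
    have e1 : (t - (s - 1 / lam)) / S.κ = (t - S.Om j ξ x t) / S.κ +
      (S.Om j ξ x t - (s - 1 / lam)) / S.κ := by ring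
    refine ⟨by have := hq.1; simp only at this ⊢; linarith, ?_⟩
    rcases hq.2 with hq | hq
    · left; simp only at hq ⊢; rw [e1] at hq; linarith [h2.1]
    · right; simp only at hq ⊢; rw [e1] at hq; linarith [h2.2]
  have hbdQ : ∀ k t, t ≤ s → (S.o k, t) ∈ Q := by
    intro k t ht
    have h1 : (t - (s - 1 / lam)) / S.κ ≤ (1 / S.κ) / lam := by
      rw [div_right_comm]
      gcongr; linarith
    refine ⟨ht, ?_⟩
    rcases S.hin k with h | h
    · right; simp only [h.2.1]; linarith
    · left; simp only [h.2.1]; linarith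
  have hQo : ∀ j k, ∀ x ∈ I01, ∀ t, (x, t) ∈ Q → (S.o k, S.Om j (S.e j) x t) ∈ Q := by
    intro j k x hx t hq
    exact hbdQ k _ (hcone j x hx t hq (S.e j) left_mem_uIcc).1
  have hQg : ∀ j, ∀ x ∈ I01, ∀ t, (x, t) ∈ Q → g j x t = 0 := by
    intro j x hx t hq
    by_cases ht : t ≤ s - 1 / lam
    · have : lam * (t - s) + 1 ≤ 0 := by
        have := mul_le_mul_of_nonneg_left ht hl0.le
        rw [mul_sub, mul_one_div_cancel hl0.ne'] at this
        linarith
      simp only [hgdef, (θ0 _ this).1, zero_mul, neg_zero]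
    · have h1 : 0 ≤ (t - (s - 1 / lam)) / S.κ := div_nonneg (by linarith [not_le.1 ht]) hκ.le
      have hx' : x < xl ∨ xr < x := by
        rcases hq.2 with hq | hq
        · left; simp only at hq; linarith
        · right; simp only at hq; linarith
      have h2 : ∑ k, S.β j k x t * φ k x = 0 :=
        Finset.sum_eq_zero fun k _ => by rw [hφ k x hx', mul_zero]
      simp only [hgdef, hψ j x hx', h2, add_zero, mul_zero, neg_zero]
  obtain ⟨r, y, cr, cy, dr, hr, hy, hrb, hr0⟩ := S.solve hc hpc hl1 hlc hΓ0 hΓ cg cgt bg bgt dg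
    hQo hcone hQg
  have hθs : ∀ t, s ≤ t → 1 ≤ lam * (t - s) + 1 := fun t ht => by
    have : 0 ≤ lam * (t - s) := mul_nonneg hl0.le (by linarith)
    linarith
  refine ⟨fun j x t => φ j x + r j x t, y, good_of_fp S cψ dφ (fun j => hφ j 0 (Or.inl hxl))
    (fun j => hφ j 1 (Or.inr hxr)) cg cgt cr cy ?_ ?_ dr hr hy, ?_, ?_⟩
  · intro j x t ht
    simp only [hgdef, (θ1 _ (hθs t ht)).1, one_mul]
  · intro j x t ht
    simp only [hgtdef, (θ1 _ (hθs t ht)).1, (θ1 _ (hθs t ht)).2, one_mul, mul_zero, zero_mul, zero_add]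
  · intro j x
    have := hrb j x s
    simp only [sub_self, mul_zero, Real.exp_zero, mul_one] at this
    simpa using this.trans (hlε j)
  · refine ⟨xl - (1 / S.κ) / lam, xr + (1 / S.κ) / lam, by linarith, by linarith, ?_⟩
    intro j x hx hx'
    have h0 : 0 < (1 / S.κ) / lam := by positivity
    have e1 : (s - (s - 1 / lam)) / S.κ = (1 / S.κ) / lam := by
      rw [div_right_comm]; congr 1; ring
    have hm : (x, s) ∈ Q := by
      refine ⟨le_rfl, ?_⟩
      simp only [e1]
      rcases hx' with h | h
      · left; linarith
      · right; linarith
    beta_reduce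
    rw [hr0 j x hx s hm, hφ j x (by rcases hx' with h | h; left; linarith; right; linarith), add_zero]

end Part7

section Part8

variable {n : ℕ}

/-- variation of constants estimate -/
lemma duh {Z b G : ℝ → ℝ} {B : ℝ} (cb : Continuous b) (cG : Continuous G)
    (hd : ∀ ξ ∈ I01, HasDerivWithinAt Z (-(b ξ * Z ξ) + G ξ) I01 ξ) (hb : ∀ ξ, |b ξ| ≤ B)
    {x y : ℝ} (hx : x ∈ I01) (hy : y ∈ I01) :
    Z x ^ 2 ≤ 2 * Real.exp (4 * B) * (Z y ^ 2 + ∫ ξ in (0:ℝ)..1, G ξ ^ 2) := by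
  have B0 : 0 ≤ B := (abs_nonneg _).trans (hb 0)
  set P : ℝ → ℝ := fun ξ => Real.exp (∫ η in x..ξ, b η) with hP
  have dP : ∀ ξ, HasDerivAt P (P ξ * b ξ) ξ := fun ξ => (prim_deriv cb x ξ).exp
  have cP : Continuous P := continuous_iff_continuousAt.2 fun ξ => (dP ξ).continuousAt
  have Pb : ∀ ξ ∈ I01, P ξ ≤ Real.exp B := by
    intro ξ hξ
    apply Real.exp_le_exp.2
    refine (le_abs_self _).trans ?_
    have := intervalIntegral.norm_integral_le_of_norm_le_const (a := x) (b := ξ) (f := b) (C := B)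
      (fun z _ => hb z)
    rw [Real.norm_eq_abs] at this
    exact this.trans (mul_le_of_le_one_right B0 (abs_sub_le_one_of_mem hξ hx))
  have h1 := ftcI (h := fun ξ => P ξ * Z ξ) (h' := fun ξ => P ξ * G ξ) hy hx (cP.mul cG) (by
    intro ξ hξ
    refine ((dP ξ).hasDerivWithinAt.mul (hd ξ hξ)).congr_deriv ?_
    ring)
  have hPx : P x = 1 := by simp [hP]
  simp only [hPx, one_mul] at h1
  have h2 : (∫ ξ in y..x, P ξ * G ξ) ^ 2 ≤ Real.exp B ^ 2 * ∫ ξ in (0:ℝ)..1, G ξ ^ 2 := by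
    have e1 : |∫ ξ in y..x, P ξ * G ξ| ≤ Real.exp B * ∫ ξ in (0:ℝ)..1, |G ξ| := by
      rw [← intervalIntegral.integral_const_mul]
      have := intervalIntegral.norm_integral_le_abs_integral_norm (f := fun ξ => P ξ * G ξ)
        (a := y) (b := x) (μ := volume)
      refine this.trans ?_
      have e2 : |∫ ξ in y..x, ‖P ξ * G ξ‖| ≤ ∫ ξ in (0:ℝ)..1, ‖P ξ * G ξ‖ := by
        rw [← abs_of_nonneg (intervalIntegral.integral_nonneg (zero_le_one)
          (fun z _ => norm_nonneg (P z * G z)))]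
        apply intervalIntegral.abs_integral_mono_interval
        · rw [uIoc_of_le zero_le_one]
          intro z hz
          rw [uIoc, mem_Ioc] at hz
          exact ⟨(le_min hy.1 hx.1).trans_lt hz.1, hz.2.trans (max_le hy.2 hx.2)⟩
        · filter_upwards with z; exact norm_nonneg _
        · exact (cP.mul cG).norm.intervalIntegrable _ _
      refine e2.trans ?_
      apply intervalIntegral.integral_mono_on zero_le_one
      · exact (cP.mul cG).norm.intervalIntegrable _ _
      · exact (continuous_const.mul cG.abs).intervalIntegrable _ _
      · intro z hz
        rw [norm_mul, Real.norm_eq_abs, Real.norm_eq_abs, abs_of_pos (Real.exp_pos _)]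
        exact mul_le_mul_of_nonneg_right (Pb z hz) (abs_nonneg _)
    have e3 : (∫ ξ in (0:ℝ)..1, |G ξ|) ^ 2 ≤ ∫ ξ in (0:ℝ)..1, G ξ ^ 2 := by
      set m := ∫ ξ in (0:ℝ)..1, |G ξ|
      have : 0 ≤ ∫ ξ in (0:ℝ)..1, (|G ξ| - m) ^ 2 :=
        intervalIntegral.integral_nonneg zero_le_one fun z _ => sq_nonneg _
      have e4 : ∫ ξ in (0:ℝ)..1, (|G ξ| - m) ^ 2 = (∫ ξ in (0:ℝ)..1, G ξ ^ 2) - 2 * m * m + m ^ 2 := by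
        have : ∀ ξ, (|G ξ| - m) ^ 2 = G ξ ^ 2 - 2 * m * |G ξ| + m ^ 2 := by
          intro ξ; rw [← sq_abs (G ξ)]; ring
        simp only [this]
        rw [intervalIntegral.integral_add, intervalIntegral.integral_sub,
          intervalIntegral.integral_const_mul]
        · simp only [intervalIntegral.integral_const, sub_zero, one_smul]
          rfl
        all_goals apply Continuous.intervalIntegrable; fun_prop
      nlinarith
    have h0 : 0 ≤ ∫ ξ in (0:ℝ)..1, |G ξ| :=
      intervalIntegral.integral_nonneg zero_le_one fun z _ => abs_nonneg _
    rw [← sq_abs]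
    calc _ ≤ (Real.exp B * ∫ ξ in (0:ℝ)..1, |G ξ|) ^ 2 := by gcongr
      _ = Real.exp B ^ 2 * (∫ ξ in (0:ℝ)..1, |G ξ|) ^ 2 := by ring
      _ ≤ _ := by gcongr
  have h3 : Z x = P y * Z y + ∫ ξ in y..x, P ξ * G ξ := by linarith
  have h4 : (P y * Z y) ^ 2 ≤ Real.exp B ^ 2 * Z y ^ 2 := by
    rw [mul_pow]; exact mul_le_mul_of_nonneg_right (pow_le_pow_left₀ (Real.exp_pos _).le (Pb y hy) 2) (sq_nonneg _)
  have h5 : Real.exp B ^ 2 ≤ Real.exp (4 * B) := by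
    rw [← Real.exp_nat_mul]; apply Real.exp_le_exp.2; push_cast; linarith
  have h6 : 0 ≤ Z y ^ 2 + ∫ ξ in (0:ℝ)..1, G ξ ^ 2 :=
    add_nonneg (sq_nonneg _) (intervalIntegral.integral_nonneg zero_le_one fun z _ => sq_nonneg _)
  have h7 := mul_le_mul_of_nonneg_right h5 h6
  have h8 := sq_nonneg (P y * Z y - ∫ ξ in y..x, P ξ * G ξ)
  rw [h3]
  nlinarith

def usq (u : Fin n → ℝ → ℝ → ℝ) (x t : ℝ) : ℝ := ∑ k, (u k x t) ^ 2

def zz (S : Sys n) (u y : Fin n → ℝ → ℝ → ℝ) (j : Fin n) (x t : ℝ) : ℝ :=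
  y j x t + ∑ k, S.q j k x t * u k x t

def FF (S : Sys n) (u : Fin n → ℝ → ℝ → ℝ) (j : Fin n) (x t : ℝ) : ℝ :=
  -(∑ k, S.βt j k x t * u k x t) + S.αt j x t * (∑ k, S.q j k x t * u k x t)
  + ∑ k, (S.qx j k x t + S.α j x t * S.qt j k x t) * u k x t
  - (∑ k, S.q j k x t * ∑ l, S.β k l x t * u l x t)
  + S.β j j x t * (∑ k, S.q j k x t * u k x t)

lemma usq_nonneg (u : Fin n → ℝ → ℝ → ℝ) (x t : ℝ) : 0 ≤ usq u x t :=
  Finset.sum_nonneg fun _ _ => sq_nonneg _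

lemma lin_bd {c v : Fin n → ℝ} {M : ℝ} (h : ∀ k, |c k| ≤ M) :
    |∑ k, c k * v k| ≤ M * ∑ k, |v k| := by
  refine (Finset.abs_sum_le_sum_abs _ _).trans ?_
  rw [Finset.mul_sum]
  gcongr with k _
  rw [abs_mul]
  gcongr
  exact h k

lemma l1sq (v : Fin n → ℝ) : (∑ k, |v k|) ^ 2 ≤ n * ∑ k, v k ^ 2 := by
  have := sq_sum_le_card_mul_sum_sq (s := Finset.univ) (f := fun k => |v k|)
  simpa using this

lemma lin_sq {c v : Fin n → ℝ} {M : ℝ} (h : ∀ k, |c k| ≤ M) :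
    (∑ k, c k * v k) ^ 2 ≤ M ^ 2 * (n * ∑ k, v k ^ 2) := by
  rw [← sq_abs]
  calc _ ≤ (M * ∑ k, |v k|) ^ 2 := by gcongr; exact lin_bd h
    _ = M ^ 2 * (∑ k, |v k|) ^ 2 := by ring
    _ ≤ _ := by gcongr; exact l1sq v

def Sys.KF (S : Sys n) : ℝ := S.B + S.L * S.B + (S.B + S.δ * S.B) + S.B * (n * S.B) + S.B * S.B

lemma FF_sq (S : Sys n) (u : Fin n → ℝ → ℝ → ℝ) (j : Fin n) (x t : ℝ) :
    (FF S u j x t) ^ 2 ≤ S.KF ^ 2 * (n * usq u x t) := by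
  have B0 := S.B0
  set A := ∑ k, |u k x t| with hA
  have A0 : 0 ≤ A := Finset.sum_nonneg fun _ _ => abs_nonneg _
  have L0 := (S.sl j).L0
  have δ0 := (S.sl j).δ0
  have i1 : |∑ k, S.βt j k x t * u k x t| ≤ S.B * A := lin_bd fun k => S.bβt j k x t
  have i2 : |∑ k, S.q j k x t * u k x t| ≤ S.B * A := lin_bd fun k => (S.bq j k x t).1
  have i3 : |∑ k, (S.qx j k x t + S.α j x t * S.qt j k x t) * u k x t| ≤ (S.B + S.δ * S.B) * A :=
    lin_bd fun k => (abs_add_le _ _).trans (by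
      rw [abs_mul]
      gcongr
      · exact (S.bq j k x t).2.1
      · exact (S.sl j).b x t
      · exact (S.bq j k x t).2.2)
  have i4 : |∑ k, S.q j k x t * ∑ l, S.β k l x t * u l x t| ≤ S.B * (n * (S.B * A)) := by
    refine (lin_bd (fun k => (S.bq j k x t).1)).trans ?_
    gcongr
    calc _ ≤ ∑ k : Fin n, S.B * A := by
          gcongr with k _
          exact lin_bd fun l => S.bβ k l x t
      _ = _ := by simp
  have i5 : |S.αt j x t * (∑ k, S.q j k x t * u k x t)| ≤ S.L * (S.B * A) := by
    rw [abs_mul]; gcongr; exact (S.sl j).bt x t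
  have i6 : |S.β j j x t * (∑ k, S.q j k x t * u k x t)| ≤ S.B * (S.B * A) := by
    rw [abs_mul]; gcongr; exact S.bβ j j x t
  have h : |FF S u j x t| ≤ S.KF * A := by
    unfold FF Sys.KF
    rw [abs_le] at *
    constructor <;> linarith [i1.1, i1.2, i2.1, i2.2, i3.1, i3.2, i4.1, i4.2, i5.1, i5.2, i6.1, i6.2]
  rw [← sq_abs]
  calc _ ≤ (S.KF * A) ^ 2 := by gcongr
    _ = S.KF ^ 2 * A ^ 2 := by ring
    _ ≤ _ := by gcongr; exact l1sq _

section
variable {S : Sys n} {s : ℝ} {u y : Fin n → ℝ → ℝ → ℝ}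

lemma CF.c {ι : Type} {R : ι → ℝ → ℝ → ℝ} (h : CF R) (i : ι) {X : Type*} [TopologicalSpace X] {a b : X → ℝ}
    (ha : Continuous a) (hb : Continuous b) : Continuous fun z => R i (a z) (b z) := c2 (h i) ha hb

lemma usq_c (hu : CF u) {X : Type*} [TopologicalSpace X] {a b : X → ℝ}
    (ha : Continuous a) (hb : Continuous b) : Continuous fun z => usq u (a z) (b z) := by
  unfold usq
  exact continuous_finsetSum _ fun k _ => (hu.c k ha hb).pow 2

lemma zz_c (h : GoodSol S s u y) (j : Fin n) {X : Type*} [TopologicalSpace X] {a b : X → ℝ}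
    (ha : Continuous a) (hb : Continuous b) : Continuous fun z => zz S u y j (a z) (b z) := by
  unfold zz
  exact (h.cy.c j ha hb).add
    (continuous_finsetSum _ fun k _ => (c2 (S.dq j k).c ha hb).mul (h.cu.c k ha hb))

lemma FF_c (hu : CF u) (j : Fin n) {X : Type*} [TopologicalSpace X] {a b : X → ℝ}
    (ha : Continuous a) (hb : Continuous b) : Continuous fun z => FF S u j (a z) (b z) := by
  unfold FF
  have e1 : ∀ k, Continuous fun z => u k (a z) (b z) := fun k => hu.c k ha hb
  have e2 : ∀ j k, Continuous fun z => S.q j k (a z) (b z) := fun j k => c2 (S.dq j k).c ha hb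
  have e3 : ∀ j k, Continuous fun z => S.qx j k (a z) (b z) := fun j k => c2 (S.dq j k).cx ha hb
  have e4 : ∀ j k, Continuous fun z => S.qt j k (a z) (b z) := fun j k => c2 (S.dq j k).ct ha hb
  have e5 : ∀ j k, Continuous fun z => S.β j k (a z) (b z) := fun j k => c2 (S.cβ j k) ha hb
  have e6 : ∀ j k, Continuous fun z => S.βt j k (a z) (b z) := fun j k => c2 (S.cβt j k) ha hb
  have e7 : ∀ j, Continuous fun z => S.α j (a z) (b z) := fun j => c2 (S.sl j).c ha hb
  have e8 : ∀ j, Continuous fun z => S.αt j (a z) (b z) := fun j => c2 (S.sl j).ct ha hb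
  have sq : Continuous fun z => ∑ k, S.q j k (a z) (b z) * u k (a z) (b z) :=
    continuous_finsetSum _ fun k _ => (e2 j k).mul (e1 k)
  refine (((Continuous.neg ?_).add ((e8 j).mul sq)).add ?_ |>.sub ?_).add ((e5 j j).mul sq)
  · exact continuous_finsetSum _ fun k _ => (e6 j k).mul (e1 k)
  · exact continuous_finsetSum _ fun k _ => ((e3 j k).add ((e7 j).mul (e4 j k))).mul (e1 k)
  · exact continuous_finsetSum _ fun k _ => (e2 j k).mul
      (continuous_finsetSum _ fun l _ => (e5 k l).mul (e1 l))

lemma Sys.Om_ge' (S : Sys n) (j : Fin n) {x : ℝ} (hx : x ∈ I01) {t : ℝ} (ht : s + S.δ ≤ t) (ξ : ℝ) :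
    s ≤ S.Om j ξ x t := by
  have := abs_le.1 ((S.sl j).Om_sub_le ξ hx t)
  unfold Sys.Om; linarith [this.1]

/-- derivative of `u_k` along a `j`-characteristic -/
lemma u_ch (h : GoodSol S s u y) (j k : Fin n) {x t : ℝ} (hx : x ∈ I01) (ht : s + S.δ ≤ t)
    {ξ : ℝ} (hξ : ξ ∈ I01) :
    HasDerivWithinAt (fun ξ => u k ξ (S.Om j ξ x t))
      ((S.α j ξ (S.Om j ξ x t) - S.α k ξ (S.Om j ξ x t)) * y k ξ (S.Om j ξ x t) -
        ∑ l, S.β k l ξ (S.Om j ξ x t) * u l ξ (S.Om j ξ x t)) I01 ξ := by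
  refine (chain_sum (h.cy k) (h.dt k) rfl (((S.sl j).Om_curve x t).2 ξ hξ)
    (h.dx k ξ hξ _ (S.Om_ge' j hx ht ξ))).congr_deriv ?_
  unfold Sys.Om
  ring

lemma z_ch (h : GoodSol S s u y) (j : Fin n) {x t : ℝ} (hx : x ∈ I01) (ht : s + S.δ ≤ t)
    {ξ : ℝ} (hξ : ξ ∈ I01) :
    HasDerivWithinAt (fun ξ => S.w j ξ x t * zz S u y j ξ (S.Om j ξ x t))
      (-(S.β j j ξ (S.Om j ξ x t) * (S.w j ξ x t * zz S u y j ξ (S.Om j ξ x t)))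
        + S.w j ξ x t * FF S u j ξ (S.Om j ξ x t)) I01 ξ := by
  have d1 := h.ych j x t hx ht ξ hξ
  have d2 : HasDerivWithinAt (fun ξ => ∑ k, S.q j k ξ (S.Om j ξ x t) * u k ξ (S.Om j ξ x t))
      _ I01 ξ := HasDerivWithinAt.fun_sum (u := Finset.univ) fun k _ =>
    (chain_sum (S.dq j k).ct (S.dq j k).dt rfl (((S.sl j).Om_curve x t).2 ξ hξ)
      ((S.dq j k).dx ξ hξ _)).mul (u_ch h j k hx ht hξ)
  have d3 := ((S.sl j).w_deriv_ξ x t hξ).mul d2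
  refine ((d1.add d3).congr (fun ζ _ => ?_) ?_).congr_deriv ?_
  · simp only [zz, Pi.add_apply, Pi.mul_apply]; unfold Sys.w; ring
  · simp only [zz, Pi.add_apply, Pi.mul_apply]; unfold Sys.w; ring
  · change _ + (S.αt j ξ (S.Om j ξ x t) * S.w j ξ x t * _ + S.w j ξ x t * _) = _
    change _ + (_ + S.w j ξ x t * ∑ k, ((S.qx j k ξ (S.Om j ξ x t) + S.qt j k ξ (S.Om j ξ x t) *
      S.α j ξ (S.Om j ξ x t)) * u k ξ (S.Om j ξ x t) + S.q j k ξ (S.Om j ξ x t) * _)) = _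
    generalize S.Om j ξ x t = τ
    generalize S.w j ξ x t = w
    have key : ∑ k, S.β j k ξ τ * y k ξ τ = S.β j j ξ τ * y j ξ τ +
        ∑ k, S.q j k ξ τ * ((S.α j ξ τ - S.α k ξ τ) * y k ξ τ) := by
      rw [← Finset.add_sum_erase _ _ (Finset.mem_univ j),
        ← Finset.add_sum_erase _ (fun k => S.q j k ξ τ * ((S.α j ξ τ - S.α k ξ τ) * y k ξ τ))
          (Finset.mem_univ j)]
      simp only [sub_self, zero_mul, mul_zero, zero_add]
      congr 1
      apply Finset.sum_congr rfl
      intro k hk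
      rw [← S.hq j k (Finset.ne_of_mem_erase hk)]
      ring
    have e1 : ∑ k, ((S.qx j k ξ τ + S.qt j k ξ τ * S.α j ξ τ) * u k ξ τ + S.q j k ξ τ *
        ((S.α j ξ τ - S.α k ξ τ) * y k ξ τ - ∑ l, S.β k l ξ τ * u l ξ τ)) =
        ∑ k, (S.qx j k ξ τ + S.α j ξ τ * S.qt j k ξ τ) * u k ξ τ +
        ∑ k, S.q j k ξ τ * ((S.α j ξ τ - S.α k ξ τ) * y k ξ τ) -
        ∑ k, S.q j k ξ τ * ∑ l, S.β k l ξ τ * u l ξ τ := by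
      rw [← Finset.sum_add_distrib, ← Finset.sum_sub_distrib]
      apply Finset.sum_congr rfl
      intro k _; ring
    rw [e1, Finset.sum_add_distrib, key]
    unfold zz FF
    ring
end

end Part8

section Part9

variable {n : ℕ}

lemma swapI {f : ℝ → ℝ → ℝ} (hf : Continuous fun q : ℝ × ℝ => f q.1 q.2) {a b c d : ℝ} (hab : a ≤ b)
    (hcd : c ≤ d) :
    ∫ x in a..b, ∫ t in c..d, f x t = ∫ t in c..d, ∫ x in a..b, f x t := by
  simp only [intervalIntegral.integral_of_le hab, intervalIntegral.integral_of_le hcd]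
  apply integral_integral_swap
  rw [Measure.prod_restrict]
  have h1 : IntegrableOn (fun q : ℝ × ℝ => f q.1 q.2) (Icc a b ×ˢ Icc c d) (volume.prod volume) :=
    hf.continuousOn.integrableOn_compact (isCompact_Icc.prod isCompact_Icc)
  exact h1.mono_set (prod_mono Ioc_subset_Icc_self Ioc_subset_Icc_self)

lemma int_sub_le {f : ℝ → ℝ} (cf : Continuous f) (f0 : ∀ t, 0 ≤ f t) {a b c d : ℝ}
    (hac : a ≤ c) (hcb : c ≤ b) (had : a ≤ d) (hdb : d ≤ b) :
    ∫ t in c..d, f t ≤ ∫ t in a..b, f t := by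
  have hab : a ≤ b := hac.trans hcb
  refine (le_abs_self _).trans ?_
  rw [← abs_of_nonneg (intervalIntegral.integral_nonneg hab (fun z _ => f0 z))]
  apply intervalIntegral.abs_integral_mono_interval
  · rw [uIoc_of_le hab]
    intro z hz
    rw [uIoc, mem_Ioc] at hz
    exact ⟨(le_min hac had).trans_lt hz.1, hz.2.trans (max_le hcb hdb)⟩
  · filter_upwards with z; exact f0 _
  · exact cf.intervalIntegrable _ _

lemma cov (S : Sys n) (j : Fin n) (ξ : ℝ) {x : ℝ} (hx : x ∈ I01) {f : ℝ → ℝ} (cf : Continuous f)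
    (f0 : ∀ t, 0 ≤ f t) (T : ℝ) {h : ℝ} (h0 : 0 ≤ h) :
    ∫ t in (T - h)..(T + h), f (S.Om j ξ x t) ≤
      Real.exp S.L * ∫ t in (T - (h + S.δ))..(T + (h + S.δ)), f t := by
  have cO : Continuous fun t => S.Om j ξ x t := S.Om_cont j continuous_const continuous_const continuous_id
  have cw : Continuous fun t => S.w j ξ x t := S.w_cont j continuous_const continuous_const continuous_id
  have δ0 := (S.sl j).δ0
  have e1 : ∫ t in (T - h)..(T + h), f (S.Om j ξ x t) ≤
      ∫ t in (T - h)..(T + h), Real.exp S.L * (f (S.Om j ξ x t) * S.w j ξ x t) := by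
    apply intervalIntegral.integral_mono_on (by linarith)
    · exact (cf.comp cO).intervalIntegrable _ _
    · exact (continuous_const.mul ((cf.comp cO).mul cw)).intervalIntegrable _ _
    · intro t _
      have h1 := (S.sl j).le_w ξ x t
      have h2 : Real.exp S.L * Real.exp (-S.L) = 1 := by rw [← Real.exp_add]; simp
      calc f (S.Om j ξ x t) = f (S.Om j ξ x t) * (Real.exp S.L * Real.exp (-S.L)) := by rw [h2, mul_one]
        _ ≤ f (S.Om j ξ x t) * (Real.exp S.L * S.w j ξ x t) := by
          gcongr
          · exact f0 _
          · exact h1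
        _ = _ := by ring
  refine e1.trans ?_
  rw [intervalIntegral.integral_const_mul]
  gcongr
  have e2 := intervalIntegral.integral_comp_mul_deriv (a := T - h) (b := T + h) (f := fun t => S.Om j ξ x t)
    (f' := fun t => S.w j ξ x t) (g := f) (fun t _ => S.Om_dt j ξ x t) cw.continuousOn cf
  simp only [Function.comp_def] at e2
  rw [e2]
  have a1 := abs_le.1 ((S.sl j).Om_sub_le ξ hx (T - h))
  have a2 := abs_le.1 ((S.sl j).Om_sub_le ξ hx (T + h))
  apply int_sub_le cf f0 <;> simp only [Sys.Om] <;> linarith [a1.1, a1.2, a2.1, a2.2]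

lemma dbl (S : Sys n) (j : Fin n) {x : ℝ} (hx : x ∈ I01) {f : ℝ → ℝ → ℝ}
    (cf : Continuous fun q : ℝ × ℝ => f q.1 q.2) (f0 : ∀ x t, 0 ≤ f x t) (T : ℝ) {h E : ℝ} (h0 : 0 ≤ h)
    (hE : ∀ t ∈ Icc (T - (h + S.δ)) (T + (h + S.δ)), ∫ ξ in (0:ℝ)..1, f ξ t ≤ E) :
    ∫ t in (T - h)..(T + h), ∫ ξ in (0:ℝ)..1, f ξ (S.Om j ξ x t) ≤
      Real.exp S.L * (2 * (h + S.δ) * E) := by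
  have δ0 := (S.sl j).δ0
  have cO : Continuous fun q : ℝ × ℝ => S.Om j q.1 x q.2 :=
    S.Om_cont j continuous_fst continuous_const continuous_snd
  have c1 : Continuous fun q : ℝ × ℝ => f q.1 (S.Om j q.1 x q.2) := c2 cf continuous_fst cO
  rw [← swapI (f := fun ξ t => f ξ (S.Om j ξ x t)) c1 zero_le_one (by linarith)]
  calc _ ≤ ∫ ξ in (0:ℝ)..1, Real.exp S.L * ∫ t in (T - (h + S.δ))..(T + (h + S.δ)), f ξ t := by
        apply intervalIntegral.integral_mono_on zero_le_one
        · apply Continuous.intervalIntegrable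
          exact intervalIntegral.continuous_parametric_intervalIntegral_of_continuous'
            (f := fun ξ t => f ξ (S.Om j ξ x t)) c1 _ _
        · apply Continuous.intervalIntegrable
          exact continuous_const.mul
            (intervalIntegral.continuous_parametric_intervalIntegral_of_continuous' (f := f) cf _ _)
        · intro ξ _
          exact cov S j ξ hx (c2 cf continuous_const continuous_id) (f0 ξ) T h0
    _ = Real.exp S.L * ∫ t in (T - (h + S.δ))..(T + (h + S.δ)), ∫ ξ in (0:ℝ)..1, f ξ t := by
        rw [intervalIntegral.integral_const_mul, swapI cf zero_le_one (by linarith)]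
    _ ≤ _ := by
        gcongr
        have : ∫ t in (T - (h + S.δ))..(T + (h + S.δ)), E = 2 * (h + S.δ) * E := by
          rw [intervalIntegral.integral_const, smul_eq_mul]; ring
        rw [← this]
        apply intervalIntegral.integral_mono_on (by linarith)
        · apply Continuous.intervalIntegrable
          exact intervalIntegral.continuous_parametric_intervalIntegral_of_continuous'
            (f := fun t ξ => f ξ t) (c2 cf continuous_snd continuous_fst) _ _
        · exact continuous_const.intervalIntegrable _ _
        · exact hE

section
variable {S : Sys n} {s : ℝ} {u y : Fin n → ℝ → ℝ → ℝ}

def Sys.C1 (S : Sys n) : ℝ := 2 + 2 * (S.B ^ 2 * n)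

lemma pt1 (h : GoodSol S s u y) (j : Fin n) {x t : ℝ} (hx : x ∈ I01) (ht : s + S.δ ≤ t) :
    (u j x t) ^ 2 ≤ S.C1 * ∫ ξ in (0:ℝ)..1, usq u ξ (S.Om j ξ x t) := by
  have cO := S.Om_c1 j x t
  set G : ℝ → ℝ := fun ξ => -∑ l, S.β j l ξ (S.Om j ξ x t) * u l ξ (S.Om j ξ x t) with hG
  have cG : Continuous G := (continuous_finsetSum _ fun l _ =>
    (c2 (S.cβ j l) continuous_id cO).mul (h.cu.c l continuous_id cO)).neg
  have cU : Continuous fun ξ => usq u ξ (S.Om j ξ x t) := usq_c h.cu continuous_id cO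
  have cu : Continuous fun ξ => u j ξ (S.Om j ξ x t) := h.cu.c j continuous_id cO
  set I := ∫ ξ in (0:ℝ)..1, usq u ξ (S.Om j ξ x t) with hI
  have hGI : ∫ ξ in (0:ℝ)..1, G ξ ^ 2 ≤ S.B ^ 2 * n * I := by
    rw [hI, ← intervalIntegral.integral_const_mul]
    apply intervalIntegral.integral_mono_on zero_le_one
    · exact (cG.pow 2).intervalIntegrable _ _
    · exact (continuous_const.mul cU).intervalIntegrable _ _
    · intro ξ _
      simp only [hG, neg_sq]
      rw [mul_assoc]
      exact lin_sq fun k => S.bβ j k _ _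
  have key : ∀ z ∈ I01, (u j x t) ^ 2 ≤ 2 * (u j z (S.Om j z x t)) ^ 2 + 2 * (S.B ^ 2 * n * I) := by
    intro z hz
    have := duh (Z := fun ξ => u j ξ (S.Om j ξ x t)) (b := fun _ => 0) (B := 0) continuous_const cG (by
      intro ξ hξ
      refine (u_ch h j j hx ht hξ).congr_deriv ?_
      simp only [hG]; ring) (by simp) hx hz
    simp only [mul_zero, Real.exp_zero, mul_one] at this
    have e : S.Om j x x t = t := (S.sl j).Om_self hx t
    rw [e] at this
    linarith
  have h1 : ∫ z in (0:ℝ)..1, (u j x t) ^ 2 ≤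
      ∫ z in (0:ℝ)..1, (2 * (u j z (S.Om j z x t)) ^ 2 + 2 * (S.B ^ 2 * n * I)) := by
    apply intervalIntegral.integral_mono_on zero_le_one
    · exact continuous_const.intervalIntegrable _ _
    · exact ((continuous_const.mul (cu.pow 2)).add continuous_const).intervalIntegrable _ _
    · exact key
  have ci : IntervalIntegrable (fun z => 2 * (u j z (S.Om j z x t)) ^ 2) volume 0 1 :=
    (continuous_const.mul (cu.pow 2)).intervalIntegrable _ _
  rw [intervalIntegral.integral_add ci
    (continuous_const.intervalIntegrable _ _), intervalIntegral.integral_const_mul] at h1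
  simp only [intervalIntegral.integral_const, sub_zero, one_smul] at h1
  have h2 : ∫ z in (0:ℝ)..1, (u j z (S.Om j z x t)) ^ 2 ≤ I := by
    apply intervalIntegral.integral_mono_on zero_le_one
    · exact (cu.pow 2).intervalIntegrable _ _
    · exact cU.intervalIntegrable _ _
    · intro ξ _
      exact Finset.single_le_sum (f := fun k => (u k ξ (S.Om j ξ x t)) ^ 2)
        (fun _ _ => sq_nonneg _) (Finset.mem_univ j)
  unfold Sys.C1
  nlinarith

def Sys.C2 (S : Sys n) : ℝ := 2 * Real.exp (4 * S.B) * (Real.exp S.L ^ 2 * (1 + S.KF ^ 2 * n))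

lemma Sys.C2_0 (S : Sys n) : 0 ≤ S.C2 := by unfold Sys.C2; positivity

lemma pt2 (h : GoodSol S s u y) (j : Fin n) {x t : ℝ} (hx : x ∈ I01) (ht : s + S.δ ≤ t) :
    (zz S u y j x t) ^ 2 ≤ S.C2 * ((zz S u y j (S.e j) (S.Om j (S.e j) x t)) ^ 2 +
      ∫ ξ in (0:ℝ)..1, usq u ξ (S.Om j ξ x t)) := by
  have cO := S.Om_c1 j x t
  have cw := S.w_c1 j x t
  have cU : Continuous fun ξ => usq u ξ (S.Om j ξ x t) := usq_c h.cu continuous_id cO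
  set G : ℝ → ℝ := fun ξ => S.w j ξ x t * FF S u j ξ (S.Om j ξ x t) with hG
  have cG : Continuous G := cw.mul (FF_c h.cu j continuous_id cO)
  set I := ∫ ξ in (0:ℝ)..1, usq u ξ (S.Om j ξ x t) with hI
  have hw2 : ∀ ξ, S.w j ξ x t ^ 2 ≤ Real.exp S.L ^ 2 := fun ξ => by
    rw [← sq_abs]; exact pow_le_pow_left₀ (abs_nonneg _) (S.w_abs j ξ x t) 2
  have hGI : ∫ ξ in (0:ℝ)..1, G ξ ^ 2 ≤ Real.exp S.L ^ 2 * (S.KF ^ 2 * n) * I := by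
    rw [hI, ← intervalIntegral.integral_const_mul]
    apply intervalIntegral.integral_mono_on zero_le_one
    · exact (cG.pow 2).intervalIntegrable _ _
    · exact (continuous_const.mul cU).intervalIntegrable _ _
    · intro ξ _
      simp only [hG, mul_pow]
      rw [mul_assoc, mul_assoc]
      exact mul_le_mul (hw2 ξ) (FF_sq S u j _ _) (sq_nonneg _) (sq_nonneg _)
  have := duh (Z := fun ξ => S.w j ξ x t * zz S u y j ξ (S.Om j ξ x t))
    (b := fun ξ => S.β j j ξ (S.Om j ξ x t)) (B := S.B) (c2 (S.cβ j j) continuous_id cO) cG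
    (fun ξ hξ => z_ch h j hx ht hξ) (fun ξ => S.bβ j j _ _) hx (S.e_mem j)
  have e : S.Om j x x t = t := (S.sl j).Om_self hx t
  have e' : S.w j x x t = 1 := (S.sl j).w_self x t
  simp only [e, e', one_mul] at this
  refine this.trans ?_
  unfold Sys.C2
  rw [mul_assoc (2 * Real.exp (4 * S.B))]
  refine mul_le_mul_of_nonneg_left ?_ (by positivity)
  have I0 : 0 ≤ I := intervalIntegral.integral_nonneg zero_le_one fun _ _ => usq_nonneg _ _ _
  have h3 := mul_le_mul_of_nonneg_right (hw2 (S.e j)) (sq_nonneg (zz S u y j (S.e j) (S.Om j (S.e j) x t)))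
  rw [mul_pow]
  have h4 : 0 ≤ Real.exp S.L ^ 2 * (S.KF ^ 2 * n) * (zz S u y j (S.e j) (S.Om j (S.e j) x t)) ^ 2 := by
    positivity
  have h5 : 0 ≤ Real.exp S.L ^ 2 * I := by positivity
  linarith

def Sys.Pm (S : Sys n) : ℝ := ∑ j, ∑ k, S.p j k ^ 2
def Sys.C3 (S : Sys n) : ℝ := 3 * (n + n * (S.Pm * (S.B ^ 2 * n)) + S.B ^ 2 * n)
lemma Sys.Pm_0 (S : Sys n) : 0 ≤ S.Pm :=
  Finset.sum_nonneg fun _ _ => Finset.sum_nonneg fun _ _ => sq_nonneg _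
lemma Sys.C3_0 (S : Sys n) : 0 ≤ S.C3 := by
  have := S.Pm_0
  unfold Sys.C3; positivity

lemma sum_sq_le (v : Fin n → ℝ) : (∑ k, v k) ^ 2 ≤ n * ∑ k, v k ^ 2 := by
  have := sq_sum_le_card_mul_sum_sq (s := Finset.univ) (f := v)
  simpa using this

lemma bd2 (h : GoodSol S s u y) (j : Fin n) (τ : ℝ) :
    (zz S u y j (S.e j) τ) ^ 2 ≤ S.C3 * (∑ k, S.p j k ^ 2 * (zz S u y k (S.o k) τ) ^ 2 +
      (usq u 0 τ + usq u 1 τ)) := by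
  have hP := S.Pm_0
  set V := usq u 0 τ + usq u 1 τ with hV
  have u0 := usq_nonneg u 0 τ
  have u1 := usq_nonneg u 1 τ
  have V0 : 0 ≤ V := add_nonneg u0 u1
  set v : Fin n → ℝ := fun k => ∑ l, S.q k l (S.o k) τ * u l (S.o k) τ with hv
  have ho : ∀ k, usq u (S.o k) τ ≤ V := fun k => by
    rcases S.hin k with g | g <;> rw [g.2.1, hV] <;> linarith
  have he : ∀ k, usq u (S.e k) τ ≤ V := fun k => by
    rcases S.hin k with g | g <;> rw [g.1, hV] <;> linarith
  have e0 : zz S u y j (S.e j) τ = (∑ k, S.p j k * zz S u y k (S.o k) τ) - (∑ k, S.p j k * v k) +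
      ∑ k, S.q j k (S.e j) τ * u k (S.e j) τ := by
    conv_lhs => unfold zz
    rw [h.bcy, ← Finset.sum_sub_distrib]
    congr 1
    apply Finset.sum_congr rfl
    intro k _
    simp only [hv, zz]; ring
  have a1 : (∑ k, S.p j k * zz S u y k (S.o k) τ) ^ 2 ≤
      n * ∑ k, S.p j k ^ 2 * (zz S u y k (S.o k) τ) ^ 2 := by
    refine (sum_sq_le _).trans (le_of_eq ?_)
    simp only [mul_pow]
  have hvk : ∀ k, v k ^ 2 ≤ S.B ^ 2 * n * V := fun k => by
    refine (lin_sq (fun l => (S.bq k l _ _).1)).trans ?_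
    rw [mul_assoc]
    gcongr
    exact ho k
  have a2 : (∑ k, S.p j k * v k) ^ 2 ≤ n * (S.Pm * (S.B ^ 2 * n * V)) := by
    refine (sum_sq_le _).trans ?_
    gcongr
    simp only [mul_pow]
    calc _ ≤ ∑ k, S.p j k ^ 2 * (S.B ^ 2 * n * V) := by gcongr with k _; exact hvk k
      _ = (∑ k, S.p j k ^ 2) * (S.B ^ 2 * n * V) := by rw [Finset.sum_mul]
      _ ≤ _ := by
        gcongr
        exact Finset.single_le_sum (f := fun j => ∑ k, S.p j k ^ 2)
          (fun _ _ => Finset.sum_nonneg fun _ _ => sq_nonneg _) (Finset.mem_univ j)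
  have a3 : (∑ k, S.q j k (S.e j) τ * u k (S.e j) τ) ^ 2 ≤ S.B ^ 2 * n * V := by
    refine (lin_sq (fun l => (S.bq j l _ _).1)).trans ?_
    rw [mul_assoc]
    gcongr
    exact he j
  rw [e0]
  set A := ∑ k, S.p j k * zz S u y k (S.o k) τ
  set A' := ∑ k, S.p j k * v k
  set A'' := ∑ k, S.q j k (S.e j) τ * u k (S.e j) τ
  set Q := ∑ k, S.p j k ^ 2 * (zz S u y k (S.o k) τ) ^ 2 with hQ
  have Q0 : 0 ≤ Q := Finset.sum_nonneg fun _ _ => by positivity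
  have f1 : (A - A' + A'') ^ 2 ≤ 3 * (A ^ 2 + A' ^ 2 + A'' ^ 2) := by
    nlinarith [sq_nonneg (A + A'), sq_nonneg (A - A''), sq_nonneg (A' + A'')]
  have g1 : 0 ≤ n * (S.Pm * (S.B ^ 2 * n)) * Q := by positivity
  have g2 : 0 ≤ S.B ^ 2 * n * Q := by positivity
  have g3 : 0 ≤ n * V := by positivity
  unfold Sys.C3
  linarith
end

end Part9

section Part10

variable {n : ℕ}

structure Win (S : Sys n) (s : ℝ) (u : Fin n → ℝ → ℝ → ℝ) (T H E : ℝ) : Prop where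
  E0 : 0 ≤ E
  H0 : 0 ≤ H
  hT : s + H ≤ T
  hE : ∀ t ∈ Icc (T - H) (T + H), ∫ x in (0:ℝ)..1, usq u x t ≤ E

def Sys.CT (S : Sys n) (H : ℝ) : ℝ := n * (S.C1 * (Real.exp S.L * (2 * H)))

lemma Sys.C1_0 (S : Sys n) : 0 ≤ S.C1 := by unfold Sys.C1; positivity
lemma Sys.CT_0 (S : Sys n) {H : ℝ} (h : 0 ≤ H) : 0 ≤ S.CT H := by
  have := S.C1_0
  unfold Sys.CT; positivity

section
variable {S : Sys n} {s : ℝ} {u y : Fin n → ℝ → ℝ → ℝ} {T H E : ℝ}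

lemma dblE (g : GoodSol S s u y) (W : Win S s u T H E) (j : Fin n) {x : ℝ} (hx : x ∈ I01) {h : ℝ}
    (h0 : 0 ≤ h) (hH : h + S.δ ≤ H) :
    ∫ t in (T - h)..(T + h), ∫ ξ in (0:ℝ)..1, usq u ξ (S.Om j ξ x t) ≤ Real.exp S.L * (2 * H) * E := by
  have δ0 := (S.sl j).δ0
  have := dbl S j hx (f := usq u) (usq_c g.cu continuous_fst continuous_snd) (usq_nonneg u) T h0
    (E := E) (fun t ht => W.hE t ⟨by linarith [ht.1], by linarith [ht.2]⟩)
  refine this.trans ?_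
  have := W.E0
  calc _ ≤ Real.exp S.L * (2 * H * E) := by gcongr
    _ = _ := by ring

lemma int_usq_c (hu : CF u) (j : Fin n) (x : ℝ) :
    Continuous fun t => ∫ ξ in (0:ℝ)..1, usq u ξ (S.Om j ξ x t) :=
  intervalIntegral.continuous_parametric_intervalIntegral_of_continuous'
    (f := fun t ξ => usq u ξ (S.Om j ξ x t))
    (usq_c hu continuous_snd (S.Om_cont j continuous_snd continuous_const continuous_fst)) _ _

lemma tr (g : GoodSol S s u y) (W : Win S s u T H E) {x : ℝ} (hx : x ∈ I01) {h : ℝ}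
    (h0 : 0 ≤ h) (hH : h + S.δ ≤ H) :
    ∫ t in (T - h)..(T + h), usq u x t ≤ S.CT H * E := by
  have c1 : ∀ j, Continuous fun t => (u j x t) ^ 2 := fun j =>
    (g.cu.c j continuous_const continuous_id).pow 2
  have e1 : ∀ j, ∫ t in (T - h)..(T + h), (u j x t) ^ 2 ≤ S.C1 * (Real.exp S.L * (2 * H) * E) := by
    intro j
    calc _ ≤ ∫ t in (T - h)..(T + h), S.C1 * ∫ ξ in (0:ℝ)..1, usq u ξ (S.Om j ξ x t) := by
          apply intervalIntegral.integral_mono_on (by linarith)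
          · exact (c1 j).intervalIntegrable _ _
          · exact (continuous_const.mul (int_usq_c g.cu j x)).intervalIntegrable _ _
          · intro t ht
            exact pt1 g j hx (by linarith [W.hT, ht.1])
      _ = S.C1 * ∫ t in (T - h)..(T + h), ∫ ξ in (0:ℝ)..1, usq u ξ (S.Om j ξ x t) := by
          rw [intervalIntegral.integral_const_mul]
      _ ≤ _ := mul_le_mul_of_nonneg_left (dblE g W j hx h0 hH) S.C1_0
  unfold usq
  rw [intervalIntegral.integral_finsetSum (fun j _ => (c1 j).intervalIntegrable _ _)]
  calc _ ≤ ∑ j : Fin n, S.C1 * (Real.exp S.L * (2 * H) * E) := Finset.sum_le_sum fun j _ => e1 j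
    _ = _ := by simp [Sys.CT]; ring

lemma psum_le (S : Sys n) (j : Fin n) {v : Fin n → ℝ} {M : ℝ} (M0 : 0 ≤ M) (hv : ∀ k, S.p j k ≠ 0 → v k ≤ M) :
    ∑ k, S.p j k ^ 2 * v k ≤ S.Pm * M := by
  calc _ ≤ ∑ k, S.p j k ^ 2 * M := by
        apply Finset.sum_le_sum
        intro k _
        by_cases hp : S.p j k = 0
        · simp [hp]
        · gcongr; exact hv k hp
    _ = (∑ k, S.p j k ^ 2) * M := by rw [Finset.sum_mul]
    _ ≤ _ := by
      gcongr
      exact Finset.single_le_sum (f := fun j => ∑ k, S.p j k ^ 2)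
          (fun _ _ => Finset.sum_nonneg fun _ _ => sq_nonneg _) (Finset.mem_univ j)
end

theorem zL2 (S : Sys n) {H : ℝ} (hH0 : 0 ≤ H) (r : ℕ) : ∃ C, 0 ≤ C ∧ ∀ s u y T E, GoodSol S s u y → Win S s u T H E →
    ∀ h, 0 ≤ h → h + (r + 1) * S.δ ≤ H → ∀ j, S.ρ j < r → ∀ x ∈ I01,
      ∫ t in (T - h)..(T + h), (zz S u y j x t) ^ 2 ≤ C * E := by
  induction r with
  | zero => exact ⟨0, le_rfl, fun s u y T E _ _ h _ _ j hj => absurd hj (by simp)⟩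
  | succ r ih =>
    obtain ⟨C, C0, hC⟩ := ih
    have q2 := S.C2_0
    have q3 := S.C3_0
    have qp := S.Pm_0
    have qt := S.CT_0 hH0
    refine ⟨S.C2 * (Real.exp S.L * (S.C3 * (S.Pm * C + 2 * S.CT H)) + Real.exp S.L * (2 * H)),
      by positivity, ?_⟩
    intro s u y T E g W h h0 hh j hj x hx
    have δ0 := (S.sl j).δ0
    have E0 := W.E0
    push_cast at hh
    have hrδ : 0 ≤ (r:ℝ) * S.δ := by positivity
    have cz : ∀ k z, Continuous fun t => (zz S u y k z t) ^ 2 := fun k z =>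
      (zz_c g k continuous_const continuous_id).pow 2
    have cu : ∀ z, Continuous fun t => usq u z t := fun z => usq_c g.cu continuous_const continuous_id
    have cO : Continuous fun t => S.Om j (S.e j) x t :=
      S.Om_cont j continuous_const continuous_const continuous_id
    have c1 : Continuous fun t => (zz S u y j (S.e j) (S.Om j (S.e j) x t)) ^ 2 := (cz j _).comp cO
    have c2 := int_usq_c (S := S) g.cu j x
    have e1 : ∫ t in (T - h)..(T + h), (zz S u y j x t) ^ 2 ≤ S.C2 * ((∫ t in (T - h)..(T + h),
        (zz S u y j (S.e j) (S.Om j (S.e j) x t)) ^ 2) +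
        ∫ t in (T - h)..(T + h), ∫ ξ in (0:ℝ)..1, usq u ξ (S.Om j ξ x t)) := by
      rw [← intervalIntegral.integral_add (c1.intervalIntegrable _ _) (c2.intervalIntegrable _ _),
        ← intervalIntegral.integral_const_mul]
      apply intervalIntegral.integral_mono_on (by linarith)
      · exact (cz _ _).intervalIntegrable _ _
      · exact (continuous_const.mul (c1.add c2)).intervalIntegrable _ _
      · intro t ht
        exact pt2 g j hx (by linarith [W.hT, ht.1])
    refine e1.trans ?_
    rw [mul_assoc, add_mul]
    refine mul_le_mul_of_nonneg_left (add_le_add ?_ (dblE g W j hx h0 (by linarith))) q2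
    have e2 := cov S j (S.e j) hx (cz j (S.e j)) (fun t => sq_nonneg _) T h0
    refine e2.trans ?_
    rw [mul_assoc]
    refine mul_le_mul_of_nonneg_left ?_ (Real.exp_pos _).le
    set h' := h + S.δ with hh'
    have e3 : ∫ t in (T - h')..(T + h'), (zz S u y j (S.e j) t) ^ 2 ≤ S.C3 *
        ((∑ k, S.p j k ^ 2 * ∫ t in (T - h')..(T + h'), (zz S u y k (S.o k) t) ^ 2) +
        ((∫ t in (T - h')..(T + h'), usq u 0 t) + ∫ t in (T - h')..(T + h'), usq u 1 t)) := by
      have cs : Continuous fun t => ∑ k, S.p j k ^ 2 * (zz S u y k (S.o k) t) ^ 2 :=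
        continuous_finsetSum _ fun k _ => continuous_const.mul (cz _ _)
      simp only [← intervalIntegral.integral_const_mul]
      have ik : ∀ k ∈ Finset.univ, IntervalIntegrable (fun t => S.p j k ^ 2 * (zz S u y k (S.o k) t) ^ 2)
          volume (T - h') (T + h') :=
        fun k _ => (continuous_const.mul (cz k (S.o k))).intervalIntegrable _ _
      have iu : IntervalIntegrable (fun t => usq u 0 t + usq u 1 t) volume (T - h') (T + h') :=
        ((cu 0).add (cu 1)).intervalIntegrable _ _
      rw [← intervalIntegral.integral_finsetSum ik,
        ← intervalIntegral.integral_add ((cu 0).intervalIntegrable _ _) ((cu 1).intervalIntegrable _ _),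
        ← intervalIntegral.integral_add (cs.intervalIntegrable _ _) iu,
        ← intervalIntegral.integral_const_mul]
      apply intervalIntegral.integral_mono_on (by linarith)
      · exact (cz _ _).intervalIntegrable _ _
      · exact (continuous_const.mul (cs.add ((cu 0).add (cu 1)))).intervalIntegrable _ _
      · intro t ht
        exact bd2 g j t
    refine e3.trans ?_
    rw [mul_assoc]
    refine mul_le_mul_of_nonneg_left ?_ q3
    have e4 := psum_le S j (v := fun k => ∫ t in (T - h')..(T + h'), (zz S u y k (S.o k) t) ^ 2)
      (M := C * E) (by positivity) (fun k hk => hC s u y T E g W h' (by linarith) (by linarith) k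
        (by have := S.hρ j k hk; omega) _ (S.o_mem k))
    have e5 := tr g W (x := 0) (by simp [I01]) (h := h') (by linarith) (by linarith)
    have e6 := tr g W (x := 1) (by simp [I01]) (h := h') (by linarith) (by linarith)
    linarith

lemma sob {f g : ℝ → ℝ} (cg : Continuous g) (hd : ∀ t, HasDerivAt f (g t) t) {T h : ℝ} (h0 : 0 < h)
    {t : ℝ} (ht : |t - T| ≤ h) :
    f t ^ 2 ≤ (1 / h) * (∫ t in (T - h)..(T + h), f t ^ 2) + 4 * h * ∫ t in (T - h)..(T + h), g t ^ 2 := by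
  have cf : Continuous f := continuous_iff_continuousAt.2 fun z => (hd z).continuousAt
  have hh : 2 * h ≠ 0 := by positivity
  set c : ℝ → ℝ := fun ξ => 2 * h * ξ + (T - h) with hc
  have cc : Continuous c := by fun_prop
  have dc : ∀ ξ, HasDerivAt c (2 * h) ξ := fun ξ => by
    have := ((hasDerivAt_id ξ).const_mul (2 * h)).add_const (T - h)
    rw [mul_one] at this
    exact this
  have ci : ∀ F : ℝ → ℝ, ∫ ξ in (0:ℝ)..1, F (c ξ) = (2 * h)⁻¹ * ∫ t in (T - h)..(T + h), F t := by
    intro F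
    rw [hc, intervalIntegral.integral_comp_mul_add _ hh]
    simp only [mul_zero, zero_add, mul_one, smul_eq_mul]
    congr 2; ring
  have at_ := abs_le.1 ht
  have hx : (t - (T - h)) / (2 * h) ∈ I01 :=
    ⟨div_nonneg (by linarith [at_.1]) (by positivity), (div_le_one (by positivity)).2 (by linarith [at_.2])⟩
  have hcx : c ((t - (T - h)) / (2 * h)) = t := by simp only [hc]; field_simp; ring
  have cG : Continuous fun ξ => 2 * h * g (c ξ) := continuous_const.mul (cg.comp cc)
  have key : ∀ z ∈ Icc (0:ℝ) 1, f t ^ 2 ≤ 2 * f (c z) ^ 2 + 4 * h * ∫ t in (T - h)..(T + h), g t ^ 2 := by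
    intro z hz
    have := duh (Z := fun ξ => f (c ξ)) (b := fun _ => 0) (B := 0) continuous_const cG (by
      intro ξ hξ
      refine ((hd (c ξ)).comp ξ (dc ξ)).hasDerivWithinAt.congr_deriv ?_
      ring) (by simp) hx hz
    rw [hcx] at this
    simp only [mul_zero, Real.exp_zero, mul_one, mul_pow] at this
    rw [intervalIntegral.integral_const_mul, ci (fun t => g t ^ 2)] at this
    refine this.trans (le_of_eq ?_)
    field_simp
    ring
  have cfc : Continuous fun z => 2 * f (c z) ^ 2 := continuous_const.mul ((cf.comp cc).pow 2)
  have h1 : ∫ _z in (0:ℝ)..1, f t ^ 2 ≤ ∫ z in (0:ℝ)..1, (2 * f (c z) ^ 2 +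
      4 * h * ∫ t in (T - h)..(T + h), g t ^ 2) :=
    intervalIntegral.integral_mono_on (μ := volume) zero_le_one
    (continuous_const.intervalIntegrable _ _)
    ((cfc.add continuous_const).intervalIntegrable _ _) key
  rw [intervalIntegral.integral_add (cfc.intervalIntegrable _ _)
    (continuous_const.intervalIntegrable _ _), intervalIntegral.integral_const_mul,
    ci (fun t => f t ^ 2)] at h1
  simp only [intervalIntegral.integral_const, sub_zero, one_smul] at h1
  refine h1.trans (le_of_eq ?_)
  field_simp

lemma y_sq (S : Sys n) (u y : Fin n → ℝ → ℝ → ℝ) (j : Fin n) (x t : ℝ) :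
    y j x t ^ 2 ≤ 2 * (zz S u y j x t) ^ 2 + 2 * (S.B ^ 2 * n) * usq u x t := by
  have h1 : (∑ k, S.q j k x t * u k x t) ^ 2 ≤ S.B ^ 2 * (n * usq u x t) :=
    lin_sq fun k => (S.bq j k x t).1
  have e : y j x t = zz S u y j x t - ∑ k, S.q j k x t * u k x t := by unfold zz; ring
  rw [e]
  nlinarith [sq_nonneg (zz S u y j x t + ∑ k, S.q j k x t * u k x t)]

theorem usup (S : Sys n) {H h : ℝ} (hh : 0 < h) (δ0 : 0 ≤ S.δ) (hH : h + (n + 1) * S.δ ≤ H) :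
    ∃ C, 0 ≤ C ∧ ∀ s u y T E, GoodSol S s u y → Win S s u T H E →
    ∀ t, |t - T| ≤ h → ∀ x ∈ I01, usq u x t ≤ C * E := by
  have hn0 : 0 ≤ (n:ℝ) * S.δ := by positivity
  have hH0 : 0 ≤ H := by linarith
  obtain ⟨C, C0, hC⟩ := zL2 S hH0 n
  have qt := S.CT_0 hH0
  refine ⟨n * ((1 / h) * S.CT H + 4 * h * (2 * C + 2 * (S.B ^ 2 * n) * S.CT H)), by positivity, ?_⟩
  intro s u y T E g W t ht x hx
  have E0 := W.E0
  have cu : Continuous fun t => usq u x t := usq_c g.cu continuous_const continuous_id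
  have hj : ∀ j, u j x t ^ 2 ≤ ((1 / h) * S.CT H + 4 * h * (2 * C + 2 * (S.B ^ 2 * n) * S.CT H)) * E := by
    intro j
    have e1 := sob (g.cy.c j continuous_const continuous_id) (g.dt j x) hh ht
    have e2 := tr g W hx hh.le (by linarith)
    have e3 := hC s u y T E g W h hh.le hH j (S.hρn j) x hx
    have cz : Continuous fun t => (zz S u y j x t) ^ 2 := (zz_c g j continuous_const continuous_id).pow 2
    have e4 : ∫ t in (T - h)..(T + h), u j x t ^ 2 ≤ ∫ t in (T - h)..(T + h), usq u x t := by
      apply intervalIntegral.integral_mono_on (by linarith)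
      · exact ((g.cu.c j continuous_const continuous_id).pow 2).intervalIntegrable _ _
      · exact cu.intervalIntegrable _ _
      · intro τ _
        exact Finset.single_le_sum (f := fun k => (u k x τ) ^ 2)
          (fun _ _ => sq_nonneg _) (Finset.mem_univ j)
    have e5 : ∫ t in (T - h)..(T + h), y j x t ^ 2 ≤ 2 * (∫ t in (T - h)..(T + h), (zz S u y j x t) ^ 2) +
        2 * (S.B ^ 2 * n) * ∫ t in (T - h)..(T + h), usq u x t := by
      have i1 : IntervalIntegrable (fun t => 2 * (zz S u y j x t) ^ 2) volume (T - h) (T + h) :=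
        (continuous_const.mul cz).intervalIntegrable _ _
      have i2 : IntervalIntegrable (fun t => 2 * (S.B ^ 2 * n) * usq u x t) volume (T - h) (T + h) :=
        (continuous_const.mul cu).intervalIntegrable _ _
      rw [← intervalIntegral.integral_const_mul, ← intervalIntegral.integral_const_mul,
        ← intervalIntegral.integral_add i1 i2]
      apply intervalIntegral.integral_mono_on (by linarith)
      · exact ((g.cy.c j continuous_const continuous_id).pow 2).intervalIntegrable _ _
      · exact ((continuous_const.mul cz).add (continuous_const.mul cu)).intervalIntegrable _ _
      · intro τ _; exact y_sq S u y j x τ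
    have e6 : ∫ t in (T - h)..(T + h), y j x t ^ 2 ≤ 2 * (C * E) + 2 * (S.B ^ 2 * n) * (S.CT H * E) := by
      refine e5.trans ?_
      gcongr
    refine e1.trans ?_
    calc _ ≤ (1 / h) * (S.CT H * E) + 4 * h * (2 * (C * E) + 2 * (S.B ^ 2 * n) * (S.CT H * E)) := by
          gcongr
          · exact e4.trans e2
          · exact e6
      _ = _ := by ring
  calc usq u x t ≤ ∑ j : Fin n, _ := Finset.sum_le_sum fun j _ => hj j
    _ = _ := by simp; ring

theorem zsup (S : Sys n) {H h3 : ℝ} (hh : 0 < h3) (δ0 : 0 ≤ S.δ) (hH : h3 + (n + 1) * S.δ ≤ H) (r : ℕ) :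
    ∃ C, 0 ≤ C ∧ ∀ s u y T E, GoodSol S s u y → Win S s u T H E →
    ∀ h, 0 ≤ h → h + r * S.δ ≤ h3 → ∀ j, S.ρ j < r → ∀ x ∈ I01, ∀ t, |t - T| ≤ h →
      (zz S u y j x t) ^ 2 ≤ C * E := by
  obtain ⟨Cu, Cu0, hCu⟩ := usup S hh δ0 hH
  induction r with
  | zero => exact ⟨0, le_rfl, fun s u y T E _ _ h _ _ j hj => absurd hj (by simp)⟩
  | succ r ih =>
    obtain ⟨C, C0, hC⟩ := ih
    have q2 := S.C2_0
    have q3 := S.C3_0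
    have qp := S.Pm_0
    refine ⟨S.C2 * (S.C3 * (S.Pm * C + 2 * Cu) + Cu), by positivity, ?_⟩
    intro s u y T E g W h h0 hh' j hj x hx t ht
    push_cast at hh'
    have E0 := W.E0
    have hrδ : 0 ≤ (r:ℝ) * S.δ := by positivity
    have hnδ : 0 ≤ (n:ℝ) * S.δ := by positivity
    have ha := abs_le.1 ht
    have hO : ∀ ξ, |S.Om j ξ x t - T| ≤ h + S.δ := fun ξ => by
      have := abs_le.1 ((S.sl j).Om_sub_le ξ hx t)
      rw [abs_le]; unfold Sys.Om; constructor <;> linarith [this.1, this.2, ha.1, ha.2]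
    have e1 := pt2 g j hx (t := t) (by linarith [W.hT, ha.1])
    refine e1.trans ?_
    rw [mul_assoc, add_mul]
    refine mul_le_mul_of_nonneg_left (add_le_add ?_ ?_) q2
    · refine (bd2 g j _).trans ?_
      rw [mul_assoc]
      refine mul_le_mul_of_nonneg_left ?_ q3
      have e4 := psum_le S j (v := fun k => (zz S u y k (S.o k) (S.Om j (S.e j) x t)) ^ 2)
        (M := C * E) (by positivity) (fun k hk => hC s u y T E g W (h + S.δ) (by linarith) (by linarith) k
        (by have := S.hρ j k hk; omega) _ (S.o_mem k) _ (hO _))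
      have e5 := hCu s u y T E g W (S.Om j (S.e j) x t) ((hO _).trans (by linarith)) 0 (by simp [I01])
      have e6 := hCu s u y T E g W (S.Om j (S.e j) x t) ((hO _).trans (by linarith)) 1 (by simp [I01])
      linarith
    · have := intervalIntegral.integral_mono_on (μ := volume) (a := 0) (b := 1) zero_le_one
        ((usq_c g.cu continuous_id (S.Om_c1 j x t)).intervalIntegrable _ _)
        ((continuous_const (y := Cu * E)).intervalIntegrable _ _) (fun ξ hξ =>
          hCu s u y T E g W (S.Om j ξ x t) ((hO _).trans (by linarith)) ξ hξ)
      simpa using this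

def Sys.HH (S : Sys n) : ℝ := 1 + n * S.δ + (n + 1) * S.δ

/-- the a priori estimate -/
theorem apriori (S : Sys n) (δ0 : 0 ≤ S.δ) : ∃ C, 0 ≤ C ∧ ∀ s u y T E, GoodSol S s u y → Win S s u T S.HH E →
    ∀ x ∈ I01, usq u x T ≤ C * E ∧ usq y x T ≤ C * E := by
  have hh : 0 < 1 + n * S.δ := by positivity
  obtain ⟨Cu, Cu0, hCu⟩ := usup S hh δ0 (le_refl S.HH)
  obtain ⟨C, C0, hC⟩ := zsup S hh δ0 (le_refl S.HH) n
  refine ⟨Cu + n * (2 * C + 2 * (S.B ^ 2 * n) * Cu), by positivity, ?_⟩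
  intro s u y T E g W x hx
  have E0 := W.E0
  have e1 := hCu s u y T E g W T (by simp; positivity) x hx
  have e2 : usq y x T ≤ n * (2 * C + 2 * (S.B ^ 2 * n) * Cu) * E := by
    calc usq y x T ≤ ∑ j : Fin n, (2 * (C * E) + 2 * (S.B ^ 2 * n) * (Cu * E)) := by
          unfold usq
          gcongr with j _
          refine (y_sq S u y j x T).trans ?_
          gcongr
          exact hC s u y T E g W 1 zero_le_one (by linarith) j (S.hρn j) x hx T (by simp)
      _ = _ := by simp; ring
  have e3 : 0 ≤ n * (2 * C + 2 * (S.B ^ 2 * n) * Cu) * E := by positivity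
  have e4 : 0 ≤ Cu * E := by positivity
  constructor <;> linarith

end Part10

section Part11

variable {n : ℕ}

lemma unif_bd {ι : Type} [Fintype ι] {g gx gt : ι → ℝ → ℝ → ℝ} (h : ∀ i, D1 (g i) (gx i) (gt i)) :
    ∃ C, 0 ≤ C ∧ ∀ i x t, |g i x t| ≤ C ∧ |gx i x t| ≤ C ∧ |gt i x t| ≤ C := by
  choose C hC using fun i => (h i).b
  refine ⟨∑ i, |C i|, Finset.sum_nonneg fun _ _ => abs_nonneg _, fun i x t => ?_⟩
  have h1 : C i ≤ ∑ i, |C i| := (le_abs_self _).trans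
    (Finset.single_le_sum (f := fun i => |C i|) (fun _ _ => abs_nonneg _) (Finset.mem_univ i))
  obtain ⟨a, b, c⟩ := hC i x t
  exact ⟨a.trans h1, b.trans h1, c.trans h1⟩

theorem exists_sys (m : ℕ) (p : Fin n → Fin n → ℝ) (hH3 : H3cond n p)
    (a : ℝ → ℝ → Fin n → ℝ) (b : ℝ → ℝ → Fin n → Fin n → ℝ)
    (hab : ∃ C : ℝ, ∀ j : Fin n, BCle 1 (fun x t => a x t j) C ∧
      ∀ k : Fin n, BCle 1 (fun x t => b x t j k) C)
    (Λ₀ : ℝ) (hΛ₀ : 0 < Λ₀) (hLam : LamCond n m Λ₀ a) :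
    ∃ S : Sys n, S.p = p ∧ (∀ j : Fin n, ((j : ℕ) < m → S.e j = 0 ∧ S.o j = 1) ∧
      (m ≤ (j : ℕ) → S.e j = 1 ∧ S.o j = 0)) ∧ 0 ≤ S.δ ∧
      (∀ j x t, S.α j x t = (a (pj x) t j)⁻¹) ∧ (∀ j x t, a (pj x) t j ≠ 0) ∧
      (∀ j k x t, S.β j k x t = b (pj x) t j k * (a (pj x) t j)⁻¹) := by
  classical
  obtain ⟨C, hC⟩ := hab
  choose ax at' hA using fun j => (hC j).1.toD1
  choose bx bt hB using fun j k => ((hC j).2 k).toD1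
  have hl : ∀ j x t, Λ₀ ≤ |a (pj x) t j| := by
    intro j x t
    have := (hLam (pj x) (pj_mem x) t).1 j
    rcases lt_or_ge (j:ℕ) m with hj | hj
    · exact (this.1 hj).trans (le_abs_self _)
    · rw [← abs_neg]; exact (by linarith [this.2 hj] : Λ₀ ≤ - a (pj x) t j).trans (le_abs_self _)
  have hne : ∀ j x t, a (pj x) t j ≠ 0 := fun j x t h0 => by
    have := hl j x t; rw [h0, abs_zero] at this; linarith
  have hαD := fun j => (hA j).inv hΛ₀ (hl j)
  have hβD := fun i : Fin n × Fin n => (hB i.1 i.2).mul (hαD i.1)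
  have hqex : ∀ i : Fin n × Fin n, ∃ gx gt, D1 (fun x t => if i.2 = i.1 then (0:ℝ) else
      b (pj x) t i.1 i.2 * a (pj x) t i.2 * (a (pj x) t i.2 - a (pj x) t i.1)⁻¹) gx gt := by
    intro i
    by_cases hi : i.2 = i.1
    · simp only [hi, if_true]; exact ⟨_, _, D1.zero⟩
    · simp only [hi, if_false]
      exact ⟨_, _, ((hB i.1 i.2).mul (hA i.2)).mul (((hA i.2).sub (hA i.1)).inv hΛ₀
        (fun x t => (hLam (pj x) (pj_mem x) t).2 _ _ hi))⟩
  choose qx qt hqD using hqex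
  obtain ⟨La, La0, hLa⟩ := unif_bd hαD
  obtain ⟨Bb, Bb0, hBb⟩ := unif_bd hβD
  obtain ⟨Bq, Bq0, hBq⟩ := unif_bd hqD
  obtain ⟨A, A0, hAb⟩ := unif_bd hA
  obtain ⟨ρ, hρn, hρ⟩ := exists_rank p hH3
  let S : Sys n :=
  { p := p
    e := fun j => if (j:ℕ) < m then 0 else 1
    o := fun j => if (j:ℕ) < m then 1 else 0
    α := fun j x t => (a (pj x) t j)⁻¹
    αt := fun j x t => -at' j x t / (a (pj x) t j) ^ 2
    β := fun j k x t => b (pj x) t j k * (a (pj x) t j)⁻¹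
    βt := fun j k x t => bt j k x t * (a (pj x) t j)⁻¹ + b (pj x) t j k * (-at' j x t / (a (pj x) t j) ^ 2)
    q := fun j k x t => if k = j then (0:ℝ) else
      b (pj x) t j k * a (pj x) t k * (a (pj x) t k - a (pj x) t j)⁻¹
    qx := fun j k => qx (j, k)
    qt := fun j k => qt (j, k)
    δ := La
    L := La
    B := Bb + Bq
    κ := (A + 1)⁻¹
    ρ := ρ
    sl := fun j => ⟨(hαD j).c, (hαD j).ct, (hαD j).dt, fun x t => (hLa j x t).1, fun x t => (hLa j x t).2.2⟩
    cβ := fun j k => (hβD (j, k)).c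
    cβt := fun j k => (hβD (j, k)).ct
    dβ := fun j k => (hβD (j, k)).dt
    bβ := fun j k x t => ((hBb (j, k) x t).1).trans (by linarith)
    bβt := fun j k x t => ((hBb (j, k) x t).2.2).trans (by linarith)
    B0 := by linarith
    dq := fun j k => hqD (j, k)
    bq := fun j k x t => ⟨((hBq (j, k) x t).1).trans (by linarith),
      ((hBq (j, k) x t).2.1).trans (by linarith), ((hBq (j, k) x t).2.2).trans (by linarith)⟩
    hq := by
      intro j k hjk x t
      simp only [hjk, if_false]
      have h1 := hne j x t
      have h2 := hne k x t
      have h3 : a (pj x) t k - a (pj x) t j ≠ 0 := fun h0 => by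
        have := (hLam (pj x) (pj_mem x) t).2 k j hjk
        rw [h0, abs_zero] at this; linarith
      field_simp
    hq0 := by intro j x t; simp
    κ0 := by positivity
    hin := by
      intro j
      rcases lt_or_ge (j:ℕ) m with hj | hj
      · left
        refine ⟨by simp [hj], by simp [hj], fun x t => ?_⟩
        have h1 := ((hLam (pj x) (pj_mem x) t).1 j).1 hj
        have h2 := (le_abs_self _).trans (hAb j x t).1
        exact inv_anti₀ (by linarith) (by linarith)
      · right
        refine ⟨by simp [hj.not_gt], by simp [hj.not_gt], fun x t => ?_⟩
        have h1 := ((hLam (pj x) (pj_mem x) t).1 j).2 hj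
        have h2 := (neg_le_abs _).trans (hAb j x t).1
        have := inv_anti₀ (by linarith : 0 < - a (pj x) t j) (by linarith : - a (pj x) t j ≤ A + 1)
        rw [inv_neg] at this
        linarith
    hρ := hρ
    hρn := hρn }
  refine ⟨S, rfl, fun j => ⟨fun hj => ?_, fun hj => ?_⟩, La0, fun _ _ _ => rfl, hne, fun _ _ _ _ => rfl⟩
  · exact ⟨if_pos hj, if_pos hj⟩
  · exact ⟨if_neg hj.not_gt, if_neg hj.not_gt⟩

end Part11

section Part12

variable {n : ℕ}

/-- assemble a vector from its components -/
def mkv (v : Fin n → ℝ) : Vn n := WithLp.toLp 2 v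

lemma mkv_apply (v : Fin n → ℝ) (j : Fin n) : mkv v j = v j := rfl

lemma mkv_norm_sq (v : Fin n → ℝ) : ‖mkv v‖ ^ 2 = ∑ j, v j ^ 2 := by
  rw [EuclideanSpace.norm_sq_eq]; simp [mkv_apply]

lemma mkv_cont {X : Type*} [TopologicalSpace X] {f : Fin n → X → ℝ} (h : ∀ j, Continuous (f j)) :
    Continuous fun z => mkv fun j => f j z :=
  (PiLp.continuous_toLp 2 _).comp (continuous_pi h)

instance : IsFiniteMeasure μ01 := ⟨by simp⟩

lemma bdd_memLp {f : ℝ → Vn n} (hf : Continuous f) : MemLp f 2 μ01 := by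
  obtain ⟨C, hC⟩ := (isCompact_Icc (a := (0:ℝ)) (b := 1)).exists_bound_of_continuousOn hf.continuousOn
  refine MemLp.of_bound hf.aestronglyMeasurable C ?_
  refine (ae_restrict_iff' measurableSet_Ioo).2 (Eventually.of_forall fun x hx => hC x ⟨hx.1.le, hx.2.le⟩)

/-- norm of an `L²` element with continuous representative -/
lemma L2_norm_sq {f : L2 n} {g : ℝ → Vn n} (h : ∀ᵐ x ∂μ01, f x = g x) :
    ‖f‖ ^ 2 = ∫ x in (0:ℝ)..1, ‖g x‖ ^ 2 := by
  have h1 : ‖f‖ ^ 2 = ∫ x, ‖f x‖ ^ 2 ∂μ01 := by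
    rw [← real_inner_self_eq_norm_sq, L2.inner_def]
    simp only [real_inner_self_eq_norm_sq]
  rw [h1, intervalIntegral.integral_of_le zero_le_one, integral_Ioc_eq_integral_Ioo]
  exact integral_congr_ae (h.mono fun x hx => by simp only [hx])

/-- `C¹` functions compactly supported in `(0,1)`, as a subspace of `L²` -/
def testM (n : ℕ) : Submodule ℝ (L2 n) where
  carrier := {f | ∃ g : ℝ → Vn n, ContDiff ℝ 1 g ∧ tsupport g ⊆ Ioo 0 1 ∧ ∀ᵐ x ∂μ01, f x = g x}
  zero_mem' := ⟨fun _ => 0, contDiff_const, by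
    have : (fun _ : ℝ => (0 : Vn n)) = 0 := rfl
    rw [this]
    simp [tsupport_eq_empty_iff.2 rfl], Lp.coeFn_zero _ _ _⟩
  add_mem' := by
    rintro f f' ⟨g, h1, h2, h3⟩ ⟨g', h1', h2', h3'⟩
    refine ⟨g + g', h1.add h1', (tsupport_add g g').trans (union_subset h2 h2'), ?_⟩
    filter_upwards [h3, h3', Lp.coeFn_add f f'] with x a b c
    rw [c, Pi.add_apply, Pi.add_apply, a, b]
  smul_mem' := by
    rintro c f ⟨g, h1, h2, h3⟩
    refine ⟨c • g, h1.const_smul c, (closure_mono (Function.support_const_smul_subset c g)).trans h2, ?_⟩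
    filter_upwards [h3, Lp.coeFn_smul c f] with x a b
    rw [b, Pi.smul_apply, Pi.smul_apply, a]

lemma testM_dense : Dense (testM n : Set (L2 n)) := by
  rw [Submodule.dense_iff_topologicalClosure_eq_top, Submodule.topologicalClosure_eq_top_iff,
    Submodule.eq_bot_iff]
  intro f hf
  rw [Submodule.mem_orthogonal] at hf
  have key : ∀ j : Fin n, ∀ᵐ x ∂μ01, f x j = 0 := by
    intro j
    have hi : Integrable (fun x => f x j) μ01 := by
      have h1 : Integrable f μ01 := (Lp.memLp f).integrable (by norm_num)
      exact ContinuousLinearMap.integrable_comp (EuclideanSpace.proj j : Vn n →L[ℝ] ℝ) h1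
    have := isOpen_Ioo.ae_eq_zero_of_integral_contDiff_smul_eq_zero (U := Ioo (0:ℝ) 1)
      (f := fun x => f x j) (μ := μ01) (hi.locallyIntegrable.locallyIntegrableOn _) (by
        intro g g1 g2 g3
        have c1 : ContDiff ℝ 1 (fun x => g x • (EuclideanSpace.single j (1:ℝ) : Vn n)) :=
          (g1.of_le (by simp)).smul contDiff_const
        have hm := bdd_memLp c1.continuous
        have := hf (hm.toLp _) ⟨_, c1, (closure_mono (Function.support_smul_subset_left _ _)).trans g3,
          hm.coeFn_toLp⟩
        rw [L2.inner_def] at this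
        rw [← this]
        refine integral_congr_ae (hm.coeFn_toLp.mono fun x hx => ?_)
        simp only [hx]
        rw [inner_smul_left, EuclideanSpace.inner_single_left]
        simp)
    have h2 : ∀ᵐ x ∂μ01, x ∈ Ioo (0:ℝ) 1 := ae_restrict_mem measurableSet_Ioo
    filter_upwards [this, h2] with x a b using a b
  apply (Lp.eq_zero_iff_ae_eq_zero).2
  filter_upwards [ae_all_iff.2 key] with x hx
  ext j; simpa using hx j

end Part12

section Part13

variable {n : ℕ}

/-- the normalised system `S` encodes the data of the original problem -/
structure SRel (S : Sys n) (m : ℕ) (p : Fin n → Fin n → ℝ) (a : ℝ → ℝ → Fin n → ℝ)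
    (b : ℝ → ℝ → Fin n → Fin n → ℝ) : Prop where
  hp : S.p = p
  eo : ∀ j : Fin n, ((j:ℕ) < m → S.e j = 0 ∧ S.o j = 1) ∧ (m ≤ (j:ℕ) → S.e j = 1 ∧ S.o j = 0)
  d0 : 0 ≤ S.δ
  hα : ∀ j x t, S.α j x t = (a (pj x) t j)⁻¹
  ha : ∀ j x t, a (pj x) t j ≠ 0
  hβ : ∀ j k x t, S.β j k x t = b (pj x) t j k * (a (pj x) t j)⁻¹

/-- the `x`-derivative of a solution -/
def dX (S : Sys n) (u y : Fin n → ℝ → ℝ → ℝ) (j : Fin n) (x t : ℝ) : ℝ :=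
  -(S.α j x t * y j x t) - ∑ k, S.β j k x t * u k x t

lemma dX_c {S : Sys n} {s : ℝ} {u y : Fin n → ℝ → ℝ → ℝ} (g : GoodSol S s u y) : CF (dX S u y) := by
  intro j
  exact (((S.sl j).c.mul (g.cy j)).neg).sub (continuous_finsetSum _ fun k _ => (S.cβ j k).mul (g.cu k))

/-- vanishing near the endpoints at the initial time -/
def Sup0 (s : ℝ) (u : Fin n → ℝ → ℝ → ℝ) : Prop :=
  ∃ l r, 0 < l ∧ r < 1 ∧ ∀ j, ∀ x ∈ I01, (x < l ∨ r < x) → u j x s = 0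

lemma datum_supp {s : ℝ} {u : Fin n → ℝ → ℝ → ℝ} (h : Sup0 s u) :
    ∃ l r, 0 < l ∧ r < 1 ∧ ∀ j x, (x < l ∨ r < x) → u j (pj x) s = 0 := by
  obtain ⟨l, r, hl, hr, h⟩ := h
  refine ⟨l, r, hl, hr, fun j x hx => h j _ (pj_mem x) ?_⟩
  rcases hx with hx | hx
  · left; unfold pj; exact max_lt hl ((min_le_right _ _).trans_lt hx)
  · right; unfold pj; exact (lt_min hr hx).trans_le (le_max_right _ _)

lemma datum_smooth {S : Sys n} {s : ℝ} {u y : Fin n → ℝ → ℝ → ℝ} (g : GoodSol S s u y)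
    (h : Sup0 s u) : ContDiff ℝ 1 (fun x => mkv fun j => u j (pj x) s) := by
  obtain ⟨l, r, hl, hr, h⟩ := datum_supp h
  rw [contDiff_euclidean]
  intro j
  simp only [mkv_apply]
  rw [contDiff_iff_contDiffAt]
  intro x
  by_cases h1 : x < l
  · have : (fun x => u j (pj x) s) =ᶠ[nhds x] fun _ => 0 := by
      filter_upwards [Iio_mem_nhds h1] with z hz using h j z (Or.inl hz)
    exact contDiffAt_const.congr_of_eventuallyEq this
  by_cases h2 : r < x
  · have : (fun x => u j (pj x) s) =ᶠ[nhds x] fun _ => 0 := by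
      filter_upwards [Ioi_mem_nhds h2] with z hz using h j z (Or.inr hz)
    exact contDiffAt_const.congr_of_eventuallyEq this
  have hx : x ∈ Ioo (0:ℝ) 1 := ⟨by linarith, by linarith⟩
  have hd : ∀ z ∈ Ioo (0:ℝ) 1, HasDerivAt (fun x => u j (pj x) s) (dX S u y j z s) z := by
    intro z hz
    have h3 := (g.dx j z ⟨hz.1.le, hz.2.le⟩ s le_rfl).hasDerivAt (Icc_mem_nhds hz.1 hz.2)
    refine h3.congr_of_eventuallyEq ?_
    filter_upwards [Icc_mem_nhds hz.1 hz.2] with w hw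
    rw [pj_of_mem hw]
  have : ContDiffOn ℝ (0 + 1) (fun x => u j (pj x) s) (Ioo 0 1) := by
    rw [contDiffOn_succ_iff_deriv_of_isOpen isOpen_Ioo]
    refine ⟨fun z hz => (hd z hz).differentiableAt.differentiableWithinAt, by simp, ?_⟩
    refine contDiffOn_zero.2 (ContinuousOn.congr (f := fun z => dX S u y j z s) ?_ fun z hz => (hd z hz).deriv)
    exact (c2 (dX_c g j) continuous_id continuous_const).continuousOn
  simpa using this.contDiffAt (Ioo_mem_nhds hx.1 hx.2)

lemma datum_tsupp {s : ℝ} {u : Fin n → ℝ → ℝ → ℝ} (h : Sup0 s u) :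
    tsupport (fun x => mkv fun j => u j (pj x) s) ⊆ Ioo 0 1 := by
  obtain ⟨l, r, hl, hr, h⟩ := datum_supp h
  have : tsupport (fun x => mkv fun j => u j (pj x) s) ⊆ Icc l r := by
    refine closure_minimal ?_ isClosed_Icc
    intro x hx
    by_contra h1
    apply hx
    have h2 : x < l ∨ r < x := by
      rcases lt_or_ge x l with h3 | h3
      · exact Or.inl h3
      · right; by_contra h4; exact h1 ⟨h3, not_lt.1 h4⟩
    ext j
    exact h j x h2
  exact this.trans (Icc_subset_Ioo hl hr)

lemma good_linsol {S : Sys n} {m : ℕ} {p : Fin n → Fin n → ℝ} {a : ℝ → ℝ → Fin n → ℝ}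
    {b : ℝ → ℝ → Fin n → Fin n → ℝ} (R : SRel S m p a b) {s : ℝ} {u y : Fin n → ℝ → ℝ → ℝ}
    (g : GoodSol S s u y) :
    IsLinSol n m p a b (fun _ _ _ => 0) s (fun x => mkv fun j => u j (pj x) s)
      (fun x t => mkv fun j => u j x t) (fun x t => mkv fun j => dX S u y j x t)
      (fun x t => mkv fun j => y j x t) := by
  refine ⟨(mkv_cont g.cu).continuousOn, (mkv_cont (dX_c g)).continuousOn, (mkv_cont g.cy).continuousOn,
    fun x hx t ht j => ⟨g.dx j x hx t ht, (g.dt j x t).hasDerivWithinAt⟩, fun x hx t ht j => ?_,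
    fun t ht j => ?_, fun x hx => ?_⟩
  · simp only [mkv_apply, dX]
    have h0 := R.ha j x t
    have h1 := R.hα j x t
    have h2 := fun k => R.hβ j k x t
    rw [pj_of_mem hx] at h0 h1
    simp only [pj_of_mem hx] at h2
    simp only [h1, h2]
    have : ∑ k, b x t j k * (a x t j)⁻¹ * u k x t = (∑ k, b x t j k * u k x t) * (a x t j)⁻¹ := by
      rw [Finset.sum_mul]; exact Finset.sum_congr rfl fun k _ => by ring
    rw [this]
    field_simp
    ring
  · have hb := g.bc j t
    have hs : ∑ k, S.p j k * u k (S.o k) t = ∑ k : Fin n, if m ≤ (k : ℕ) then p j k * (mkv fun j => u j 0 t) k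
        else p j k * (mkv fun j => u j 1 t) k := by
      refine Finset.sum_congr rfl fun k _ => ?_
      rw [R.hp]
      split_ifs with hk
      · rw [((R.eo k).2 hk).2, mkv_apply]
      · rw [((R.eo k).1 (not_le.1 hk)).2, mkv_apply]
    rw [hs] at hb
    constructor
    · intro hj; rw [← hb, ((R.eo j).1 hj).1]; rfl
    · intro hj; rw [← hb, ((R.eo j).2 hj).1]; rfl
  · simp only [pj_of_mem hx]

lemma ae01 {P : ℝ → Prop} (h : ∀ x ∈ I01, P x) : ∀ᵐ x ∂μ01, P x :=
  (ae_restrict_iff' measurableSet_Ioo).2 (Eventually.of_forall fun x hx => h x ⟨hx.1.le, hx.2.le⟩)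

lemma good_evo {S : Sys n} {m : ℕ} {p : Fin n → Fin n → ℝ} {a : ℝ → ℝ → Fin n → ℝ}
    {b : ℝ → ℝ → Fin n → Fin n → ℝ} (R : SRel S m p a b) {U : ℝ → ℝ → L2 n →L[ℝ] L2 n}
    (hU : GeneratedBy n m p a b U) {s : ℝ} {u y : Fin n → ℝ → ℝ → ℝ}
    (g : GoodSol S s u y) (h0 : Sup0 s u) {f : L2 n} (hf : ∀ᵐ x ∂μ01, f x = mkv fun j => u j x s)
    {t : ℝ} (ht : s ≤ t) : ∀ᵐ x ∂μ01, (U t s f) x = mkv fun j => u j x t := by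
  refine hU.2.2.2 s _ (datum_smooth g h0) (datum_tsupp h0) f ?_ _ _ _ (good_linsol R g) t ht
  have := ae01 (P := fun x => pj x = x) fun x hx => pj_of_mem hx
  filter_upwards [hf, this] with x h1 h2
  rw [h1, h2]

/-- elements of `L²` which are data of good solutions -/
def Dset (S : Sys n) (s : ℝ) : Set (L2 n) :=
  {f | ∃ u y, GoodSol S s u y ∧ Sup0 s u ∧ ∀ᵐ x ∂μ01, f x = mkv fun j => u j x s}

lemma Dset_dense (S : Sys n) (s : ℝ) : Dense (Dset S s) := by
  intro f
  rw [Metric.mem_closure_iff]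
  intro ε hε
  obtain ⟨f1, ⟨g, g1, g2, g3⟩, hf1⟩ := Metric.mem_closure_iff.1 (testM_dense (n := n) f) (ε/2) (by linarith)
  obtain ⟨xl, xr, hl, hr, hs⟩ : ∃ xl xr, 0 < xl ∧ xr < 1 ∧ ∀ x, (x < xl ∨ xr < x) → g x = 0 := by
    have hc : IsCompact (tsupport g) :=
      (isCompact_Icc (a := (0:ℝ)) (b := 1)).of_isClosed_subset (isClosed_tsupport g)
        (g2.trans Ioo_subset_Icc_self)
    rcases (tsupport g).eq_empty_or_nonempty with h | h
    · exact ⟨1/2, 1/2, by norm_num, by norm_num, fun x _ => by rw [tsupport_eq_empty_iff.1 h]; rfl⟩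
    · obtain ⟨xl, h1, h2⟩ := hc.exists_isLeast h
      obtain ⟨xr, h3, h4⟩ := hc.exists_isGreatest h
      refine ⟨xl, xr, (g2 h1).1, (g2 h3).2, fun x hx => ?_⟩
      apply image_eq_zero_of_notMem_tsupport
      intro hm
      rcases hx with hx | hx
      · exact absurd (h2 hm) (not_le.2 hx)
      · exact absurd (h4 hm) (not_le.2 hx)
  have g1' := contDiff_euclidean.1 g1
  obtain ⟨u, y, hg, hu, h0⟩ := S.exists_good s (φ := fun j x => g x j) (ψ := fun j => deriv (fun x => g x j))
    (fun j => (g1' j).continuous_deriv le_rfl)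
    (fun j x => ((g1' j).differentiable (by simp) x).hasDerivAt) hl hr
    (fun j x hx => by simp [hs x hx]) (ε := ε / (2 * (n + 1))) (by positivity)
  have cu : Continuous (fun x => mkv fun j => u j x s) :=
    mkv_cont fun j => c2 (hg.cu j) continuous_id continuous_const
  have hm := bdd_memLp cu
  refine ⟨hm.toLp, ⟨u, y, hg, h0, hm.coeFn_toLp⟩, ?_⟩
  have h1 : ‖f1 - hm.toLp‖ ≤ ε / 2 := by
    have e1 : ∀ᵐ x ∂μ01, (f1 - hm.toLp) x = g x - mkv fun j => u j x s := by
      filter_upwards [g3, hm.coeFn_toLp, Lp.coeFn_sub f1 (hm.toLp)] with x h1 h2 h3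
      rw [h3, Pi.sub_apply, h1, h2]
    have e2 := L2_norm_sq e1
    have e3 : ∀ x, ‖g x - mkv fun j => u j x s‖ ^ 2 ≤ (ε / 2) ^ 2 := by
      intro x
      rw [EuclideanSpace.norm_sq_eq]
      calc _ ≤ ∑ j : Fin n, (ε / (2 * (n + 1))) ^ 2 := by
            refine Finset.sum_le_sum fun j _ => ?_
            refine pow_le_pow_left₀ (norm_nonneg _) ?_ 2
            have := hu j x
            rw [abs_sub_comm] at this
            exact this
        _ = n * (ε / (2 * (n + 1))) ^ 2 := by simp
        _ ≤ _ := by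
            rw [div_pow, div_pow, mul_pow]
            have : (0:ℝ) < (n+1)^2 := by positivity
            rw [← mul_div_assoc, div_le_div_iff₀ (by positivity) (by positivity)]
            have h5 : (n:ℝ) ≤ (n+1)^2 := by nlinarith [(Nat.cast_nonneg n : (0:ℝ) ≤ n)]
            nlinarith [mul_le_mul_of_nonneg_left h5 (by positivity : 0 ≤ ε^2 * 2^2)]
    have e4 : ‖f1 - hm.toLp‖ ^ 2 ≤ (ε/2) ^ 2 := by
      rw [e2]
      have := intervalIntegral.integral_mono_on (a := (0:ℝ)) (b := 1) (μ := volume) zero_le_one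
        (f := fun x => ‖g x - mkv fun j => u j x s‖ ^ 2) (g := fun _ => (ε/2)^2)
        (((g1.continuous.sub cu).norm.pow 2).intervalIntegrable _ _) (by simp) fun x _ => e3 x
      simpa using this
    exact le_of_sq_le_sq e4 (by positivity)
  calc dist f (hm.toLp) ≤ dist f f1 + dist f1 (hm.toLp) := dist_triangle _ _ _
    _ < ε := by rw [dist_eq_norm f1]; linarith

end Part13

section Part14

variable {n : ℕ}

lemma abs_le_mkv (v : Fin n → ℝ) (j : Fin n) : |v j| ≤ ‖mkv v‖ := by
  have := PiLp.norm_apply_le (mkv v) j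
  rwa [mkv_apply, Real.norm_eq_abs] at this

lemma mkv_le {v : Fin n → ℝ} {c : ℝ} (hc : 0 ≤ c) (h : ∀ j, |v j| ≤ c) : ‖mkv v‖ ≤ n * c := by
  refine le_of_sq_le_sq ?_ (by positivity)
  rw [mkv_norm_sq]
  calc _ ≤ ∑ _j : Fin n, c ^ 2 := Finset.sum_le_sum fun j _ => by
        rw [← sq_abs]; exact pow_le_pow_left₀ (abs_nonneg _) (h j) 2
    _ = n * c ^ 2 := by simp
    _ ≤ _ := by
      rw [mul_pow]
      refine mul_le_mul_of_nonneg_right ?_ (by positivity)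
      exact_mod_cast Nat.le_self_pow (by norm_num) n

lemma Sup0.sub {s : ℝ} {u u' : Fin n → ℝ → ℝ → ℝ} (h : Sup0 s u) (h' : Sup0 s u') :
    Sup0 s (fun j x t => u j x t - u' j x t) := by
  obtain ⟨l, r, hl, hr, h⟩ := h
  obtain ⟨l', r', hl', hr', h'⟩ := h'
  refine ⟨min l l', max r r', lt_min hl hl', max_lt hr hr', fun j x hx hh => ?_⟩
  have e1 : x < l ∨ r < x := hh.imp (fun h => h.trans_le (min_le_left _ _)) fun h => (le_max_left _ _).trans_lt h
  have e2 : x < l' ∨ r' < x := hh.imp (fun h => h.trans_le (min_le_right _ _)) fun h => (le_max_right _ _).trans_lt h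
  simp only [h j x hx e1, h' j x hx e2, sub_zero]

lemma Sys.HH_pos (S : Sys n) (h : 0 ≤ S.δ) : 0 < S.HH := by
  unfold Sys.HH; positivity

lemma main_bound {S : Sys n} {m : ℕ} {p : Fin n → Fin n → ℝ} {a : ℝ → ℝ → Fin n → ℝ}
    {b : ℝ → ℝ → Fin n → Fin n → ℝ} (R : SRel S m p a b) {U : ℝ → ℝ → L2 n →L[ℝ] L2 n}
    (hU : GeneratedBy n m p a b U) {s T : ℝ} (hT : s + S.HH ≤ T) :
    ∃ C, 0 ≤ C ∧ ∀ u y, GoodSol S s u y → Sup0 s u → ∀ f : L2 n,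
      (∀ᵐ x ∂μ01, f x = mkv fun j => u j x s) → ∀ x ∈ I01,
      ‖mkv fun j => u j x T‖ ≤ C * ‖f‖ ∧ ‖mkv fun j => dX S u y j x T‖ ≤ C * ‖f‖ := by
  obtain ⟨C, C0, hC⟩ := apriori S R.d0
  obtain ⟨K, hK, ν, hν⟩ := hU.2.2.1
  have H0 := S.HH_pos R.d0
  set M := K * Real.exp (|ν| * (T + S.HH - s)) with hM
  have M0 : 0 ≤ M := by positivity
  set c := Real.sqrt C * M with hc
  have c0 : 0 ≤ c := by positivity
  have B0 := S.B0
  have δ0 := R.d0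
  refine ⟨c + n * ((S.δ + n * S.B) * c), by positivity, fun u y g h0 f hf x hx => ?_⟩
  have W : Win S s u T S.HH ((M * ‖f‖) ^ 2) := by
    refine ⟨by positivity, H0.le, hT, fun t ht => ?_⟩
    have hst : s ≤ t := by linarith [ht.1]
    have e1 := L2_norm_sq (good_evo R hU g h0 hf hst)
    simp only [mkv_norm_sq] at e1
    have e2 : ‖U t s f‖ ≤ M * ‖f‖ := by
      refine ((U t s).le_opNorm f).trans (mul_le_mul_of_nonneg_right ((hν s t hst).trans ?_) (norm_nonneg _))
      refine mul_le_mul_of_nonneg_left (Real.exp_le_exp.2 ?_) (by linarith)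
      calc ν * (t - s) ≤ |ν| * (t - s) := mul_le_mul_of_nonneg_right (le_abs_self _) (by linarith)
        _ ≤ _ := mul_le_mul_of_nonneg_left (by linarith [ht.2]) (abs_nonneg _)
    unfold usq
    rw [← e1]
    exact pow_le_pow_left₀ (norm_nonneg _) e2 2
  obtain ⟨hu, hy⟩ := hC s u y T _ g W x hx
  have hcf : C * (M * ‖f‖) ^ 2 = (c * ‖f‖) ^ 2 := by
    have := Real.sq_sqrt C0
    calc _ = Real.sqrt C ^ 2 * (M * ‖f‖) ^ 2 := by rw [this]
      _ = _ := by rw [hc]; ring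
  rw [hcf] at hu hy
  have hcf0 : 0 ≤ c * ‖f‖ := by positivity
  have hu' : ‖mkv fun j => u j x T‖ ≤ c * ‖f‖ := le_of_sq_le_sq (by rw [mkv_norm_sq]; exact hu) hcf0
  have hy' : ‖mkv fun j => y j x T‖ ≤ c * ‖f‖ := le_of_sq_le_sq (by rw [mkv_norm_sq]; exact hy) hcf0
  have hd : ∀ j, |dX S u y j x T| ≤ (S.δ + n * S.B) * (c * ‖f‖) := by
    intro j
    unfold dX
    refine (abs_sub _ _).trans ?_
    rw [abs_neg, abs_mul, add_mul]
    refine add_le_add (mul_le_mul ((S.sl j).b x T) ((abs_le_mkv (fun j => y j x T) j).trans hy')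
      (abs_nonneg _) δ0) ?_
    refine (Finset.abs_sum_le_sum_abs _ _).trans ?_
    calc _ ≤ ∑ _k : Fin n, S.B * (c * ‖f‖) := Finset.sum_le_sum fun k _ => by
          rw [abs_mul]
          exact mul_le_mul (S.bβ j k x T) ((abs_le_mkv (fun j => u j x T) k).trans hu') (abs_nonneg _) B0
      _ = _ := by simp; ring
  have hd' := mkv_le (by positivity) hd
  have q1 : 0 ≤ n * ((S.δ + n * S.B) * c) * ‖f‖ := by positivity
  constructor
  · rw [add_mul]; linarith
  · rw [add_mul]
    refine hd'.trans ?_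
    have : n * ((S.δ + n * S.B) * (c * ‖f‖)) = n * ((S.δ + n * S.B) * c) * ‖f‖ := by ring
    rw [this]; linarith

lemma cauchy_of_le {X Y : Type*} [PseudoMetricSpace X] [PseudoMetricSpace Y] {x : ℕ → X} {z : ℕ → Y}
    {C : ℝ} (C0 : 0 ≤ C) (h : ∀ k l, dist (z k) (z l) ≤ C * dist (x k) (x l)) (hx : CauchySeq x) :
    CauchySeq z := by
  rw [Metric.cauchySeq_iff] at hx ⊢
  intro ε hε
  obtain ⟨N, hN⟩ := hx (ε / (C + 1)) (by positivity)
  refine ⟨N, fun k hk l hl => (h k l).trans_lt ?_⟩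
  have := hN k hk l hl
  rw [lt_div_iff₀ (by positivity)] at this
  nlinarith [dist_nonneg (x := x k) (y := x l)]

/-- continuous map on the unit interval from components -/
def vc (v : Fin n → ℝ → ℝ) (hv : ∀ j, Continuous (v j)) : C(I01, Vn n) :=
  ⟨fun x => mkv fun j => v j x, mkv_cont fun j => (hv j).comp continuous_subtype_val⟩

/-- projection onto the unit interval, as a subtype -/
def pI (x : ℝ) : I01 := projIcc 0 1 zero_le_one x

lemma pI_cont : Continuous pI := continuous_projIcc (h := zero_le_one)

lemma pI_mem {x : ℝ} (h : x ∈ I01) : pI x = ⟨x, h⟩ := projIcc_of_mem _ h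

lemma limit_exists {S : Sys n} {m : ℕ} {p : Fin n → Fin n → ℝ} {a : ℝ → ℝ → Fin n → ℝ}
    {b : ℝ → ℝ → Fin n → Fin n → ℝ} (R : SRel S m p a b) {U : ℝ → ℝ → L2 n →L[ℝ] L2 n}
    (hU : GeneratedBy n m p a b U) {s T : ℝ} (hT : s + S.HH ≤ T) :
    ∃ C, 0 ≤ C ∧ ∀ φ : L2 n, ∃ g h : C(I01, Vn n),
      (∀ x ∈ I01, ∀ j, g (pI x) j - g (pI 0) j = ∫ z in (0:ℝ)..x, h (pI z) j) ∧
      (∀ x, ‖g x‖ ≤ C * ‖φ‖ ∧ ‖h x‖ ≤ C * ‖φ‖) ∧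
      ∀ᵐ x ∂μ01, (U T s φ) x = g (pI x) := by
  obtain ⟨C, C0, hC⟩ := main_bound R hU hT
  have hsT : s ≤ T := by linarith [S.HH_pos R.d0]
  refine ⟨C, C0, fun φ => ?_⟩
  obtain ⟨F, hF, hFφ⟩ := mem_closure_iff_seq_limit.1 (Dset_dense S s φ)
  choose u y hg h0 hf using hF
  set V : ℕ → C(I01, Vn n) := fun k => vc (fun j x => u k j x T)
    fun j => c2 ((hg k).cu j) continuous_id continuous_const with hV
  set V' : ℕ → C(I01, Vn n) := fun k => vc (fun j x => dX S (u k) (y k) j x T)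
    fun j => c2 (dX_c (hg k) j) continuous_id continuous_const with hV'
  have hdiff : ∀ k l, ∀ x ∈ I01, ‖mkv fun j => u k j x T - u l j x T‖ ≤ C * ‖F k - F l‖ ∧
      ‖mkv fun j => dX S (u k) (y k) j x T - dX S (u l) (y l) j x T‖ ≤ C * ‖F k - F l‖ := by
    intro k l x hx
    have := hC _ _ ((hg k).sub (hg l)) ((h0 k).sub (h0 l)) (F k - F l) (by
      filter_upwards [hf k, hf l, Lp.coeFn_sub (F k) (F l)] with x h1 h2 h3
      rw [h3, Pi.sub_apply, h1, h2]; rfl) x hx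
    refine ⟨this.1, ?_⟩
    have e : (fun j => dX S (u k) (y k) j x T - dX S (u l) (y l) j x T) =
        fun j => dX S (fun j x t => u k j x t - u l j x t) (fun j x t => y k j x t - y l j x t) j x T := by
      funext j
      simp only [dX, mul_sub, Finset.sum_sub_distrib]; ring
    rw [e]; exact this.2
  have cF : CauchySeq F := hFφ.cauchySeq
  have cV : CauchySeq V := cauchy_of_le C0 (fun k l => by
    rw [dist_eq_norm, dist_eq_norm]
    exact (ContinuousMap.norm_le _ (by positivity)).2 fun x => (hdiff k l x x.2).1) cF
  have cV' : CauchySeq V' := cauchy_of_le C0 (fun k l => by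
    rw [dist_eq_norm, dist_eq_norm]
    exact (ContinuousMap.norm_le _ (by positivity)).2 fun x => (hdiff k l x x.2).2) cF
  obtain ⟨g, hgl⟩ := cauchySeq_tendsto_of_complete cV
  obtain ⟨h, hhl⟩ := cauchySeq_tendsto_of_complete cV'
  have pg : ∀ x, Tendsto (fun k => V k x) atTop (nhds (g x)) := fun x =>
    ((continuous_eval_const x).tendsto g).comp hgl
  have ph : ∀ x, Tendsto (fun k => V' k x) atTop (nhds (h x)) := fun x =>
    ((continuous_eval_const x).tendsto h).comp hhl
  have hFn : Tendsto (fun k => C * ‖F k‖) atTop (nhds (C * ‖φ‖)) := hFφ.norm.const_mul C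
  have cj : ∀ j : Fin n, Continuous fun v : Vn n => v j := fun j =>
    (EuclideanSpace.proj j : Vn n →L[ℝ] ℝ).continuous
  refine ⟨g, h, fun x hx j => ?_, fun x => ⟨?_, ?_⟩, ?_⟩
  · have l1 : Tendsto (fun k => V k (pI x) j - V k (pI 0) j) atTop
        (nhds (g (pI x) j - g (pI 0) j)) :=
      (((cj j).tendsto _).comp (pg _)).sub (((cj j).tendsto _).comp (pg _))
    have l2 : Tendsto (fun k => ∫ z in (0:ℝ)..x, V' k (pI z) j) atTop
        (nhds (∫ z in (0:ℝ)..x, h (pI z) j)) := by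
      refine intervalIntegral.tendsto_integral_filter_of_dominated_convergence (fun _ => ‖h‖ + 1)
        (Eventually.of_forall fun k => ((cj j).comp ((V' k).continuous.comp pI_cont)).aestronglyMeasurable)
        ?_ (by simp) (Eventually.of_forall fun z _ => ((cj j).tendsto _).comp (ph _))
      filter_upwards [hhl.norm.eventually (gt_mem_nhds (lt_add_one ‖h‖))] with k hk
      refine Eventually.of_forall fun z _ => ?_
      exact (PiLp.norm_apply_le _ j).trans (((V' k).norm_coe_le_norm _).trans hk.le)
    refine tendsto_nhds_unique l1 (l2.congr fun k => ?_)
    have h00 : (0:ℝ) ∈ I01 := by simp [I01]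
    have e1 : ∀ z, V' k (pI z) j = dX S (u k) (y k) j (pI z) T := fun z => rfl
    have e2 : ∀ z, V k (pI z) j = u k j (pI z) T := fun z => rfl
    simp only [e1, e2]
    have := ftcI (h := fun x => u k j x T) (h' := fun x => dX S (u k) (y k) j (pI x) T) h00 hx
      (c2 (dX_c (hg k) j) (continuous_subtype_val.comp pI_cont) continuous_const)
      (fun z hz => by
        rw [pI_mem hz]; exact (hg k).dx j z hz T hsT)
    rw [this, pI_mem hx, pI_mem h00]
  · exact le_of_tendsto_of_tendsto' (pg x).norm hFn fun k =>
      (hC _ _ (hg k) (h0 k) (F k) (hf k) x x.2).1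
  · exact le_of_tendsto_of_tendsto' (ph x).norm hFn fun k =>
      (hC _ _ (hg k) (h0 k) (F k) (hf k) x x.2).2
  · have t1 : Tendsto (fun k => U T s (F k)) atTop (nhds (U T s φ)) :=
      ((U T s).continuous.tendsto φ).comp hFφ
    obtain ⟨ns, hns, hae⟩ := (tendstoInMeasure_of_tendsto_Lp t1).exists_seq_tendsto_ae
    have hev := ae_all_iff.2 fun k => good_evo R hU (hg k) (h0 k) (hf k) hsT
    filter_upwards [hae, hev, ae01 (P := fun x => x ∈ I01) fun x hx => hx] with x h1 h2 h3
    refine tendsto_nhds_unique h1 (((pg (pI x)).comp hns.tendsto_atTop).congr fun k => ?_)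
    have : ((pI x : I01) : ℝ) = x := by rw [pI_mem h3]
    rw [h2]
    change mkv (fun j => u (ns k) j (pI x) T) = _
    rw [this]

lemma uniq {g h : ℝ → Vn n} (cg : Continuous g) (ch : Continuous h) (e : ∀ᵐ x ∂μ01, g x = h x) :
    ∀ x ∈ I01, g x = h x := by
  have : g =ᵐ[volume.restrict (Icc (0:ℝ) 1)] h := by
    rw [← Measure.restrict_congr_set Ioo_ae_eq_Icc]; exact e
  exact Measure.eqOn_Icc_of_ae_eq volume zero_ne_one this cg.continuousOn ch.continuousOn

end Part14

/- STATEMENT 7: smoothing property of the evolution family: for `t ≥ s + 2d`,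
`U(t,s)` factors through `C¹([0,1];ℝⁿ)` via a bounded linear operator. -/
theorem stmt_7 (n m : ℕ) (hn : 1 ≤ n) (hmn : m ≤ n)
    (p : Fin n → Fin n → ℝ) (hH3 : H3cond n p)
    (a : ℝ → ℝ → Fin n → ℝ) (b : ℝ → ℝ → Fin n → Fin n → ℝ)
    -- `a`, `b` have bounded continuous partial derivatives up to first order
    (hab : ∃ C : ℝ, ∀ j : Fin n, BCle 1 (fun x t => a x t j) C ∧
      ∀ k : Fin n, BCle 1 (fun x t => b x t j k) C)
    (Λ₀ : ℝ) (hΛ₀ : 0 < Λ₀) (hLam : LamCond n m Λ₀ a)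
    (U : ℝ → ℝ → L2 n →L[ℝ] L2 n) (hU : GeneratedBy n m p a b U) :
    ∃ d : ℝ, 0 < d ∧ ∀ s t : ℝ, s + 2 * d ≤ t →
      -- a linear operator `W` from `L²` into `C¹([0,1];ℝⁿ)` ...
      ∃ W : L2 n →ₗ[ℝ] (ℝ → Vn n), ∃ C : ℝ, 0 ≤ C ∧
        ∀ φ : L2 n, ∃ g' : ℝ → Vn n,
          ContinuousOn (W φ) (Set.Icc 0 1) ∧
          ContinuousOn g' (Set.Icc 0 1) ∧
          (∀ x ∈ Set.Icc (0:ℝ) 1, ∀ j : Fin n,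
            HasDerivWithinAt (fun y => W φ y j) (g' x j) (Set.Icc 0 1) x) ∧
          -- ... which is bounded ...
          (∀ x ∈ Set.Icc (0:ℝ) 1, ‖W φ x‖ + ‖g' x‖ ≤ C * ‖φ‖) ∧
          -- ... and whose composition with the inclusion `C¹ ↪ L²` is `U(t,s)`
          (∀ᵐ x ∂μ01, (U t s φ) x = W φ x) := by
  obtain ⟨S, hp, heo, hd0, hα, ha, hβ⟩ := exists_sys m p hH3 a b hab Λ₀ hΛ₀ hLam
  have R : SRel S m p a b := ⟨hp, heo, hd0, hα, ha, hβ⟩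
  refine ⟨S.HH / 2, by linarith [S.HH_pos hd0], fun s t hst => ?_⟩
  obtain ⟨C, C0, hC⟩ := limit_exists R hU (s := s) (T := t) (by linarith)
  choose g h hgh hb hae using hC
  have cg : ∀ φ, Continuous fun x => g φ (pI x) := fun φ => (g φ).continuous.comp pI_cont
  have ch : ∀ φ, Continuous fun x => h φ (pI x) := fun φ => (h φ).continuous.comp pI_cont
  have ext : ∀ f f' : C(I01, Vn n), (∀ x ∈ I01, f (pI x) = f' (pI x)) → ∀ x, f (pI x) = f' (pI x) := by
    intro f f' hf x
    have h1 := hf (pI x) (pI x).2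
    rwa [pI_mem (pI x).2] at h1
  let W : L2 n →ₗ[ℝ] (ℝ → Vn n) :=
    { toFun := fun φ x => g φ (pI x)
      map_add' := by
        intro φ ψ
        funext x
        refine ext (g (φ + ψ)) (g φ + g ψ) (uniq (cg _) ((cg φ).add (cg ψ)) ?_) x
        filter_upwards [hae (φ + ψ), hae φ, hae ψ, Lp.coeFn_add (U t s φ) (U t s ψ)] with z h1 h2 h3 h4
        rw [← h1, map_add, h4, Pi.add_apply, h2, h3]; rfl
      map_smul' := by
        intro c φ
        funext x
        refine ext (g (c • φ)) (c • g φ) (uniq (cg _) ((cg φ).const_smul c) ?_) x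
        filter_upwards [hae (c • φ), hae φ, Lp.coeFn_smul c (U t s φ)] with z h1 h2 h3
        rw [← h1, map_smul, h3, Pi.smul_apply, h2]; rfl }
  have hW : ∀ φ x, W φ x = g φ (pI x) := fun _ _ => rfl
  refine ⟨W, 2 * C, by positivity, fun φ => ⟨fun x => h φ (pI x), (cg φ).continuousOn, (ch φ).continuousOn,
    fun x hx j => ?_, fun x hx => ?_, hae φ⟩⟩
  · have cj : Continuous fun z => h φ (pI z) j :=
      (EuclideanSpace.proj j : Vn n →L[ℝ] ℝ).continuous.comp (ch φ)
    have h1 : HasDerivAt (fun z => ∫ w in (0:ℝ)..z, h φ (pI w) j) (h φ (pI x) j) x :=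
      intervalIntegral.integral_hasDerivAt_right (cj.intervalIntegrable _ _)
        (cj.stronglyMeasurableAtFilter _ _) cj.continuousAt
    have h2 := (h1.const_add (g φ (pI 0) j)).hasDerivWithinAt (s := Icc (0:ℝ) 1)
    refine h2.congr (fun z hz => ?_) ?_
    · rw [← hgh φ z hz j, hW]; ring
    · rw [← hgh φ x hx j, hW]; ring
  · have := hb φ (pI x)
    rw [hW]; linarith [this.1, this.2]
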